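/- Any two finite groups G and H, each of order 2^9 · 3^2 · 7 · 23 · 47^3 · 103 and each having prime graph degrees deg(2) = 3, deg(3) = 1, deg(7) = 1, deg(23) = 1, deg(47) = 1, deg(103) = 1, are isomorphic. -/

import Mathlib

/-- The degree of the prime `p` in the prime graph (Gruenberg–Kegel graph) `GK(G)` of the
group `G`: the number of primes `q ≠ p` such that `G` contains an element of order `p * q`
(two distinct primes being adjacent in `GK(G)` iff `G` has an element of order their
product). -/
noncomputable def gkDegree (G : Type*) [Group G] (p : ℕ) : ℕ :=
  Nat.card {q : ℕ // p ≠ q ∧ p.Prime ∧ q.Prime ∧ ∃ g : G, orderOf g = p * q}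

namespace OD

set_option linter.unusedSectionVars false

open MulAction

section Counting

variable {K α : Type*} [Group K] [Finite K] [Finite α]

theorem card_dvd_card_mul_of_stabilizer [MulAction K α] {c : ℕ}
    (h : ∀ a : α, Nat.card (stabilizer K a) ∣ c) : Nat.card K ∣ Nat.card α * c := by
  have := Fintype.ofFinite (orbitRel.Quotient K α)
  rw [Nat.card_congr (selfEquivSigmaOrbits K α), Nat.card_sigma, Finset.sum_mul]
  refine Finset.dvd_sum fun ω _ => ?_
  rw [Nat.card_congr (orbitEquivQuotientStabilizer K ω.out),
    Subgroup.card_eq_card_quotient_mul_card_subgroup (stabilizer K ω.out)]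
  exact mul_dvd_mul_left _ (h _)

/-- If a permutation representation leaves `Y` invariant and the orders of all point stabilizers
on `Y` divide `c`, then the order of the group divides `|Y| * c`. -/
theorem card_dvd_ncard_mul (φ : K →* Equiv.Perm α) {Y : Set α} (hY : ∀ k, ∀ a ∈ Y, φ k a ∈ Y)
    {c : ℕ} (h : ∀ a ∈ Y, {k | φ k a = a}.ncard ∣ c) : Nat.card K ∣ Y.ncard * c := by
  let _ : MulAction K Y :=
    { smul := fun k a => ⟨φ k a, hY k a a.2⟩
      one_smul := fun a => Subtype.ext (by change φ 1 a = a; simp)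
      mul_smul := fun k l a => Subtype.ext (by change φ (k * l) a = φ k (φ l a); simp) }
  have := card_dvd_card_mul_of_stabilizer (K := K) (α := Y) (c := c) fun a => by
    refine dvd_trans (Eq.dvd ?_) (h a a.2)
    rw [← Nat.card_coe_set_eq]
    exact Nat.card_congr (Equiv.subtypeEquivRight fun k => by
      rw [mem_stabilizer_iff, Subtype.ext_iff]; rfl)
  rwa [Nat.card_coe_set_eq] at this

theorem card_dvd_ncard_of_free (φ : K →* Equiv.Perm α) {Y : Set α}
    (hY : ∀ k, ∀ a ∈ Y, φ k a ∈ Y) (h : ∀ a ∈ Y, ∀ k, φ k a = a → k = 1) :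
    Nat.card K ∣ Y.ncard := by
  have := card_dvd_ncard_mul φ hY (c := 1) fun a ha => by
    rw [Nat.dvd_one, Set.ncard_eq_one]
    exact ⟨1, Set.ext fun k => ⟨fun hk => h a ha k hk, fun hk => by
      rw [Set.mem_singleton_iff.1 hk]; simp⟩⟩
  simpa using this

theorem ncard_modEq_ncard_fixed {p : ℕ} [Fact p.Prime] (hK : IsPGroup p K)
    (φ : K →* Equiv.Perm α) {Y : Set α} (hY : ∀ k, ∀ a ∈ Y, φ k a ∈ Y) :
    Y.ncard ≡ {a ∈ Y | ∀ k, φ k a = a}.ncard [MOD p] := by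
  let _ : MulAction K Y :=
    { smul := fun k a => ⟨φ k a, hY k a a.2⟩
      one_smul := fun a => Subtype.ext (by change φ 1 a = a; simp)
      mul_smul := fun k l a => Subtype.ext (by change φ (k * l) a = φ k (φ l a); simp) }
  have := hK.card_modEq_card_fixedPoints Y
  rw [Nat.card_coe_set_eq, Nat.card_coe_set_eq] at this
  convert this using 1
  rw [← Set.ncard_image_of_injective _ Subtype.val_injective]
  congr 1
  ext a
  simp only [Set.mem_ofPred_eq, Set.mem_image, mem_fixedPoints, Subtype.exists,
    exists_and_right, exists_eq_right, Subtype.ext_iff]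
  exact ⟨fun h => ⟨h.1, h.2⟩, fun h => ⟨h.1, h.2⟩⟩

end Counting

section Conj

variable {G : Type*} [Group G]

/-- The conjugation action of a subgroup on the ambient group. -/
def conjHom (K : Subgroup G) : K →* Equiv.Perm G :=
  (MulAut.toPerm G).comp (MulAut.conj.comp K.subtype)

@[simp] theorem conjHom_apply (K : Subgroup G) (k : K) (x : G) :
    conjHom K k x = k * x * (k : G)⁻¹ := rfl

variable [Finite G]

theorem card_dvd_ncard_of_conj_free (K : Subgroup G) {Y : Set G}
    (hY : ∀ k ∈ K, ∀ a ∈ Y, k * a * k⁻¹ ∈ Y)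
    (h : ∀ a ∈ Y, ∀ k ∈ K, k * a * k⁻¹ = a → k = 1) : Nat.card K ∣ Y.ncard :=
  card_dvd_ncard_of_free (conjHom K) (fun k a ha => hY k k.2 a ha)
    fun a ha k hk => Subtype.ext (h a ha k k.2 hk)

theorem ncard_modEq_ncard_conj_fixed {p : ℕ} [Fact p.Prime] {K : Subgroup G} (hK : IsPGroup p K)
    {Y : Set G} (hY : ∀ k ∈ K, ∀ a ∈ Y, k * a * k⁻¹ ∈ Y) :
    Y.ncard ≡ {a ∈ Y | ∀ k ∈ K, k * a * k⁻¹ = a}.ncard [MOD p] := by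
  convert ncard_modEq_ncard_fixed hK (conjHom K) (fun k a ha => hY k k.2 a ha) using 2
  ext a
  simp

theorem ncard_ne_one_eq (K : Subgroup G) : {a | a ∈ K ∧ a ≠ 1}.ncard = Nat.card K - 1 := by
  have : {a | a ∈ K ∧ a ≠ 1} = (K : Set G) \ {1} := by ext; simp
  rw [this, Set.ncard_sdiff_singleton_of_mem (K.one_mem), ← Nat.card_coe_set_eq]
  rfl

theorem mul_mul_inv_eq_iff {k a : G} : k * a * k⁻¹ = a ↔ k * a = a * k := by
  rw [mul_inv_eq_iff_eq_mul]

end Conj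

section PrimeGraph

variable (G : Type*) [Group G]

/-- Adjacency in the prime graph. -/
def GKAdj (p q : ℕ) : Prop := p ≠ q ∧ p.Prime ∧ q.Prime ∧ ∃ g : G, orderOf g = p * q

variable {G}

theorem GKAdj.symm {p q : ℕ} (h : GKAdj G p q) : GKAdj G q p :=
  ⟨h.1.symm, h.2.2.1, h.2.1, by obtain ⟨g, hg⟩ := h.2.2.2; exact ⟨g, by rw [hg, mul_comm]⟩⟩

theorem GKAdj.of_commute {p q : ℕ} (hp : p.Prime) (hq : q.Prime) (hpq : p ≠ q) {x y : G}
    (hx : orderOf x = p) (hy : orderOf y = q) (h : x * y = y * x) : GKAdj G p q := by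
  refine ⟨hpq, hp, hq, x * y, ?_⟩
  have : Commute x y := h
  rw [this.orderOf_mul_eq_mul_orderOf_of_coprime, hx, hy]
  rw [hx, hy]
  exact (Nat.coprime_primes hp hq).2 hpq

theorem GKAdj.exists_commute {p q : ℕ} (h : GKAdj G p q) :
    ∃ x y : G, orderOf x = p ∧ orderOf y = q ∧ x * y = y * x := by
  obtain ⟨-, hp, hq, g, hg⟩ := h
  refine ⟨g ^ q, g ^ p, ?_, ?_, ((Commute.refl g).pow_pow q p)⟩
  · rw [orderOf_pow_of_dvd hq.ne_zero (by rw [hg]; exact dvd_mul_left _ _), hg,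
      Nat.mul_div_cancel _ hq.pos]
  · rw [orderOf_pow_of_dvd hp.ne_zero (by rw [hg]; exact dvd_mul_right _ _), hg,
      Nat.mul_div_cancel_left _ hp.pos]

theorem GKAdj.dvd_card {p q : ℕ} [Finite G] (h : GKAdj G p q) : q ∣ Nat.card G := by
  obtain ⟨-, -, -, g, hg⟩ := h
  exact (Dvd.intro_left _ hg.symm).trans (orderOf_dvd_natCard g)

theorem exists_unique_adj {p : ℕ} (h : gkDegree G p = 1) : ∃ q, ∀ r, GKAdj G p r ↔ r = q := by
  obtain ⟨hs, ⟨⟨q, hq⟩⟩⟩ := Nat.card_eq_one_iff_unique.1 h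
  refine ⟨q, fun r => ⟨fun hr => ?_, fun hr => hr ▸ hq⟩⟩
  exact congrArg Subtype.val (hs.elim ⟨r, hr⟩ ⟨q, hq⟩)

theorem GKAdj.eq_of_degree_eq_one {p q r : ℕ} (h : gkDegree G p = 1) (hq : GKAdj G p q)
    (hr : GKAdj G p r) : r = q := by
  obtain ⟨s, hs⟩ := exists_unique_adj h
  rw [(hs r).1 hr, (hs q).1 hq]

/-- The prime divisors of the order of the centralizer of an element of prime order `p`. -/
theorem dvd_card_centralizer {p q : ℕ} [Finite G] (hp : p.Prime) (hq : q.Prime) (hpq : p ≠ q)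
    {x : G} (hx : orderOf x = p) (h : q ∣ Nat.card (Subgroup.centralizer {x})) : GKAdj G p q := by
  have := Fact.mk hq
  obtain ⟨y, hy⟩ := exists_prime_orderOf_dvd_card' q h
  refine GKAdj.of_commute hp hq hpq hx (y := (y : G)) (by rw [← hy]; simp) ?_
  exact (Subgroup.mem_centralizer_iff.1 y.2 x rfl)

end PrimeGraph

end OD

namespace OD
set_option linter.unusedSectionVars false
open Subgroup

section
variable {G : Type*} [Group G] [Finite G]

theorem centralizer_zpowers_eq (s : G) :
    centralizer (zpowers s : Set G) = centralizer {s} := by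
  rw [zpowers_eq_closure, centralizer_closure]

theorem card_normalizer_zpowers {r : ℕ} (hr : r.Prime) {s : G} (hs : orderOf s = r) :
    ∃ k, k ∣ r - 1 ∧ Nat.card (normalizer (zpowers s : Set G)) =
      Nat.card (centralizer ({s} : Set G)) * k := by
  let φ := (zpowers s).normalizerMonoidHom
  refine ⟨Nat.card φ.range, ?_, ?_⟩
  · have h := card_subgroup_dvd_card φ.range
    rwa [IsCyclic.card_mulAut, Nat.card_zpowers, hs, Nat.totient_prime hr] at h
  · have h1 : Nat.card φ.ker = Nat.card (centralizer ({s} : Set G)) := by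
      rw [normalizerMonoidHom_ker, ← centralizer_zpowers_eq]
      exact Nat.card_congr (subgroupOfEquivOfLe (centralizer_le_normalizer _)).toEquiv
    rw [← h1, ← card_mul_index φ.ker, index_ker]

theorem exists_sylow_count {r : ℕ} (hr : r.Prime) {s : G} (hs : orderOf s = r)
    (h2 : ¬ r ^ 2 ∣ Nat.card G) :
    ∃ n, n ≡ 1 [MOD r] ∧ Nat.card G = n * Nat.card (normalizer (zpowers s : Set G)) := by
  have := Fact.mk hr
  have hc : Nat.card (zpowers s) = r ^ (Nat.card G).factorization r := by
    have h1 : (Nat.card G).factorization r = 1 := by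
      have hd : r ∣ Nat.card G := hs ▸ orderOf_dvd_natCard s
      have h0 := Nat.card_pos (α := G).ne'
      have := (hr.dvd_iff_one_le_factorization h0).1 hd
      have := mt (hr.pow_dvd_iff_le_factorization h0).2 h2
      omega
    rw [Nat.card_zpowers, hs, h1, pow_one]
  let S : Sylow r G := Sylow.ofCard (zpowers s) hc
  refine ⟨_, card_sylow_modEq_one r G, ?_⟩
  rw [S.card_eq_index_normalizer]
  exact (index_mul_card _).symm

/-- If all primes other than `r` dividing `c` are equal to `q`, and `r` divides `c` just once. -/
theorem eq_mul_pow_of_primes {c r q : ℕ} (hr : r.Prime) (hc : r ∣ c) (h0 : c ≠ 0)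
    (h2 : ¬ r ^ 2 ∣ c) (h : ∀ p, p.Prime → p ≠ r → p ∣ c → p = q) : ∃ j, c = r * q ^ j := by
  obtain ⟨d, rfl⟩ := hc
  refine ⟨d.primeFactorsList.length, ?_⟩
  congr 1
  refine Nat.eq_prime_pow_of_unique_prime_dvd (by rintro rfl; simp at h0) fun {p} hp hpd => ?_
  refine h p hp ?_ (hpd.mul_left r)
  rintro rfl
  exact h2 (by rw [pow_two]; exact mul_dvd_mul_left _ hpd)

end

/-- The order and the prime graph of `U_3(47)`. -/
structure HasPattern (G : Type*) [Group G] : Prop where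
  card : Nat.card G = 2 ^ 9 * 3 ^ 2 * 7 * 23 * 47 ^ 3 * 103
  adj_two : GKAdj G 2 3 ∧ GKAdj G 2 23 ∧ GKAdj G 2 47
  adj_three : ∀ r, GKAdj G 3 r → r = 2
  adj_seven : ∀ r, GKAdj G 7 r → r = 103
  adj_23 : ∀ r, GKAdj G 23 r → r = 2
  adj_47 : ∀ r, GKAdj G 47 r → r = 2
  adj_103 : ∀ r, GKAdj G 103 r → r = 7
  card_normalizer_103 : ∀ s : G, orderOf s = 103 →
    Nat.card (normalizer (zpowers s : Set G)) = 103 * 21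

variable {G : Type*} [Group G] [Finite G]

theorem prime_dvd_order {p : ℕ} (hp : p.Prime)
    (h : p ∣ 2 ^ 9 * 3 ^ 2 * 7 * 23 * 47 ^ 3 * 103) :
    p = 2 ∨ p = 3 ∨ p = 7 ∨ p = 23 ∨ p = 47 ∨ p = 103 := by
  rw [hp.dvd_mul, hp.dvd_mul, hp.dvd_mul, hp.dvd_mul, hp.dvd_mul] at h
  rcases h with ((((h | h) | h) | h) | h) | h
  · exact Or.inl ((Nat.prime_dvd_prime_iff_eq hp (by norm_num)).1 (hp.dvd_of_dvd_pow h))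
  · exact Or.inr (Or.inl ((Nat.prime_dvd_prime_iff_eq hp (by norm_num)).1 (hp.dvd_of_dvd_pow h)))
  · have := (Nat.prime_dvd_prime_iff_eq hp (by norm_num)).1 h; omega
  · have := (Nat.prime_dvd_prime_iff_eq hp (by norm_num)).1 h; omega
  · have := (Nat.prime_dvd_prime_iff_eq hp (by norm_num)).1 (hp.dvd_of_dvd_pow h); omega
  · have := (Nat.prime_dvd_prime_iff_eq hp (by norm_num)).1 h; omega

theorem exists_orderOf_eq (hG : Nat.card G = 2 ^ 9 * 3 ^ 2 * 7 * 23 * 47 ^ 3 * 103) {p : ℕ}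
    (hp : p.Prime) (h : p ∣ 2 ^ 9 * 3 ^ 2 * 7 * 23 * 47 ^ 3 * 103) : ∃ s : G, orderOf s = p := by
  have := Fact.mk hp
  exact exists_prime_orderOf_dvd_card' p (hG ▸ h)

theorem card_normalizer_103 (hG : Nat.card G = 2 ^ 9 * 3 ^ 2 * 7 * 23 * 47 ^ 3 * 103) {q : ℕ}
    (hq : ∀ r, GKAdj G 103 r ↔ r = q) {s : G} (hs : orderOf s = 103) :
    q = 7 ∧ Nat.card (normalizer (zpowers s : Set G)) = 103 * 21 := by
  have hp : Nat.Prime 103 := by norm_num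
  have h2 : ¬ 103 ^ 2 ∣ Nat.card G := by rw [hG]; norm_num
  obtain ⟨n, hn, hnG⟩ := exists_sylow_count hp hs h2
  obtain ⟨k, hk, hkN⟩ := card_normalizer_zpowers hp hs
  have hCG : Nat.card (centralizer ({s} : Set G)) ∣ Nat.card G := card_subgroup_dvd_card _
  have hkG : k ∣ Nat.card G := (Dvd.intro_left _ hkN.symm).trans (card_subgroup_dvd_card _)
  have hsC : 103 ∣ Nat.card (centralizer ({s} : Set G)) := by
    rw [← centralizer_zpowers_eq]
    have := card_dvd_of_le (le_centralizer (zpowers s))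
    rwa [Nat.card_zpowers, hs] at this
  obtain ⟨j, hj⟩ := eq_mul_pow_of_primes (q := q) hp hsC Nat.card_pos.ne'
    (fun h => h2 (h.trans hCG))
    (fun p hpp hne hd => (hq p).1 (dvd_card_centralizer hp hpp hne.symm hs hd))
  have hadj : GKAdj G 103 q := (hq q).2 rfl
  have hqG := hadj.dvd_card
  rw [hG] at hqG hkG hnG
  rw [hkN, hj] at hnG ⊢
  have hjG : q ^ j ∣ 2 ^ 9 * 3 ^ 2 * 7 * 23 * 47 ^ 3 * 103 := by
    rw [hj, hG] at hCG
    exact (Dvd.intro_left _ rfl).trans hCG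
  have hmod : q ^ j * k % 103 = 21 := by
    have e : 2 ^ 9 * 3 ^ 2 * 7 * 23 * 47 ^ 3 = n * (q ^ j * k) :=
      Nat.eq_of_mul_eq_mul_left (show 0 < 103 by norm_num) (by linarith)
    have h3 := hn.mul_right (q ^ j * k)
    rw [← e, one_mul] at h3
    have h4 : _ % 103 = q ^ j * k % 103 := h3
    omega
  have hk6 : k ∣ 6 := by
    have := Nat.dvd_gcd hk hkG
    norm_num at this
    exact this
  have hk' : k = 1 ∨ k = 2 ∨ k = 3 ∨ k = 6 := by
    have := Nat.le_of_dvd (by norm_num) hk6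
    interval_cases k <;> omega
  have key : ∀ e, ¬ q ^ (e + 1) ∣ 2 ^ 9 * 3 ^ 2 * 7 * 23 * 47 ^ 3 * 103 → j ≤ e := fun e he => by
    by_contra hlt
    exact he ((pow_dvd_pow q (by omega)).trans hjG)
  suffices h : q = 7 ∧ j = 1 ∧ k = 3 by
    obtain ⟨rfl, rfl, rfl⟩ := h
    norm_num
  rcases prime_dvd_order hadj.2.2.1 hqG with rfl | rfl | rfl | rfl | rfl | rfl
  · have := key 9 (by norm_num)
    interval_cases j <;> rcases hk' with rfl | rfl | rfl | rfl <;> omega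
  · have := key 2 (by norm_num)
    interval_cases j <;> rcases hk' with rfl | rfl | rfl | rfl <;> omega
  · have := key 1 (by norm_num)
    interval_cases j <;> rcases hk' with rfl | rfl | rfl | rfl <;> omega
  · have := key 1 (by norm_num)
    interval_cases j <;> rcases hk' with rfl | rfl | rfl | rfl <;> omega
  · have := key 3 (by norm_num)
    interval_cases j <;> rcases hk' with rfl | rfl | rfl | rfl <;> omega
  · exact absurd rfl hadj.1

theorem hasPattern (hG : Nat.card G = 2 ^ 9 * 3 ^ 2 * 7 * 23 * 47 ^ 3 * 103)
    (h2 : gkDegree G 2 = 3) (h3 : gkDegree G 3 = 1) (h7 : gkDegree G 7 = 1)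
    (h23 : gkDegree G 23 = 1) (h47 : gkDegree G 47 = 1) (h103 : gkDegree G 103 = 1) :
    HasPattern G := by
  obtain ⟨q, hq⟩ := exists_unique_adj h103
  obtain ⟨s, hs⟩ := exists_orderOf_eq hG (p := 103) (by norm_num) (by norm_num)
  obtain rfl := (card_normalizer_103 hG hq hs).1
  have a7 : GKAdj G 7 103 := ((hq 7).2 rfl).symm
  have hsub : {q | GKAdj G 2 q} ⊆ ({3, 23, 47} : Finset ℕ) := by
    intro r (hr : GKAdj G 2 r)
    have := hr.dvd_card
    rw [hG] at this
    rcases prime_dvd_order hr.2.2.1 this with rfl | rfl | rfl | rfl | rfl | rfl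
    · exact absurd rfl hr.1
    · simp
    · exact absurd (GKAdj.eq_of_degree_eq_one h7 a7 hr.symm) (by norm_num)
    · simp
    · simp
    · exact absurd ((hq 2).1 hr.symm) (by norm_num)
  have hcard : {q | GKAdj G 2 q}.ncard = 3 := by
    rw [← h2, ← Nat.card_coe_set_eq]; rfl
  have heq : {q | GKAdj G 2 q} = ({3, 23, 47} : Finset ℕ) :=
    Set.eq_of_subset_of_ncard_le hsub (by rw [hcard, Set.ncard_coe_finset]; rfl)
      (Finset.finite_toSet _)
  have hmem : ∀ q ∈ ({3, 23, 47} : Finset ℕ), GKAdj G 2 q := fun q hq => by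
    have : q ∈ {q | GKAdj G 2 q} := heq ▸ hq
    exact this
  have a3 := hmem 3 (by simp)
  have a23 := hmem 23 (by simp)
  have a47 := hmem 47 (by simp)
  exact
    { card := hG
      adj_two := ⟨a3, a23, a47⟩
      adj_three := fun r hr => GKAdj.eq_of_degree_eq_one h3 a3.symm hr
      adj_seven := fun r hr => GKAdj.eq_of_degree_eq_one h7 a7 hr
      adj_23 := fun r hr => GKAdj.eq_of_degree_eq_one h23 a23.symm hr
      adj_47 := fun r hr => GKAdj.eq_of_degree_eq_one h47 a47.symm hr
      adj_103 := fun r hr => (hq r).1 hr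
      card_normalizer_103 := fun s hs => (card_normalizer_103 hG hq hs).2 }

end OD

namespace OD
set_option linter.unusedSectionVars false
open Subgroup

variable {G : Type*} [Group G] [Finite G]

theorem exists_pow_orderOf_eq {p : ℕ} [hp : Fact p.Prime] {P : Subgroup G} (hP : IsPGroup p P) {a : G}
    (ha : a ∈ P) (h1 : a ≠ 1) : ∃ m : ℕ, orderOf (a ^ m) = p := by
  obtain ⟨k, hk⟩ := (IsPGroup.iff_orderOf.1 hP) ⟨a, ha⟩
  rw [Subgroup.orderOf_mk] at hk
  have hk0 : k ≠ 0 := by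
    rintro rfl
    exact h1 (by simpa using hk)
  obtain ⟨j, rfl⟩ := Nat.exists_eq_succ_of_ne_zero hk0
  refine ⟨p ^ j, ?_⟩
  rw [orderOf_pow_of_dvd (pow_ne_zero _ hp.out.ne_zero) (by rw [hk]; exact pow_dvd_pow _ (by omega)), hk,
    Nat.pow_div (by omega) hp.out.pos]
  simp

theorem GKAdj.of_commute_of_mem {p r : ℕ} [hp : Fact p.Prime] (hr : r.Prime) (hrp : r ≠ p)
    {P : Subgroup G} (hP : IsPGroup p P) {a x : G} (ha : a ∈ P) (h1 : a ≠ 1) (hx : orderOf x = r)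
    (h : x * a = a * x) : GKAdj G r p := by
  obtain ⟨m, hm⟩ := exists_pow_orderOf_eq hP ha h1
  exact GKAdj.of_commute hr hp.out hrp hx hm ((show Commute x a from h).pow_right m)

theorem orderOf_of_mem_zpowers {r : ℕ} (hr : r.Prime) {g k : G} (hg : orderOf g = r)
    (hk : k ∈ zpowers g) (h1 : k ≠ 1) : orderOf k = r := by
  have h := orderOf_dvd_of_mem_zpowers hk
  rw [hg] at h
  rcases (Nat.dvd_prime hr).1 h with h | h
  · exact absurd (orderOf_eq_one_iff.1 h) h1
  · exact h

/-- An element of prime order `r` normalizing a subgroup, without nontrivial fixed points. -/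
theorem prime_dvd_card_sub_one {r : ℕ} (hr : r.Prime) {P : Subgroup G} {g : G} (hg : orderOf g = r)
    (hN : g ∈ normalizer (P : Set G))
    (h : ∀ x : G, orderOf x = r → ∀ a ∈ P, a ≠ 1 → x * a ≠ a * x) : r ∣ Nat.card P - 1 := by
  rw [← hg, ← Nat.card_zpowers, ← ncard_ne_one_eq]
  refine card_dvd_ncard_of_conj_free (zpowers g) (fun k hk a ha => ⟨?_, ?_⟩) fun a ha k hk hka => ?_
  · exact (mem_normalizer_iff.1 ((zpowers_le.2 hN) hk) a).1 ha.1
  · exact fun h => ha.2 (by simpa using h)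
  · by_contra h1
    exact h k (orderOf_of_mem_zpowers hr hg hk h1) a ha.1 ha.2 (mul_mul_inv_eq_iff.1 hka)

namespace HasPattern

theorem factorization (hG : HasPattern G) {p e m : ℕ} (hp : p.Prime)
    (h : 2 ^ 9 * 3 ^ 2 * 7 * 23 * 47 ^ 3 * 103 = p ^ e * m) (hm : ¬ p ∣ m) :
    (Nat.card G).factorization p = e := by
  rw [hG.card, h, Nat.factorization_mul (pow_ne_zero _ hp.ne_zero) (by rintro rfl; simp at hm),
    hp.factorization_pow]
  simp [Nat.factorization_eq_zero_of_not_dvd hm]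

local instance fact47 : Fact (Nat.Prime 47) := ⟨by norm_num⟩

theorem card_sylow_47 (hG : HasPattern G) (P : Sylow 47 G) : Nat.card P = 47 ^ 3 := by
  rw [P.card_eq_multiplicity, hG.factorization (e := 3) (m := 2 ^ 9 * 3 ^ 2 * 7 * 23 * 103)] <;> norm_num

theorem not_commute_47 (hG : HasPattern G) {r : ℕ} (hr : r.Prime) (h2 : r ≠ 2) (h47 : r ≠ 47)
    {P : Subgroup G} (hP : IsPGroup 47 P) {x a : G} (hx : orderOf x = r) (ha : a ∈ P) (h1 : a ≠ 1) :
    x * a ≠ a * x := fun h =>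
  h2 (hG.adj_47 r (GKAdj.of_commute_of_mem hr h47 hP ha h1 hx h).symm)

theorem card_normalizer_47 (hG : HasPattern G) (P : Sylow 47 G) :
    Nat.card (normalizer (P : Set G)) = 47 ^ 3 * 736 ∧ Nat.card (Sylow 47 G) = 47 ^ 3 + 1 := by
  have hPc := hG.card_sylow_47 P
  have hn := card_sylow_modEq_one 47 G
  have hN : Nat.card G = Nat.card (Sylow 47 G) * Nat.card (normalizer (P : Set G)) := by
    rw [P.card_eq_index_normalizer, index_mul_card]
  obtain ⟨m, hm⟩ : 47 ^ 3 ∣ Nat.card (normalizer (P : Set G)) := by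
    have h := card_dvd_of_le (le_normalizer (H := (P : Subgroup G)))
    exact hPc ▸ h
  have hr : ∀ r, r.Prime → r ≠ 2 → r ≠ 47 → r ∣ m → r ∣ 47 ^ 3 - 1 := by
    intro r hr h2 h47 hrm
    have := Fact.mk hr
    obtain ⟨g, hg⟩ := exists_prime_orderOf_dvd_card' r (hm ▸ hrm.mul_left (47 ^ 3))
    rw [← hPc]
    exact prime_dvd_card_sub_one hr (g := (g : G)) (by rw [← hg]; simp) g.2
      fun x hx a ha h1 => hG.not_commute_47 hr h2 h47 P.2 hx ha h1
  rw [hG.card, hm] at hN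
  generalize Nat.card (Sylow 47 G) = n at *
  rw [hm]
  have hN' : 2 ^ 9 * 3 ^ 2 * 7 * 23 * 103 = n * m :=
    Nat.eq_of_mul_eq_mul_left (show 0 < 47 ^ 3 by norm_num) (by linarith)
  have hmd : m ∣ 2 ^ 9 * 23 := by
    have h3 : Nat.Coprime m 3 := ((Nat.Prime.coprime_iff_not_dvd (by norm_num)).2 fun h =>
      absurd (hr 3 (by norm_num) (by norm_num) (by norm_num) h) (by norm_num)).symm
    have h7 : Nat.Coprime m 7 := ((Nat.Prime.coprime_iff_not_dvd (by norm_num)).2 fun h =>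
      absurd (hr 7 (by norm_num) (by norm_num) (by norm_num) h) (by norm_num)).symm
    have h103 : Nat.Coprime m 103 := ((Nat.Prime.coprime_iff_not_dvd (by norm_num)).2 fun h =>
      absurd (hr 103 (by norm_num) (by norm_num) (by norm_num) h) (by norm_num)).symm
    have hd : m ∣ 2 ^ 9 * 23 * (3 ^ 2 * 7 * 103) := Dvd.intro_left n (hN'.symm.trans (by norm_num))
    exact Nat.Coprime.dvd_of_dvd_mul_right
      (((h3.pow_right 2).mul_right h7).mul_right h103) hd
  have hmod : m % 47 = 31 := by
    have h3 : _ % 47 = _ % 47 := hn.mul_right m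
    rw [← hN', one_mul] at h3
    omega
  have hm736 : m = 736 := by
    obtain ⟨a, b, ha, hb, rfl⟩ := (Nat.dvd_mul).1 hmd
    obtain ⟨i, hi, rfl⟩ := (Nat.dvd_prime_pow Nat.prime_two).1 ha
    rcases (Nat.dvd_prime (by norm_num)).1 hb with rfl | rfl <;> interval_cases i <;> omega
  subst hm736
  omega

theorem card_centralizer_23 (hG : HasPattern G) {s : G} (hs : orderOf s = 23) :
    Nat.card (centralizer ({s} : Set G)) = 736 := by
  have hp : Nat.Prime 23 := by norm_num
  have h2 : ¬ 23 ^ 2 ∣ Nat.card G := by rw [hG.card]; norm_num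
  obtain ⟨n, hn, hnG⟩ := exists_sylow_count hp hs h2
  obtain ⟨k, hk, hkN⟩ := card_normalizer_zpowers hp hs
  have hCG : Nat.card (centralizer ({s} : Set G)) ∣ Nat.card G := card_subgroup_dvd_card _
  have hkG : k ∣ Nat.card G := (Dvd.intro_left _ hkN.symm).trans (card_subgroup_dvd_card _)
  have hsC : 23 ∣ Nat.card (centralizer ({s} : Set G)) := by
    rw [← centralizer_zpowers_eq]
    have := card_dvd_of_le (le_centralizer (zpowers s))
    rwa [Nat.card_zpowers, hs] at this
  obtain ⟨j, hj⟩ := eq_mul_pow_of_primes (q := 2) hp hsC Nat.card_pos.ne'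
    (fun h => h2 (h.trans hCG))
    (fun p hpp hne hd => hG.adj_23 p (dvd_card_centralizer hp hpp hne.symm hs hd))
  have hk1 : k ≠ 1 := by
    rintro rfl
    have := Fact.mk hp
    have hc : Nat.card (zpowers s) = 23 ^ (Nat.card G).factorization 23 := by
      rw [hG.factorization (e := 1) (m := 2 ^ 9 * 3 ^ 2 * 7 * 47 ^ 3 * 103), Nat.card_zpowers, hs] <;>
        norm_num
    let S : Sylow 23 G := Sylow.ofCard (zpowers s) hc
    have hle : normalizer (S : Set G) ≤ centralizer (S : Set G) := by
      have h := centralizer_le_normalizer (zpowers s : Set G)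
      refine (Subgroup.eq_of_le_of_card_ge h ?_).ge
      rw [centralizer_zpowers_eq, hkN, mul_one]
    set M := (MonoidHom.transferSylow S hle).ker with hM
    have hcomp : M.index = 23 := by
      rw [(MonoidHom.ker_transferSylow_isComplement' S hle).symm.index_eq_card]
      exact (Nat.card_zpowers s).trans hs
    have hcard := M.index_mul_card
    rw [hcomp, hG.card] at hcard
    have := Fact.mk (show Nat.Prime 103 by norm_num)
    obtain ⟨t, ht⟩ := exists_prime_orderOf_dvd_card' 103 (show 103 ∣ Nat.card M by omega)
    have hct : Nat.card (zpowers t) = 103 ^ (Nat.card M).factorization 103 := by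
      rw [show Nat.card M = 103 * (2 ^ 9 * 3 ^ 2 * 7 * 47 ^ 3) by omega,
        Nat.factorization_mul (by norm_num) (by norm_num), Nat.card_zpowers, ht]
      have : Nat.factorization (2 ^ 9 * 3 ^ 2 * 7 * 47 ^ 3) 103 = 0 :=
        Nat.factorization_eq_zero_of_not_dvd (by norm_num)
      rw [Finsupp.add_apply, this, Nat.Prime.factorization_self (by norm_num)]
      norm_num
    have hfr := Sylow.normalizer_sup_eq_top (Sylow.ofCard (zpowers t) hct)
    have hmap : (zpowers t).map M.subtype = zpowers (t : G) := by
      rw [MonoidHom.map_zpowers]; rfl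
    change normalizer (((zpowers t).map M.subtype : Subgroup G) : Set G) ⊔ M = ⊤ at hfr
    rw [hmap] at hfr
    have h103 := hG.card_normalizer_103 (t : G) (by rw [← ht]; simp)
    have hrel := Subgroup.relIndex_sup_right (normalizer (zpowers (t : G) : Set G)) M
    rw [hfr, relIndex_top_right, hcomp] at hrel
    have hdvd := Subgroup.relIndex_dvd_card M (normalizer (zpowers (t : G) : Set G))
    rw [← hrel, h103] at hdvd
    norm_num at hdvd
  have hk2 : k = 2 := by
    rw [hG.card] at hkG
    have := Nat.dvd_gcd hk hkG
    norm_num at this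
    have h := Nat.le_of_dvd (by norm_num) this
    interval_cases k <;> omega
  subst hk2
  have hjG : 2 ^ j ∣ 2 ^ 9 * 3 ^ 2 * 7 * 23 * 47 ^ 3 * 103 := by
    rw [hj, hG.card] at hCG
    exact (Dvd.intro_left _ rfl).trans hCG
  have hj9 : j ≤ 9 := by
    by_contra hlt
    exact absurd ((pow_dvd_pow 2 (show 10 ≤ j by omega)).trans hjG) (by norm_num)
  rw [hG.card, hkN, hj] at hnG
  have e : 2 ^ 9 * 3 ^ 2 * 7 * 47 ^ 3 * 103 = n * (2 ^ j * 2) :=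
      Nat.eq_of_mul_eq_mul_left (show 0 < 23 by norm_num) (by linarith)
  have h3 : _ % 23 = _ % 23 := hn.mul_right (2 ^ j * 2)
  rw [← e, one_mul] at h3
  rw [hj]
  interval_cases j <;> omega

end HasPattern
end OD

namespace OD
set_option linter.unusedSectionVars false
open Subgroup
open scoped Pointwise

variable {G : Type*} [Group G] [Finite G]

theorem mem_smul_sylow {p : ℕ} {P : Sylow p G} {g x : G} : x ∈ g • P ↔ g⁻¹ * x * g ∈ P := by
  change x ∈ MulAut.conj g • (P : Subgroup G) ↔ _
  rw [Subgroup.mem_pointwise_smul_iff_inv_smul_mem]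
  simp [MulAut.smul_def, ← map_inv]
  rfl

/-- The center of a Sylow subgroup, as a subgroup of the whole group. -/
def sylowCenter {p : ℕ} (P : Sylow p G) : Subgroup G := P ⊓ centralizer (P : Set G)

theorem mem_sylowCenter {p : ℕ} {P : Sylow p G} {z : G} :
    z ∈ sylowCenter P ↔ z ∈ P ∧ ∀ x ∈ P, x * z = z * x := by
  rw [sylowCenter, mem_inf, mem_centralizer_iff]; rfl

theorem smul_mem_sylowCenter {p : ℕ} {P : Sylow p G} {z g : G} (h : z ∈ sylowCenter P) :
    g * z * g⁻¹ ∈ sylowCenter (g • P) := by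
  rw [mem_sylowCenter] at h ⊢
  refine ⟨mem_smul_sylow.2 (by simpa [mul_assoc] using h.1), fun x hx => ?_⟩
  have := h.2 _ (mem_smul_sylow.1 hx)
  calc x * (g * z * g⁻¹) = g * (g⁻¹ * x * g * z) * g⁻¹ := by group
    _ = g * (z * (g⁻¹ * x * g)) * g⁻¹ := by rw [this]
    _ = _ := by group

namespace HasPattern

local instance : Fact (Nat.Prime 47) := ⟨by norm_num⟩


theorem exists_sylow_centralizer (hG : HasPattern G) {P : Sylow 47 G} {x : G} (hx : x ∈ P)
    (h1 : x ≠ 1) :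
    ∃ R : Sylow 47 G, ∀ T : Subgroup G, IsPGroup 47 T → T ≤ centralizer {x} → T ≤ R := by
  set C := centralizer ({x} : Set G)
  have hprimes : ∀ r, r.Prime → r ∣ Nat.card C → r = 2 ∨ r = 47 := by
    intro r hr hd
    by_contra! hne
    have := Fact.mk hr
    obtain ⟨y, hy⟩ := exists_prime_orderOf_dvd_card' r hd
    exact hG.not_commute_47 hr hne.1 hne.2 P.2 (x := (y : G)) (by rw [← hy]; simp) hx h1
      (mem_centralizer_iff.1 y.2 x rfl).symm
  have hmod := card_sylow_modEq_one 47 C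
  have hcard : Nat.card (Sylow 47 C) = 1 := by
    obtain ⟨Q⟩ : Nonempty (Sylow 47 C) := inferInstance
    have hd : Nat.card (Sylow 47 C) ∣ Nat.card C := by
      rw [Q.card_eq_index_normalizer]; exact index_dvd_card _
    have hpow := Nat.eq_prime_pow_of_unique_prime_dvd (p := 2) (n := Nat.card (Sylow 47 C))
      Nat.card_pos.ne' fun {d} hdp hdd => by
        rcases hprimes d hdp (hdd.trans hd) with h | rfl
        · exact h
        · exact absurd (hmod.symm.dvd_iff (dvd_refl 47) |>.2 hdd) (by norm_num)
    generalize (Nat.card (Sylow 47 C)).primeFactorsList.length = j at hpow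
    have hjG := hd.trans (card_subgroup_dvd_card C)
    rw [hpow] at hjG hmod ⊢
    rw [hG.card] at hjG
    have hj9 : j ≤ 9 := by
      by_contra hlt
      exact absurd ((pow_dvd_pow 2 (show 10 ≤ j by omega)).trans hjG) (by norm_num)
    have hmod' : 2 ^ j % 47 = 1 % 47 := hmod
    interval_cases j <;> omega
  obtain ⟨hsub, ⟨Q⟩⟩ := Nat.card_eq_one_iff_unique.1 hcard
  obtain ⟨R, hR⟩ := (Q.2.map C.subtype).exists_le_sylow
  refine ⟨R, fun T hT hTC => ?_⟩
  obtain ⟨Q', hQ'⟩ := (hT.comap_of_injective C.subtype C.subtype_injective).exists_le_sylow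
  intro t ht
  refine hR ⟨⟨t, hTC ht⟩, ?_, rfl⟩
  rw [hsub.elim Q Q']
  exact hQ' ht

/-- A `47`-subgroup commuting with a nontrivial central element of `P` is contained in `P`. -/
theorem le_of_le_centralizer (hG : HasPattern G) {P : Sylow 47 G} {z : G} (hz : z ∈ sylowCenter P)
    (h1 : z ≠ 1) {T : Subgroup G} (hT : IsPGroup 47 T) (h : ∀ t ∈ T, t * z = z * t) : T ≤ P := by
  rw [mem_sylowCenter] at hz
  obtain ⟨R, hR⟩ := hG.exists_sylow_centralizer hz.1 h1
  have hPR : (P : Subgroup G) ≤ R := hR P P.2 fun x hx => by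
    rw [mem_centralizer_singleton_iff]; exact hz.2 x hx
  have hTR := hR T hT fun x hx => by
    rw [mem_centralizer_singleton_iff]; exact h x hx
  exact hTR.trans (Subgroup.eq_of_le_of_card_ge hPR (by
    rw [hG.card_sylow_47 P, hG.card_sylow_47 R])).ge

theorem exists_mem_sylowCenter (hG : HasPattern G) (P : Sylow 47 G) :
    ∃ z ∈ sylowCenter P, orderOf z = 47 := by
  have : Nontrivial P := by
    rw [← Finite.one_lt_card_iff_nontrivial, hG.card_sylow_47 P]; norm_num
  have := P.2.center_nontrivial
  obtain ⟨z, hz⟩ := exists_ne (1 : center P)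
  obtain ⟨m, hm⟩ := exists_pow_orderOf_eq P.2 z.1.2 (fun h => hz (Subtype.ext (Subtype.ext h)))
  refine ⟨_, pow_mem (mem_sylowCenter.2 ⟨z.1.2, fun x hx => ?_⟩) m, hm⟩
  exact congrArg Subtype.val (mem_center_iff.1 z.2 ⟨x, hx⟩)

theorem sylow_eq_of_le (hG : HasPattern G) {P Q : Sylow 47 G} (h : (P : Subgroup G) ≤ Q) : P = Q :=
  Sylow.ext (Subgroup.eq_of_le_of_card_ge h (by rw [hG.card_sylow_47 P, hG.card_sylow_47 Q]))

theorem eq_of_mem_sylowCenter (hG : HasPattern G) {P Q : Sylow 47 G} {z : G}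
    (hP : z ∈ sylowCenter P) (hQ : z ∈ sylowCenter Q) (h1 : z ≠ 1) : P = Q :=
  hG.sylow_eq_of_le (hG.le_of_le_centralizer hQ h1 P.2 (mem_sylowCenter.1 hP).2)

theorem sylowCenter_le_comm (hG : HasPattern G) {P Q : Sylow 47 G} (h : sylowCenter Q ≤ P) :
    sylowCenter P ≤ Q := by
  obtain ⟨z, hz, hz47⟩ := hG.exists_mem_sylowCenter Q
  have h1 : z ≠ 1 := by rintro rfl; simp at hz47
  refine hG.le_of_le_centralizer hz h1 (P.2.to_le inf_le_left) fun t ht => ?_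
  exact ((mem_sylowCenter.1 ht).2 z (h hz)).symm

theorem sylowCenter_le_inf (hG : HasPattern G) {P : Sylow 47 G}
    (hP : ∃ a ∈ P, ∃ b ∈ P, a * b ≠ b * a) {D : Subgroup G} (hD : Nat.card D = 47 ^ 2)
    (hDP : D ≤ P) : sylowCenter P ≤ D := by
  intro z hz
  by_contra hzD
  have hDc := IsPGroup.isMulCommutative_of_card_eq_prime_sq hD
  have hcomm : ∀ a ∈ D, ∀ b ∈ D, a * b = b * a := fun a ha b hb =>
    congrArg Subtype.val (hDc.is_comm.comm (⟨a, ha⟩ : D) ⟨b, hb⟩)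
  have key : ∀ E : Subgroup G, E ≤ P → D ≤ E → z ∈ E → E = P := by
    intro E hEP hDE hzE
    refine Subgroup.eq_of_le_of_card_ge hEP ?_
    obtain ⟨m, hm⟩ := card_dvd_of_le hDE
    obtain ⟨k, hk⟩ := card_dvd_of_le hEP
    have hlt : Nat.card D < Nat.card E := by
      refine lt_of_le_of_ne (card_le_of_le hDE) fun h => hzD ?_
      rw [Subgroup.eq_of_le_of_card_ge hDE h.ge]; exact hzE
    rw [hG.card_sylow_47 P, hm, hD] at hk
    rw [hm, hD] at hlt
    have hk' : 47 = m * k := Nat.eq_of_mul_eq_mul_left (show 0 < 47 ^ 2 by norm_num) (by linarith)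
    rcases (Nat.dvd_prime (show Nat.Prime 47 by norm_num)).1 (Dvd.intro k hk'.symm) with rfl | rfl
    · omega
    · rw [hm, hD, hG.card_sylow_47 P]; norm_num
  rw [mem_sylowCenter] at hz
  have h1 := key (P ⊓ centralizer (D : Set G)) inf_le_left
    (le_inf hDP fun a ha => mem_centralizer_iff.2 fun b hb => hcomm b hb a ha)
    ⟨hz.1, mem_centralizer_iff.2 fun b hb => hz.2 b (hDP hb)⟩
  have h2 := key (sylowCenter P) inf_le_left
    (fun a ha => mem_sylowCenter.2 ⟨hDP ha, fun x hx => by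
      rw [← SetLike.mem_coe, ← Sylow.coe_coe, SetLike.mem_coe, ← h1] at hx
      exact (mem_centralizer_iff.1 hx.2 a ha).symm⟩) (mem_sylowCenter.2 hz)
  obtain ⟨a, ha, b, hb, hab⟩ := hP
  rw [← SetLike.mem_coe, ← Sylow.coe_coe, SetLike.mem_coe, ← h2] at hb
  exact hab ((mem_sylowCenter.1 hb).2 a ha)

end HasPattern
end OD

namespace OD
set_option linter.unusedSectionVars false
open Subgroup
open scoped Pointwise

variable {G : Type*} [Group G] [Finite G]

theorem mem_sylow_of_smul_eq {p : ℕ} {P Q : Sylow p G} {g : G} (hg : g ∈ P)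
    (h : g • Q = Q) : g ∈ Q := by
  rw [Sylow.smul_eq_iff_mem_normalizer] at h
  have : g ∈ (P : Subgroup G) ⊓ normalizer (Q : Set G) := ⟨hg, h⟩
  rw [IsPGroup.inf_normalizer_sylow P.2] at this
  exact this.2

theorem smul_eq_of_mem {p : ℕ} {Q : Sylow p G} {g : G} (hg : g ∈ Q) : g • Q = Q :=
  Sylow.smul_eq_iff_mem_normalizer.2 (le_normalizer hg)

namespace HasPattern

local instance : Fact (Nat.Prime 47) := ⟨by norm_num⟩

/-- The Sylow `47`-subgroups different from `P` whose center is contained in `P`. -/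
def nb (P : Sylow 47 G) : Set (Sylow 47 G) := {Q | Q ≠ P ∧ sylowCenter Q ≤ P}

theorem smul_mem_nb {P Q : Sylow 47 G} (g : G) (h : Q ∈ nb P) : g • Q ∈ nb (g • P) := by
  refine ⟨fun h' => h.1 (smul_left_cancel g h'), fun z hz => mem_smul_sylow.2 (h.2 ?_)⟩
  have := smul_mem_sylowCenter (g := g⁻¹) hz
  rwa [inv_smul_smul, inv_inv] at this

theorem card_inf_dvd (hG : HasPattern G) {P Q : Sylow 47 G} (hPQ : P ≠ Q) :
    Nat.card ((P : Subgroup G) ⊓ Q : Subgroup G) ∣ 47 ^ 2 := by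
  have h := card_dvd_of_le (inf_le_left : (P : Subgroup G) ⊓ Q ≤ P)
  rw [hG.card_sylow_47 P] at h
  obtain ⟨k, hk, hk'⟩ := (Nat.dvd_prime_pow (by norm_num)).1 h
  rw [hk']
  refine pow_dvd_pow _ (Nat.le_of_lt_succ (lt_of_le_of_ne hk ?_))
  rintro rfl
  refine hPQ (hG.sylow_eq_of_le (inf_eq_left.1 (Subgroup.eq_of_le_of_card_ge inf_le_left ?_)))
  rw [hk', hG.card_sylow_47 P]

theorem card_inf_dvd_of_not_nb (hG : HasPattern G)
    (hna : ∀ P : Sylow 47 G, ∃ a ∈ P, ∃ b ∈ P, a * b ≠ b * a) {P Q : Sylow 47 G} (hPQ : Q ≠ P)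
    (hQ : Q ∉ nb P) : Nat.card ((P : Subgroup G) ⊓ Q : Subgroup G) ∣ 47 := by
  obtain ⟨k, hk, hk'⟩ := (Nat.dvd_prime_pow (by norm_num)).1 (hG.card_inf_dvd hPQ.symm)
  interval_cases k
  · rw [hk']; norm_num
  · rw [hk']; norm_num
  · exact absurd ⟨hPQ, (hG.sylowCenter_le_inf (hna Q) hk' inf_le_right).trans inf_le_left⟩ hQ

/-- The number of Sylow subgroups whose center lies in a given subgroup of order at most `47 ^ 2`
is bounded, as the nontrivial elements of different centers are distinct. -/
theorem ncard_sylowCenter_le (hG : HasPattern G) {D : Subgroup G} (hD : Nat.card D ∣ 47 ^ 2) :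
    {Q : Sylow 47 G | sylowCenter Q ≤ D}.ncard ≤ 48 := by
  classical
  have := Fintype.ofFinite G
  have := Fintype.ofFinite (Sylow 47 G)
  choose z hz hz47 using hG.exists_mem_sylowCenter
  let T : Finset (Sylow 47 G) := Finset.univ.filter fun Q => sylowCenter Q ≤ D
  have hT : {Q : Sylow 47 G | sylowCenter Q ≤ D} = T := by ext; simp [T]
  rw [hT, Set.ncard_coe_finset]
  let f : Sylow 47 G → Finset G := fun Q => Finset.univ.filter fun x => x ∈ zpowers (z Q) ∧ x ≠ 1
  have hf : ∀ Q, (f Q).card = 46 := by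
    intro Q
    have h := ncard_ne_one_eq (zpowers (z Q))
    rw [Nat.card_zpowers, hz47] at h
    rw [show 46 = 47 - 1 from rfl, ← h, ← Set.ncard_coe_finset]
    congr 1
    ext; simp [f]
  have hle : ∀ Q, zpowers (z Q) ≤ sylowCenter Q := fun Q => zpowers_le.2 (hz Q)
  have hdis : (T : Set (Sylow 47 G)).PairwiseDisjoint f := by
    intro Q _ R _ hQR
    refine Finset.disjoint_left.2 fun x hx hx' => hQR ?_
    simp only [f, Finset.mem_filter] at hx hx'
    exact hG.eq_of_mem_sylowCenter (hle Q hx.2.1) (hle R hx'.2.1) hx.2.2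
  have hcard := Finset.card_biUnion hdis
  rw [Finset.sum_const_nat fun Q _ => hf Q] at hcard
  have hsub : (T.biUnion f : Set G) ⊆ {a | a ∈ D ∧ a ≠ 1} := by
    intro x hx
    simp only [Finset.coe_biUnion, Set.mem_iUnion] at hx
    obtain ⟨Q, hQ, hx⟩ := hx
    simp only [f, T, Finset.coe_filter, Set.mem_ofPred_eq, Finset.mem_univ, true_and] at hx hQ
    exact ⟨hQ (hle Q hx.1), hx.2⟩
  have hle := Set.ncard_le_ncard hsub
  rw [Set.ncard_coe_finset, hcard, ncard_ne_one_eq] at hle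
  have := Nat.le_of_dvd (by norm_num) hD
  omega

theorem sylow_47_inf_eq_bot (hG : HasPattern G) {P Q : Sylow 47 G} (hPQ : P ≠ Q) {x : G}
    (hP : x ∈ P) (hQ : x ∈ Q) : x = 1 := by
  classical
  by_contra h1
  obtain ⟨R, hR⟩ := hG.exists_sylow_centralizer hP h1
  have hna : ∀ P : Sylow 47 G, ∃ a ∈ P, ∃ b ∈ P, a * b ≠ b * a := by
    by_contra! ⟨S, hS⟩
    have hall : ∀ P' : Sylow 47 G, x ∈ P' → P' = R := by
      intro P' hx
      obtain ⟨g, rfl⟩ := MulAction.exists_smul_eq G S P'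
      refine hG.sylow_eq_of_le (hR _ (g • S).2 fun a ha => ?_)
      rw [mem_centralizer_singleton_iff]
      have := hS _ (mem_smul_sylow.1 ha) _ (mem_smul_sylow.1 hx)
      calc a * x = g * (g⁻¹ * a * g * (g⁻¹ * x * g)) * g⁻¹ := by group
        _ = g * (g⁻¹ * x * g * (g⁻¹ * a * g)) * g⁻¹ := by rw [this]
        _ = x * a := by group
    exact hPQ ((hall P hP).trans (hall Q hQ).symm)
  have hRc : ∀ P' : Sylow 47 G, x ∈ P' → sylowCenter P' ≤ R := fun P' hx =>
    hR _ (P'.2.to_le inf_le_left) fun z hz => by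
      rw [mem_centralizer_singleton_iff]
      exact ((mem_sylowCenter.1 hz).2 x hx).symm
  have hne : ∀ S : Sylow 47 G, (nb S).Nonempty := by
    obtain ⟨S₀, T₀, h₀⟩ : ∃ S T : Sylow 47 G, T ∈ nb S := by
      by_cases h : P = R
      · exact ⟨R, Q, fun h' => hPQ (h.trans h'.symm), hRc Q hQ⟩
      · exact ⟨R, P, h, hRc P hP⟩
    intro S
    obtain ⟨g, rfl⟩ := MulAction.exists_smul_eq G S₀ S
    exact ⟨_, smul_mem_nb g h₀⟩
  have hcardW : ∀ S : Sylow 47 G, ((nb S ∪ {S})ᶜ).ncard + (nb S).ncard = 47 ^ 3 := by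
    intro S
    have h := Set.ncard_add_ncard_compl (nb S ∪ {S})
    rw [Set.union_singleton, Set.ncard_insert_of_notMem (fun h => h.1 rfl),
      (hG.card_normalizer_47 S).2] at h
    rw [Set.union_singleton]
    omega
  have hdvd : ∀ S : Sylow 47 G, 47 ^ 2 ∣ ((nb S ∪ {S})ᶜ).ncard := by
    intro S
    have h := card_dvd_ncard_mul (c := 47)
      ((MulAction.toPermHom G (Sylow 47 G)).comp (S : Subgroup G).subtype)
      (Y := (nb S ∪ {S})ᶜ) ?_ ?_
    · rw [hG.card_sylow_47 S, pow_succ] at h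
      exact Nat.dvd_of_mul_dvd_mul_right (by norm_num) h
    · intro k T hT hkT
      change (k : G) • T ∈ nb S ∪ {S} at hkT
      have e : ((k : G)⁻¹ • (k : G) • T) = T := inv_smul_smul _ _
      refine hT ?_
      rw [← e]
      have e' := smul_eq_of_mem (Q := S) (inv_mem k.2)
      rcases hkT with h | h
      · have := smul_mem_nb (k : G)⁻¹ h
        rw [e'] at this
        exact Or.inl this
      · rw [Set.mem_singleton_iff] at h
        rw [h]
        exact Or.inr e'
    · intro T hT
      rw [Set.mem_compl_iff, Set.mem_union, not_or] at hT
      convert hG.card_inf_dvd_of_not_nb hna hT.2 hT.1 using 1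
      rw [← Set.ncard_image_of_injective _ Subtype.val_injective, ← Nat.card_coe_set_eq]
      refine Nat.card_congr (Equiv.subtypeEquivRight fun g => ?_)
      constructor
      · rintro ⟨k, hk, rfl⟩
        exact ⟨k.2, mem_sylow_of_smul_eq k.2 hk⟩
      · intro hg
        exact ⟨⟨g, hg.1⟩, smul_eq_of_mem hg.2, rfl⟩
  have hnb : ∀ S : Sylow 47 G, 47 ^ 2 ≤ (nb S).ncard := by
    intro S
    have hpos : 0 < (nb S).ncard := (Set.ncard_pos).2 (hne S)
    refine Nat.le_of_dvd hpos ((Nat.dvd_add_right (hdvd S)).1 ?_)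
    rw [hcardW S]
    norm_num
  have := Fintype.ofFinite (Sylow 47 G)
  let N : Sylow 47 G → Finset (Sylow 47 G) := fun S => (nb S).toFinset
  have hN : ∀ S, (N S).card = (nb S).ncard := fun S => (Set.ncard_eq_toFinset_card' _).symm
  have hmemN : ∀ S T, T ∈ N S ↔ T ∈ nb S := fun S T => Set.mem_toFinset
  let f : Sylow 47 G → Finset (Sylow 47 G) := fun S => N S \ insert P (N P)
  have hf : ∀ S ∈ N P, 2161 ≤ (f S).card := by
    intro S hS
    rw [hmemN] at hS
    have h1 : (N S ∩ insert P (N P)).card ≤ 48 := by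
      refine le_trans ?_ (hG.ncard_sylowCenter_le (hG.card_inf_dvd hS.1.symm))
      rw [← Set.ncard_coe_finset]
      refine Set.ncard_le_ncard fun T hT => ?_
      rw [Finset.mem_coe, Finset.mem_inter, Finset.mem_insert, hmemN, hmemN] at hT
      refine le_inf ?_ hT.1.2
      rcases hT.2 with rfl | h
      · exact inf_le_left
      · exact h.2
    have h2 := Finset.card_sdiff_add_card_inter (N S) (insert P (N P))
    have h3 := hnb S
    rw [← hN] at h3
    change 2161 ≤ (N S \ insert P (N P)).card
    omega
  have hdis : (N P : Set (Sylow 47 G)).PairwiseDisjoint f := by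
    intro S hS T hT hST
    refine Finset.disjoint_left.2 fun U hUS hUT => hST ?_
    simp only [f, Finset.mem_sdiff, Finset.mem_insert, hmemN, not_or, Finset.mem_coe] at hUS hUT hS hT
    have hd := hG.card_inf_dvd_of_not_nb hna hUS.2.1 hUS.2.2
    have hmem : ∀ S, S ∈ nb P → U ∈ nb S → sylowCenter S ≤ (P : Subgroup G) ⊓ U := fun S h h' =>
      le_inf h.2 (hG.sylowCenter_le_comm h'.2)
    have heq : ∀ S, S ∈ nb P → U ∈ nb S → sylowCenter S = (P : Subgroup G) ⊓ U := by
      intro S h h'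
      refine Subgroup.eq_of_le_of_card_ge (hmem S h h') ((Nat.le_of_dvd (by norm_num) hd).trans ?_)
      obtain ⟨z, hz, hz47⟩ := hG.exists_mem_sylowCenter S
      have := card_le_of_le (zpowers_le.2 hz)
      rwa [Nat.card_zpowers, hz47] at this
    obtain ⟨z, hz, hz47⟩ := hG.exists_mem_sylowCenter S
    refine hG.eq_of_mem_sylowCenter hz (Q := T) ?_ (by rintro rfl; simp at hz47)
    rw [heq T hT hUT.1, ← heq S hS hUS.1]
    exact hz
  have hcard := Finset.card_biUnion hdis
  have hle := (N P).card_nsmul_le_sum (fun S => (f S).card) 2161 hf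
  rw [← hcard, hN, smul_eq_mul] at hle
  have hle2 : ((N P).biUnion f).card ≤ ((nb P ∪ {P})ᶜ).ncard := by
    rw [← Set.ncard_coe_finset]
    refine Set.ncard_le_ncard fun T hT => ?_
    rw [Finset.mem_coe, Finset.mem_biUnion] at hT
    obtain ⟨S, hS, hT⟩ := hT
    simp only [f, Finset.mem_sdiff, Finset.mem_insert, hmemN, not_or] at hT
    rintro (h | h)
    · exact hT.2.2 h
    · exact hT.2.1 h
  have h1 := hnb P
  have h2 := hcardW P
  omega

end HasPattern
end OD

namespace OD
set_option linter.unusedSectionVars false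
open Subgroup
open scoped Pointwise

/-- The permutation group setting: `G` acts doubly transitively on `47 ^ 3 + 1` points, with a
family of subgroups `P ω` acting regularly on the points different from `ω`. -/
structure Setting (G Ω : Type*) [Group G] [MulAction G Ω] (P : Ω → Subgroup G) : Prop where
  card_G : Nat.card G = 2 ^ 9 * 3 ^ 2 * 7 * 23 * 47 ^ 3 * 103
  card_Ω : Nat.card Ω = 47 ^ 3 + 1
  faithful : ∀ g : G, (∀ ω : Ω, g • ω = ω) → g = 1
  card_P : ∀ ω, Nat.card (P ω) = 47 ^ 3
  conj : ∀ (g : G) (ω : Ω), ∀ x ∈ P ω, g * x * g⁻¹ ∈ P (g • ω)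
  fix : ∀ ω, ∀ x ∈ P ω, x • ω = ω
  trans : ∀ ω α β : Ω, α ≠ ω → β ≠ ω → ∃ x ∈ P ω, x • α = β
  semireg : ∀ ω α : Ω, α ≠ ω → ∀ x ∈ P ω, x • α = α → x = 1
  noncomm : ∀ ω, ∀ x ∈ P ω, x ≠ 1 → ∀ s : G, orderOf s = 23 → s * x ≠ x * s
  cent : ∀ s : G, orderOf s = 23 → Nat.card (centralizer ({s} : Set G)) = 736
  inv : ∃ ω, ∃ v x : G, orderOf v = 2 ∧ x ∈ P ω ∧ x ≠ 1 ∧ v * x = x * v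

variable {G : Type*} [Group G] [Finite G]

namespace HasPattern

local instance : Fact (Nat.Prime 47) := ⟨by norm_num⟩

theorem eq_one_of_smul_eq (hG : HasPattern G) {P Q : Sylow 47 G} (hPQ : Q ≠ P) {x : G}
    (hx : x ∈ P) (h : x • Q = Q) : x = 1 :=
  hG.sylow_47_inf_eq_bot hPQ.symm hx (mem_sylow_of_smul_eq hx h)

theorem exists_smul_eq (hG : HasPattern G) {P Q R : Sylow 47 G} (hQ : Q ≠ P) (hR : R ≠ P) :
    ∃ x ∈ P, x • Q = R := by
  let f : P → ({P}ᶜ : Set (Sylow 47 G)) := fun x => ⟨(x : G) • Q, fun h => hQ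
    (smul_left_cancel (x : G) ((Set.mem_singleton_iff.1 h).trans (smul_eq_of_mem x.2).symm))⟩
  have hf : Function.Injective f := by
    intro x y hxy
    have h : (x : G) • Q = (y : G) • Q := congrArg Subtype.val hxy
    have : ((y : G)⁻¹ * x) • Q = Q := by rw [mul_smul, h, inv_smul_smul]
    have := hG.eq_one_of_smul_eq hQ (mul_mem (inv_mem y.2) x.2) this
    exact (Subtype.ext (inv_mul_eq_one.1 this)).symm
  have hcard : Nat.card P = Nat.card ({P}ᶜ : Set (Sylow 47 G)) := by
    have h := Set.ncard_add_ncard_compl ({P} : Set (Sylow 47 G))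
    rw [(hG.card_normalizer_47 P).2, Set.ncard_singleton] at h
    rw [hG.card_sylow_47 P, Nat.card_coe_set_eq]
    omega
  obtain ⟨x, hx⟩ := ((Nat.bijective_iff_injective_and_card f).2 ⟨hf, hcard⟩).2 ⟨R, hR⟩
  exact ⟨x, x.2, congrArg Subtype.val hx⟩

theorem eq_one_of_forall_smul_eq (hG : HasPattern G) {g : G}
    (hg : ∀ P : Sylow 47 G, g • P = P) : g = 1 := by
  let N := (MulAction.toPermHom G (Sylow 47 G)).ker
  have hgN : g ∈ N := by
    rw [MonoidHom.mem_ker]; ext1 P; exact hg P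
  suffices h : Nat.card N = 1 by
    have := Subgroup.card_eq_one.1 h
    rw [this] at hgN
    exact hgN
  have hN : ∀ n ∈ N, ∀ P : Sylow 47 G, n • P = P := fun n hn P =>
    congrArg (fun e : Equiv.Perm (Sylow 47 G) => e P) (MonoidHom.mem_ker.1 hn)
  obtain ⟨P⟩ : Nonempty (Sylow 47 G) := inferInstance
  have h47 : ¬ 47 ∣ Nat.card N := by
    intro hd
    obtain ⟨x, hx⟩ := exists_prime_orderOf_dvd_card' 47 hd
    have hp : IsPGroup 47 (zpowers (x : G)) := IsPGroup.of_card (n := 1) (by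
      rw [Nat.card_zpowers, orderOf_coe, hx, pow_one])
    obtain ⟨Q, hQ⟩ := hp.exists_le_sylow
    have hxQ : (x : G) ∈ Q := hQ (mem_zpowers _)
    obtain ⟨R, hR⟩ : ∃ R, R ≠ Q := by
      have : Nontrivial (Sylow 47 G) := by
        rw [← Finite.one_lt_card_iff_nontrivial, (hG.card_normalizer_47 P).2]; norm_num
      exact exists_ne Q
    have := hG.eq_one_of_smul_eq hR hxQ (hN _ x.2 R)
    rw [← orderOf_coe, this] at hx
    simp at hx
  have hdvd : Nat.card N ∣ 736 := by
    have hle : N ≤ normalizer (P : Set G) := fun n hn =>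
      Sylow.smul_eq_iff_mem_normalizer.1 (hN n hn P)
    have h := card_dvd_of_le hle
    rw [(hG.card_normalizer_47 P).1] at h
    refine Nat.Coprime.dvd_of_dvd_mul_left (Nat.Coprime.pow_right 3 ?_) h
    exact ((Nat.Prime.coprime_iff_not_dvd (by norm_num)).2 h47).symm
  obtain ⟨t, ht⟩ := exists_orderOf_eq hG.card (p := 103) (by norm_num) (by norm_num)
  have hnt : t ∈ normalizer (N : Set G) := by rw [normalizer_eq_top]; trivial
  have h103 := prime_dvd_card_sub_one (by norm_num) ht hnt fun x hx a ha h1 hxa => by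
    obtain ⟨p, hp, hpa⟩ := Nat.exists_prime_and_dvd (mt orderOf_eq_one_iff.1 h1)
    have hp' : p ∣ 736 := hpa.trans ((Subgroup.orderOf_dvd_natCard N ha).trans hdvd)
    have hp103 : p ≠ 103 := by rintro rfl; norm_num at hp'
    have hadj : GKAdj G 103 p := GKAdj.of_commute (by norm_num) hp hp103.symm hx
      (orderOf_pow_orderOf_div (orderOf_pos a).ne' hpa) ((show Commute x a from hxa).pow_right _)
    rw [hG.adj_103 p hadj] at hp'
    norm_num at hp'
  have hpos := Nat.card_pos (α := N)
  have hle := Nat.le_of_dvd (by norm_num) hdvd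
  obtain ⟨k, hk⟩ := h103
  have hk' : Nat.card N = 103 * k + 1 := by omega
  have hk7 : k ≤ 7 := by omega
  rw [hk'] at hdvd ⊢
  interval_cases k <;> first | rfl | (exfalso; revert hdvd; norm_num)

theorem setting (hG : HasPattern G) :
    Setting G (Sylow 47 G) (fun P => (P : Subgroup G)) where
  card_G := hG.card
  card_Ω := by
    obtain ⟨P⟩ : Nonempty (Sylow 47 G) := inferInstance
    exact (hG.card_normalizer_47 P).2
  faithful _ := hG.eq_one_of_forall_smul_eq
  card_P := hG.card_sylow_47
  conj g P x hx := by
    change g * x * g⁻¹ ∈ g • P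
    exact mem_smul_sylow.2 (by
      rw [show g⁻¹ * (g * x * g⁻¹) * g = x by group]; exact hx)
  fix P x hx := smul_eq_of_mem hx
  trans P Q R hQ hR := hG.exists_smul_eq hQ hR
  semireg P Q hQ x hx h := hG.eq_one_of_smul_eq hQ hx h
  noncomm P x hx h1 s hs := hG.not_commute_47 (by norm_num) (by norm_num) (by norm_num) P.2 hs hx h1
  cent s hs := hG.card_centralizer_23 hs
  inv := by
    obtain ⟨v, x, hv, hx, hvx⟩ := hG.adj_two.2.2.exists_commute
    have hp : IsPGroup 47 (zpowers x) := IsPGroup.of_card (n := 1) (by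
      rw [Nat.card_zpowers, hx, pow_one])
    obtain ⟨Q, hQ⟩ := hp.exists_le_sylow
    exact ⟨Q, v, x, hv, hQ (mem_zpowers x), by rintro rfl; simp at hx, hvx⟩

end HasPattern
end OD

namespace OD
set_option linter.unusedSectionVars false
open Subgroup MulAction
open scoped Pointwise

section Transitive

variable {G Ω : Type*} [Group G] [Finite G] [MulAction G Ω]

theorem ncard_dvd_card_of_transitive (H : Subgroup G) {F : Set Ω} {a : Ω}
    (h1 : ∀ g ∈ H, g • a ∈ F) (h2 : ∀ b ∈ F, ∃ g ∈ H, g • a = b) : F.ncard ∣ Nat.card H := by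
  have : F = orbit H a := by
    ext b
    rw [mem_orbit_iff]
    constructor
    · intro hb
      obtain ⟨g, hg, rfl⟩ := h2 b hb
      exact ⟨⟨g, hg⟩, rfl⟩
    · rintro ⟨g, rfl⟩
      exact h1 g g.2
  rw [this, ← Nat.card_coe_set_eq, Nat.card_congr (orbitEquivQuotientStabilizer H a)]
  exact card_quotient_dvd_card _

end Transitive

namespace Setting

variable {G Ω : Type*} [Group G] [Finite G] [MulAction G Ω] {P : Ω → Subgroup G} {i o : Ω}

local instance : Fact (Nat.Prime 47) := ⟨by norm_num⟩

theorem finite (h : Setting G Ω P) : Finite Ω :=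
  Nat.finite_of_card_ne_zero (by rw [h.card_Ω]; norm_num)

theorem exists_ne_ne (h : Setting G Ω P) (a b : Ω) : ∃ c, c ≠ a ∧ c ≠ b := by
  have := h.finite
  by_contra! hc
  have hu : (Set.univ : Set Ω) ⊆ {a, b} := fun c _ => by
    by_cases hca : c = a
    · exact Or.inl hca
    · exact Or.inr (hc c hca)
  have h1 := Set.ncard_le_ncard hu
  rw [Set.ncard_univ, h.card_Ω] at h1
  have h2 := Set.ncard_insert_le a {b}
  rw [Set.ncard_singleton] at h2
  omega

theorem exists_smul_eq (h : Setting G Ω P) (a b : Ω) : ∃ g : G, g • a = b := by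
  obtain ⟨c, hca, hcb⟩ := h.exists_ne_ne a b
  obtain ⟨x, -, hx⟩ := h.trans c a b hca.symm hcb.symm
  exact ⟨x, hx⟩

theorem two_transitive (h : Setting G Ω P) {a b c d : Ω} (hab : a ≠ b) (hcd : c ≠ d) :
    ∃ g : G, g • a = c ∧ g • b = d := by
  obtain ⟨g, rfl⟩ := h.exists_smul_eq a c
  obtain ⟨x, hx, hxd⟩ := h.trans (g • a) (g • b) d (fun e => hab (smul_left_cancel g e).symm)
    hcd.symm
  exact ⟨x * g, by rw [mul_smul, h.fix _ x hx], by rw [mul_smul, hxd]⟩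

theorem conj_mem (h : Setting G Ω P) {g x : G} (hg : g • i = i) (hx : x ∈ P i) :
    g * x * g⁻¹ ∈ P i := by
  have := h.conj g i x hx
  rwa [hg] at this

/-- The stabilizer of two points. -/
def twoStab (G : Type*) {Ω : Type*} [Group G] [MulAction G Ω] (i o : Ω) : Subgroup G :=
  stabilizer G i ⊓ stabilizer G o

theorem mem_twoStab {g : G} : g ∈ twoStab G i o ↔ g • i = i ∧ g • o = o := Iff.rfl

theorem eq_of_smul_eq (h : Setting G Ω P) (hio : i ≠ o) {x y : G} (hx : x ∈ P i) (hy : y ∈ P i)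
    (e : x • o = y • o) : x = y := by
  have := h.semireg i o hio.symm (y⁻¹ * x) (mul_mem (inv_mem hy) hx)
    (by rw [mul_smul, e, inv_smul_smul])
  exact (inv_mul_eq_one.1 this).symm

theorem conj_smul {k : G} (hk : k • o = o) (x : G) : (k * x * k⁻¹) • o = k • x • o := by
  rw [mul_smul, mul_smul, inv_smul_eq_iff.2 hk.symm]

theorem smul_ne (h : Setting G Ω P) (hio : i ≠ o) {x : G} (hx : x ∈ P i) : x • o ≠ i := by
  intro e
  have h1 := h.fix i x hx
  exact hio (smul_left_cancel x (h1.trans e.symm))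

theorem card_twoStab (h : Setting G Ω P) (hio : i ≠ o) : Nat.card (twoStab G i o) = 736 := by
  have hst : Nat.card G = Nat.card Ω * Nat.card (stabilizer G i) := by
    rw [Subgroup.card_eq_card_quotient_mul_card_subgroup (stabilizer G i),
      ← Nat.card_congr (orbitEquivQuotientStabilizer G i)]
    congr 1
    have : orbit G i = Set.univ := Set.eq_univ_of_forall fun b => h.exists_smul_eq i b
    rw [this, Nat.card_coe_set_eq, Set.ncard_univ]
  let f : P i × twoStab G i o → stabilizer G i := fun p =>
    ⟨p.1 * p.2, by rw [mem_stabilizer_iff, mul_smul, p.2.2.1, h.fix i _ p.1.2]⟩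
  have hf : Function.Bijective f := by
    constructor
    · rintro ⟨⟨x, hx⟩, ⟨k, hk⟩⟩ ⟨⟨x', hx'⟩, ⟨k', hk'⟩⟩ e
      have e : x * k = x' * k' := congrArg Subtype.val e
      have hxx : x = x' := h.eq_of_smul_eq hio hx hx' (by
        have := congrArg (fun g : G => g • o) e
        simp only [mul_smul] at this
        rwa [hk.2, hk'.2] at this)
      subst hxx
      simpa using e
    · rintro ⟨g, hg⟩
      have hgo : g • o ≠ i := fun e => hio (smul_left_cancel g (hg.trans e.symm))
      obtain ⟨x, hx, hxo⟩ := h.trans i o (g • o) hio.symm hgo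
      refine ⟨⟨⟨x, hx⟩, ⟨x⁻¹ * g, ?_, ?_⟩⟩, Subtype.ext ?_⟩
      · change (x⁻¹ * g) • i = i
        rw [mul_smul, mem_stabilizer_iff.1 hg, inv_smul_eq_iff, h.fix i x hx]
      · change (x⁻¹ * g) • o = o
        rw [mul_smul, inv_smul_eq_iff, hxo]
      · change x * (x⁻¹ * g) = g
        group
  have hc := Nat.card_congr (Equiv.ofBijective f hf)
  rw [Nat.card_prod, h.card_P] at hc
  rw [h.card_G, h.card_Ω, ← hc] at hst
  omega

/-- The centralizer of `k` in `P i`. -/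
def cp (P : Ω → Subgroup G) (i : Ω) (k : G) : Subgroup G := P i ⊓ centralizer {k}

theorem mem_cp {k x : G} : x ∈ cp P i k ↔ x ∈ P i ∧ x * k = k * x := by
  rw [cp, mem_inf, mem_centralizer_singleton_iff]

theorem smul_smul_eq_iff (h : Setting G Ω P) (hio : i ≠ o) {k x : G} (hk : k ∈ twoStab G i o)
    (hx : x ∈ P i) : k • x • o = x • o ↔ x ∈ cp P i k := by
  rw [← conj_smul hk.2, mem_cp, and_iff_right hx]
  constructor
  · intro e
    have := h.eq_of_smul_eq hio (h.conj_mem hk.1 hx) hx e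
    exact (mul_mul_inv_eq_iff.1 this).symm
  · intro e
    rw [mul_mul_inv_eq_iff.2 e.symm]

theorem ncard_fixed (h : Setting G Ω P) (hio : i ≠ o) {k : G} (hk : k ∈ twoStab G i o) :
    {a : Ω | k • a = a}.ncard = Nat.card (cp P i k) + 1 := by
  have := h.finite
  have he : {a : Ω | k • a = a} = insert i ((fun x : G => x • o) '' (cp P i k : Set G)) := by
    ext a
    simp only [Set.mem_ofPred_eq, Set.mem_insert_iff, Set.mem_image, SetLike.mem_coe]
    constructor
    · intro ha
      by_cases hai : a = i
      · exact Or.inl hai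
      · obtain ⟨x, hx, rfl⟩ := h.trans i o a hio.symm hai
        exact Or.inr ⟨x, (h.smul_smul_eq_iff hio hk hx).1 ha, rfl⟩
    · rintro (rfl | ⟨x, hx, rfl⟩)
      · exact hk.1
      · exact (h.smul_smul_eq_iff hio hk hx.1).2 hx
  rw [he, Set.ncard_insert_of_notMem, Set.InjOn.ncard_image, ← Nat.card_coe_set_eq]
  · rfl
  · exact fun x hx y hy e => h.eq_of_smul_eq hio hx.1 hy.1 e
  · rintro ⟨x, hx, e⟩
    exact h.smul_ne hio hx.1 e

theorem card_cp (h : Setting G Ω P) (hio : i ≠ o) {k : G} (hk : k ∈ twoStab G i o) (h1 : k ≠ 1) :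
    Nat.card (cp P i k) = 1 ∨ Nat.card (cp P i k) = 47 := by
  have hd : Nat.card (cp P i k) ∣ Nat.card (P i) := card_dvd_of_le inf_le_left
  rw [h.card_P] at hd
  obtain ⟨j, hj, hj'⟩ := (Nat.dvd_prime_pow (by norm_num)).1 hd
  interval_cases j
  · exact Or.inl hj'
  · exact Or.inr hj'
  · exfalso
    have hfix := h.ncard_fixed hio hk
    rw [hj'] at hfix
    set F := {a : Ω | k • a = a} with hF
    have key : ∀ a ∈ F, ∀ b ∈ F, ∀ c ∈ F, b ≠ a → c ≠ a →
        ∃ g ∈ centralizer ({k} : Set G), g • b = c := by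
      intro a ha b hb c hc hba hca
      obtain ⟨x, hx, hxb⟩ := h.trans a b c hba hca
      refine ⟨x, mem_centralizer_singleton_iff.2 ?_, hxb⟩
      have hk1 : (k * x * k⁻¹) • b = x • b := by
        rw [conj_smul hb, hxb]; exact hc
      have := h.eq_of_smul_eq hba.symm (h.conj_mem ha hx) hx hk1
      exact (mul_mul_inv_eq_iff.1 this).symm
    have hdvd := ncard_dvd_card_of_transitive (centralizer ({k} : Set G)) (F := F) (a := i)
      (fun g hg => by
        rw [mem_centralizer_singleton_iff] at hg
        change k • g • i = g • i
        rw [← mul_smul, ← hg, mul_smul, hk.1])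
      (fun b hb => by
        obtain ⟨c, hcF, hci, hcb⟩ : ∃ c ∈ F, c ≠ i ∧ c ≠ b := by
          by_contra! hno
          have hsub : F ⊆ {i, b} := fun c hc => by
            by_cases hci : c = i
            · exact Or.inl hci
            · exact Or.inr (hno c hc hci)
          have h3 := Set.ncard_le_ncard hsub
          have h4 := Set.ncard_insert_le i {b}
          rw [Set.ncard_singleton] at h4
          omega
        exact key c hcF i hk.1 b hb hci.symm hcb.symm)
    rw [hfix] at hdvd
    have := hdvd.trans (card_subgroup_dvd_card _)
    rw [h.card_G] at this
    norm_num at this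
  · exfalso
    have he : cp P i k = P i := Subgroup.eq_of_le_of_card_ge inf_le_left (by rw [hj', h.card_P])
    refine h1 (h.faithful k fun a => ?_)
    by_cases hai : a = i
    · rw [hai]; exact hk.1
    · obtain ⟨x, hx, rfl⟩ := h.trans i o a hio.symm hai
      exact (h.smul_smul_eq_iff hio hk hx).2 (he ▸ hx)

theorem eq_one_of_card_cp (h : Setting G Ω P) (hio : i ≠ o) {k : G} (hk : k ∈ twoStab G i o)
    (h1 : 47 < Nat.card (cp P i k)) : k = 1 := by
  by_contra hne
  rcases h.card_cp hio hk hne with h2 | h2 <;> omega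

theorem exists_swap (h : Setting G Ω P) (hio : i ≠ o) : ∃ g : G, g • i = o ∧ g • o = i :=
  h.two_transitive hio hio.symm

/-- The elements of `P i` inverted by an involution. -/
def inverted (P : Ω → Subgroup G) (i : Ω) (k : G) : Set G := {x | x ∈ P i ∧ k * x * k⁻¹ = x⁻¹}

theorem card_le_inverted (h : Setting G Ω P) {k : G} (hki : k • i = i) (hk2 : k * k = 1) :
    47 ^ 3 ≤ (inverted P i k).ncard * Nat.card (cp P i k) := by
  classical
  have := Fintype.ofFinite G
  let f : G → G := fun x => x⁻¹ * (k * x * k⁻¹)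
  let T : Finset G := (P i : Set G).toFinset
  have hT : T.card = 47 ^ 3 := by
    rw [← h.card_P i, ← Set.ncard_eq_toFinset_card', ← Nat.card_coe_set_eq]; rfl
  have hle := Finset.card_le_mul_card_image (f := f) T (Nat.card (cp P i k)) ?_
  · rw [hT] at hle
    refine hle.trans ?_
    rw [mul_comm]
    refine Nat.mul_le_mul_right _ ?_
    rw [← Set.ncard_coe_finset]
    refine Set.ncard_le_ncard fun w hw => ?_
    rw [Finset.mem_coe, Finset.mem_image] at hw
    obtain ⟨x, hx, rfl⟩ := hw
    have hx : x ∈ P i := by simpa [T] using hx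
    refine ⟨mul_mem (inv_mem hx) (h.conj_mem hki hx), ?_⟩
    have hki : k⁻¹ = k := inv_eq_of_mul_eq_one_left hk2
    simp only [f, hki, mul_inv_rev, inv_inv]
    calc k * (x⁻¹ * (k * x * k)) * k = k * x⁻¹ * k * x * (k * k) := by group
      _ = _ := by rw [hk2, mul_one]; group
  · intro w hw
    obtain ⟨x, hx, rfl⟩ := Finset.mem_image.1 hw
    have hx : x ∈ P i := by simpa [T] using hx
    have hinj : Function.Injective fun c : G => c * x := mul_left_injective x
    rw [← Set.ncard_coe_finset]
    refine (Set.ncard_le_ncard (t := (fun c : G => c * x) '' (cp P i k : Set G)) fun u hu => ?_).trans ?_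
    · rw [Finset.mem_coe, Finset.mem_filter] at hu
      have hu' : u ∈ P i := by simpa [T] using hu.1
      have e : u⁻¹ * (k * u * k⁻¹) = x⁻¹ * (k * x * k⁻¹) := hu.2
      refine ⟨u * x⁻¹, ?_, by simp⟩
      refine mem_cp.2 ⟨mul_mem hu' (inv_mem hx), ?_⟩
      have e1 : k * u * k⁻¹ = u * (x⁻¹ * (k * x * k⁻¹)) := by rw [← e]; group
      have e2 : k * u = u * x⁻¹ * k * x := by
        calc k * u = k * u * k⁻¹ * k := by group
          _ = _ := by rw [e1]; group
      calc u * x⁻¹ * k = u * x⁻¹ * k * x * x⁻¹ := by group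
        _ = k * (u * x⁻¹) := by rw [← e2]; group
    · rw [Set.ncard_image_of_injective _ hinj, ← Nat.card_coe_set_eq]
      rfl

end Setting
end OD

namespace OD
set_option linter.unusedSectionVars false
open Subgroup MulAction
open scoped Pointwise

local instance : Fact (Nat.Prime 47) := ⟨by norm_num⟩
local instance : Fact (Nat.Prime 23) := ⟨by norm_num⟩

theorem mem_zpowers_of_card_736 {L : Type*} [Group L] (hL : Nat.card L = 736) {s k : L}
    (hs : orderOf s = 23) (hk : k ^ 23 = 1) : k ∈ zpowers s := by
  have : Finite L := Nat.finite_of_card_ne_zero (by rw [hL]; norm_num)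
  have hf : (736 : ℕ).factorization 23 = 1 := by
    have : (736 : ℕ) = 23 ^ 1 * 32 := by norm_num
    rw [this, Nat.factorization_mul (by norm_num) (by norm_num), Nat.Prime.factorization_pow
      (by norm_num)]
    simp [Nat.factorization_eq_zero_of_not_dvd]
  let S : Sylow 23 L := Sylow.ofCard (zpowers s) (by rw [Nat.card_zpowers, hs, hL, hf]; rfl)
  have hSc : (S : Subgroup L) = zpowers s := rfl
  have hn : Nat.card (Sylow 23 L) = 1 := by
    have h1 := card_sylow_modEq_one 23 L
    have h2 := S.card_dvd_index
    have h3 := card_mul_index (S : Subgroup L)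
    rw [hSc, Nat.card_zpowers, hs, hL] at h3
    rw [hSc] at h2
    have h4 : (zpowers s).index = 32 := by omega
    rw [h4] at h2
    have h5 := Nat.le_of_dvd (by norm_num) h2
    unfold Nat.ModEq at h1
    interval_cases h : Nat.card (Sylow 23 L) <;> omega
  have := (Nat.card_eq_one_iff_unique.1 hn).1
  have hp : IsPGroup 23 (zpowers k) := by
    refine IsPGroup.of_card_dvd_pow (n := 1) ?_
    rw [Nat.card_zpowers, pow_one]
    exact orderOf_dvd_of_pow_eq_one hk
  obtain ⟨T, hT⟩ := hp.exists_le_sylow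
  rw [Subsingleton.elim T S] at hT
  exact hT (mem_zpowers k)

namespace Setting

variable {G Ω : Type*} [Group G] [Finite G] [MulAction G Ω] {P : Ω → Subgroup G} {i o : Ω}

theorem exists_orderOf_23 (h : Setting G Ω P) (hio : i ≠ o) :
    ∃ s ∈ twoStab G i o, orderOf s = 23 := by
  obtain ⟨s, hs⟩ := exists_prime_orderOf_dvd_card' (G := twoStab G i o) 23
    (by rw [h.card_twoStab hio]; norm_num)
  exact ⟨s, s.2, by rw [← hs, orderOf_coe]⟩

theorem mem_zpowers_of_pow_eq_one (h : Setting G Ω P) (hio : i ≠ o) {s k : G}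
    (hs : s ∈ twoStab G i o) (hs' : orderOf s = 23) (hk : k ∈ twoStab G i o) (hk' : k ^ 23 = 1) :
    k ∈ zpowers s := by
  have := mem_zpowers_of_card_736 (h.card_twoStab hio) (s := ⟨s, hs⟩) (k := ⟨k, hk⟩)
    (by rw [orderOf_mk, hs']) (Subtype.ext hk')
  obtain ⟨n, hn⟩ := this
  exact ⟨n, by simpa using congrArg Subtype.val hn⟩

theorem conj_mem_zpowers (h : Setting G Ω P) (hio : i ≠ o) {s k x : G}
    (hs : s ∈ twoStab G i o) (hs' : orderOf s = 23) (hk : k ∈ twoStab G i o)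
    (hx : x ∈ zpowers s) : k * x * k⁻¹ ∈ zpowers s := by
  have h1 : zpowers s ≤ twoStab G i o := zpowers_le.2 hs
  refine h.mem_zpowers_of_pow_eq_one hio hs hs' (mul_mem (mul_mem hk (h1 hx)) (inv_mem hk)) ?_
  obtain ⟨n, rfl⟩ := hx
  rw [conj_pow, ← zpow_natCast, ← zpow_mul, mul_comm, zpow_mul, zpow_natCast, ← hs',
    pow_orderOf_eq_one, one_zpow, mul_one, mul_inv_cancel]

theorem card_dvd_22_mul (h : Setting G Ω P) (hio : i ≠ o) {s : G} (hs : s ∈ twoStab G i o)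
    (hs' : orderOf s = 23) {L : Subgroup G} (hL : L ≤ twoStab G i o) :
    Nat.card L ∣ 22 * Nat.card (L ⊓ centralizer {s} : Subgroup G) := by
  have := card_dvd_ncard_mul (conjHom L) (Y := {a | a ∈ zpowers s ∧ a ≠ 1})
    (c := Nat.card (L ⊓ centralizer {s} : Subgroup G)) ?_ ?_
  · rwa [ncard_ne_one_eq, Nat.card_zpowers, hs'] at this
  · rintro k a ⟨ha, ha1⟩
    rw [conjHom_apply]
    exact ⟨h.conj_mem_zpowers hio hs hs' (hL k.2) ha, fun e => ha1 (conj_eq_one_iff.1 e)⟩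
  · rintro a ⟨ha, ha1⟩
    have hz : zpowers a = zpowers s :=
      eq_of_le_of_card_ge (zpowers_le.2 ha) (by
        rw [Nat.card_zpowers, Nat.card_zpowers, hs',
          orderOf_of_mem_zpowers (by norm_num) hs' ha ha1])
    have hca : centralizer ({a} : Set G) = centralizer {s} := by
      rw [← centralizer_zpowers_eq, hz, centralizer_zpowers_eq]
    have : Set.ncard {k : L | conjHom L k a = a} = Nat.card (L ⊓ centralizer {s} : Subgroup G) := by
      rw [← Nat.card_coe_set_eq]
      refine Nat.card_congr ⟨fun k => ⟨k.1, k.1.2, ?_⟩, fun k => ⟨⟨k.1, k.2.1⟩, ?_⟩,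
        fun _ => rfl, fun _ => rfl⟩
      · have hk : conjHom L k.1 a = a := k.2
        rw [conjHom_apply, mul_mul_inv_eq_iff] at hk
        rw [← hca]
        exact mem_centralizer_singleton_iff.2 hk
      · have hk := (mem_inf.1 k.2).2
        replace hk : (k : G) ∈ centralizer ({a} : Set G) := by rwa [hca]
        rw [mem_centralizer_singleton_iff] at hk
        change conjHom L _ a = a
        rw [conjHom_apply, mul_mul_inv_eq_iff]
        exact hk
    rw [this]

theorem exists_central_involution (h : Setting G Ω P) (hio : i ≠ o) :
    ∃ y ∈ twoStab G i o, orderOf y = 2 ∧ ∀ k ∈ twoStab G i o, k * y = y * k := by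
  obtain ⟨s, hs, hs'⟩ := h.exists_orderOf_23 hio
  have hK := h.card_twoStab hio
  obtain ⟨Q, hQ, hQc⟩ : ∃ Q ≤ twoStab G i o, Nat.card Q = 2 ^ 5 := by
    obtain ⟨Q, hQ⟩ := Sylow.exists_subgroup_card_pow_prime (G := twoStab G i o) 2 (n := 5)
      (by rw [hK]; norm_num)
    exact ⟨Q.map (twoStab G i o).subtype, map_subtype_le Q, by
      rw [← hQ]; exact card_map_of_injective (subtype_injective _)⟩
  have hQp : IsPGroup 2 Q := IsPGroup.of_card hQc
  have h16 : 2 ∣ Nat.card (Q ⊓ centralizer {s} : Subgroup G) := by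
    have := h.card_dvd_22_mul hio hs hs' hQ
    rw [hQc] at this
    omega
  have hmod := ncard_modEq_ncard_conj_fixed hQp
    (Y := ((Q ⊓ centralizer {s} : Subgroup G) : Set G)) (by
      intro k hk a haQ
      obtain ⟨ha, ha'⟩ := mem_inf.1 haQ
      refine mem_inf.2 ⟨mul_mem (mul_mem hk ha) (inv_mem hk), ?_⟩
      rw [mem_centralizer_singleton_iff] at ha' ⊢
      obtain ⟨n, hn⟩ := h.conj_mem_zpowers hio hs hs' (inv_mem (hQ hk)) (mem_zpowers s)
      have hc : Commute a (k⁻¹ * s * k⁻¹⁻¹) := by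
        rw [← hn]; exact Commute.zpow_right ha' n
      have hc : a * (k⁻¹ * s * k) = k⁻¹ * s * k * a := by
        have := hc.eq
        rwa [inv_inv] at this
      calc k * a * k⁻¹ * s = k * (a * (k⁻¹ * s * k)) * k⁻¹ := by group
        _ = s * (k * a * k⁻¹) := by rw [hc]; group)
  rw [← Nat.card_coe_set_eq] at hmod
  have hmod' := (Nat.modEq_zero_iff_dvd.2 h16).symm.trans hmod
  set F := {a | a ∈ ((Q ⊓ centralizer {s} : Subgroup G) : Set G) ∧ ∀ k ∈ Q, k * a * k⁻¹ = a}
    with hF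
  obtain ⟨a, ha, ha1⟩ : ∃ a ∈ F, a ≠ 1 := by
    by_contra! hno
    have : F = {1} := by
      ext a
      refine ⟨fun ha => hno a ha, ?_⟩
      rintro rfl
      exact ⟨one_mem _, fun k _ => by group⟩
    rw [this, Set.ncard_singleton] at hmod'
    exact absurd hmod' (by decide)
  obtain ⟨m, hm⟩ := exists_pow_orderOf_eq hQp ha.1.1 ha1
  have haC : a ∈ centralizer ({s} : Set G) := ha.1.2
  rw [mem_centralizer_singleton_iff] at haC
  refine ⟨a ^ m, pow_mem (hQ ha.1.1) m, hm, ?_⟩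
  set L := twoStab G i o ⊓ centralizer {a} with hL
  have hQL : Q ≤ L := le_inf hQ fun k hk => mem_centralizer_singleton_iff.2
    (mul_mul_inv_eq_iff.1 (ha.2 k hk))
  have hsL : zpowers s ≤ L := zpowers_le.2 ⟨hs, mem_centralizer_singleton_iff.2 haC.symm⟩
  have h1 := card_dvd_of_le hQL
  have h2 := card_dvd_of_le hsL
  rw [Nat.card_zpowers, hs'] at h2
  rw [hQc] at h1
  have hLK : L = twoStab G i o := by
    refine eq_of_le_of_card_ge inf_le_left ?_
    rw [hK]
    exact Nat.le_of_dvd Nat.card_pos (Nat.Coprime.mul_dvd_of_dvd_of_dvd (by norm_num) h1 h2)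
  intro k hk
  rw [← hLK] at hk
  exact Commute.pow_right (mem_centralizer_singleton_iff.1 hk.2) m

theorem card_cp_eq_47 (h : Setting G Ω P) (hio : i ≠ o) {k x : G} (hk : k ∈ twoStab G i o)
    (h1 : k ≠ 1) (hx : x ∈ cp P i k) (hx1 : x ≠ 1) : Nat.card (cp P i k) = 47 := by
  refine (h.card_cp hio hk h1).resolve_left fun e => hx1 ?_
  rw [Subgroup.card_eq_one] at e
  rwa [e, mem_bot] at hx

theorem smul_eq_of_commute (h : Setting G Ω P) {v x : G} (hx : x ∈ P i) (hx1 : x ≠ 1)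
    (hv : v * x = x * v) : v • i = i := by
  by_contra hne
  refine hx1 (h.semireg i (v • i) hne x hx ?_)
  rw [← mul_smul, ← hv, mul_smul, h.fix i x hx]

theorem exists_fixed_ne (h : Setting G Ω P) {w : G} (hw2 : w * w = 1) (hwi : w • i = i) :
    ∃ a, a ≠ i ∧ w • a = a := by
  have hfin := h.finite
  by_contra! hno
  have hp : IsPGroup 2 (zpowers w) := IsPGroup.of_card_dvd_pow (n := 1) (by
    rw [Nat.card_zpowers, pow_one]
    exact orderOf_dvd_of_pow_eq_one (by rw [pow_two, hw2]))
  have hzi : ∀ k : zpowers w, (k : G) • i = i := fun k =>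
    (zpowers_le.2 (show w ∈ stabilizer G i from hwi)) k.2
  have := ncard_modEq_ncard_fixed hp ((MulAction.toPermHom G Ω).comp (zpowers w).subtype)
    (Y := {i}ᶜ) (fun k a ha e => ha
      (smul_left_cancel (k : G) ((show (k : G) • a = i from e).trans (hzi k).symm)))
  have he : {a | a ∈ ({i}ᶜ : Set Ω) ∧ ∀ k : zpowers w,
      ((MulAction.toPermHom G Ω).comp (zpowers w).subtype) k a = a} = ∅ := by
    ext a
    simp only [Set.mem_ofPred_eq, Set.mem_empty_iff_false, iff_false]
    exact fun hh => hno a hh.1 (hh.2 ⟨w, mem_zpowers w⟩)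
  rw [he, Set.ncard_empty] at this
  have h3 := Set.ncard_add_ncard_compl ({i} : Set Ω)
  rw [Set.ncard_singleton, h.card_Ω] at h3
  have h4 : ({i}ᶜ : Set Ω).ncard = 47 ^ 3 := by omega
  rw [h4] at this
  exact absurd this (by decide)

theorem exists_involution_card_cp (h : Setting G Ω P) (hio : i ≠ o) :
    ∃ v ∈ twoStab G i o, orderOf v = 2 ∧ Nat.card (cp P i v) = 47 := by
  have hfin := h.finite
  obtain ⟨ω, v, x, hv, hx, hx1, hvx⟩ := h.inv
  obtain ⟨g, rfl⟩ := h.exists_smul_eq ω i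
  obtain ⟨w, hw⟩ : ∃ w, w = g * v * g⁻¹ := ⟨_, rfl⟩
  have hwo : orderOf w = 2 := by
    rw [hw, ← hv]
    exact (MulAut.conj g).orderOf_eq v
  have hwx : w * (g * x * g⁻¹) = g * x * g⁻¹ * w := by
    calc w * (g * x * g⁻¹) = g * (v * x) * g⁻¹ := by rw [hw]; group
      _ = _ := by rw [hvx, hw]; group
  have hx' := h.conj g ω x hx
  have hx1' : g * x * g⁻¹ ≠ 1 := fun e => hx1 (conj_eq_one_iff.1 e)
  have hwi := h.smul_eq_of_commute hx' hx1' hwx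
  generalize g * x * g⁻¹ = x' at hwx hx' hx1'
  generalize g • ω = i at *
  obtain ⟨a, hai, ha⟩ := h.exists_fixed_ne (by rw [← pow_two, ← hwo, pow_orderOf_eq_one]) hwi
  obtain ⟨u, hu, rfl⟩ := h.trans i a o hai hio.symm
  have hk : u * w * u⁻¹ ∈ twoStab G i (u • a) := by
    refine ⟨?_, ?_⟩
    · change (u * w * u⁻¹) • i = i
      rw [mul_smul, mul_smul, h.fix i _ (inv_mem hu), hwi, h.fix i u hu]
    · change (u * w * u⁻¹) • u • a = u • a
      rw [mul_smul, inv_smul_smul, mul_smul, ha]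
  have hk2 : orderOf (u * w * u⁻¹) = 2 := by
    rw [← hwo]
    exact (MulAut.conj u).orderOf_eq w
  have hk1 : u * w * u⁻¹ ≠ 1 := fun e => by
    rw [e, orderOf_one] at hk2
    norm_num at hk2
  refine ⟨_, hk, hk2, h.card_cp_eq_47 hio hk hk1 (x := u * x' * u⁻¹) (mem_cp.2
    ⟨mul_mem (mul_mem hu hx') (inv_mem hu), ?_⟩) fun e => hx1' (conj_eq_one_iff.1 e)⟩
  calc u * x' * u⁻¹ * (u * w * u⁻¹) = u * (x' * w) * u⁻¹ := by group
    _ = _ := by rw [← hwx]; group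

theorem card_cp_eq_47_of_involution (h : Setting G Ω P) (hio : i ≠ o) {v w : G}
    (hv : v ∈ twoStab G i o) (hw : w ∈ twoStab G i o) (hv2 : v * v = 1) (hv1 : v ≠ 1)
    (hw2 : w * w = 1) (hc : Nat.card (cp P i w) = 47) :
    Nat.card (cp P i v) = 47 := by
  refine (h.card_cp hio hv hv1).resolve_left fun e => ?_
  have h1 := h.card_le_inverted hv.1 hv2
  have h2 := h.card_le_inverted hw.1 hw2
  rw [e, mul_one] at h1
  rw [hc] at h2
  have hinv : inverted P i v = P i := by
    refine Set.eq_of_subset_of_ncard_le (fun x hx => hx.1) ?_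
    rw [← Nat.card_coe_set_eq]
    exact (h.card_P i).le.trans h1
  have hle : (inverted P i w).ncard ≤ Nat.card (cp P i (v * w)) := by
    rw [← SetLike.coe_sort_coe, Nat.card_coe_set_eq]
    refine Set.ncard_le_ncard fun x hx => mem_cp.2 ⟨hx.1, ?_⟩
    have h3 : x⁻¹ ∈ inverted P i v := by rw [hinv]; exact inv_mem hx.1
    have h4 : v * x⁻¹ * v⁻¹ = x := by rw [h3.2, inv_inv]
    refine (mul_mul_inv_eq_iff.1 ?_).symm
    calc v * w * x * (v * w)⁻¹ = v * (w * x * w⁻¹) * v⁻¹ := by group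
      _ = x := by rw [hx.2, h4]
  have h5 := h.eq_one_of_card_cp hio (mul_mem hv hw) (by omega)
  have h6 : v = w := by
    rw [← mul_one v, ← hw2, ← mul_assoc, h5, one_mul]
  rw [h6, hc] at e
  norm_num at e

theorem exists_good_involution (h : Setting G Ω P) (hio : i ≠ o) :
    ∃ y ∈ twoStab G i o, y * y = 1 ∧ y ≠ 1 ∧ (∀ k ∈ twoStab G i o, k * y = y * k) ∧
      ∀ v ∈ twoStab G i o, v * v = 1 → v ≠ 1 → Nat.card (cp P i v) = 47 := by
  obtain ⟨y, hy, hy2, hyc⟩ := h.exists_central_involution hio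
  obtain ⟨v, hv, hv2, hv47⟩ := h.exists_involution_card_cp hio
  have h1 : y * y = 1 := by rw [← pow_two, ← hy2, pow_orderOf_eq_one]
  have h2 : y ≠ 1 := fun e => by
    rw [e, orderOf_one] at hy2
    norm_num at hy2
  have h3 : v * v = 1 := by rw [← pow_two, ← hv2, pow_orderOf_eq_one]
  have h4 := h.card_cp_eq_47_of_involution hio hy hv h1 h2 h3 hv47
  exact ⟨y, hy, h1, h2, hyc, fun w hw hw2 hw1 =>
    h.card_cp_eq_47_of_involution hio hw hy hw2 hw1 h1 h4⟩

end Setting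

section Param

variable {G : Type*} [Group G] [Finite G]

theorem exists_param {A : Subgroup G} (hA : Nat.card A = 47) :
    ∃ z : ZMod 47 → G, (∀ a b, z (a + b) = z a * z b) ∧ Function.Injective z ∧
      ∀ x, x ∈ A ↔ ∃ a, z a = x := by
  let e : Multiplicative (ZMod 47) ≃* A := mulEquivOfPrimeCardEq (p := 47)
    (by rw [Nat.card_congr Multiplicative.toAdd, Nat.card_zmod]) hA
  refine ⟨fun a => e (Multiplicative.ofAdd a), fun a b => ?_, fun a b hab => ?_, fun x => ?_⟩
  · simp
  · simpa using hab
  · constructor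
    · intro hx
      exact ⟨Multiplicative.toAdd (e.symm ⟨x, hx⟩), by simp⟩
    · rintro ⟨a, rfl⟩
      exact SetLike.coe_mem _

theorem exists_char {A K : Subgroup G} {z : ZMod 47 → G} (hz : ∀ a b, z (a + b) = z a * z b)
    (hi : Function.Injective z) (hA : ∀ x, x ∈ A ↔ ∃ a, z a = x)
    (hK : ∀ k ∈ K, ∀ x ∈ A, k * x * k⁻¹ ∈ A) :
    ∃ χ : G → ZMod 47, ∀ k ∈ K, ∀ a, k * z a * k⁻¹ = z (χ k * a) := by
  have key : ∀ k : G, ∃ c : ZMod 47, k ∈ K → ∀ a, k * z a * k⁻¹ = z (c * a) := by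
    intro k
    by_cases hk : k ∈ K
    · choose f hf using fun a => (hA _).1 (hK k hk (z a) ((hA _).2 ⟨a, rfl⟩))
      have hfa : ∀ a b, f (a + b) = f a + f b := fun a b => hi (by
        rw [hf, hz, hz, hf, hf]; group)
      refine ⟨f 1, fun _ a => ?_⟩
      have := ((AddMonoidHom.mk' f hfa).toZModLinearMap 47).map_smul a 1
      simp only [smul_eq_mul, mul_one, AddMonoidHom.coe_toZModLinearMap,
        AddMonoidHom.mk'_apply] at this
      rw [← hf, this, mul_comm]
    · exact ⟨0, fun h => absurd h hk⟩
  choose χ hχ using key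
  exact ⟨χ, hχ⟩

end Param

/-- A `Setting` together with a normalised description of the stabilizer of two points. -/
structure Frame {G Ω : Type*} [Group G] [MulAction G Ω] (P : Ω → Subgroup G) (i o : Ω)
    (y σ : G) (z : ZMod 47 → G) (χ : G → ZMod 47) : Prop extends Setting G Ω P where
  ne : i ≠ o
  y_mem : y ∈ Setting.twoStab G i o
  y_mul : y * y = 1
  y_ne : y ≠ 1
  y_comm : ∀ k ∈ Setting.twoStab G i o, k * y = y * k
  card_inv : ∀ v ∈ Setting.twoStab G i o, v * v = 1 → v ≠ 1 → Nat.card (Setting.cp P i v) = 47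
  s_mem : σ ∈ Setting.twoStab G i o
  s_order : orderOf σ = 23
  z_add : ∀ a b, z (a + b) = z a * z b
  z_inj : Function.Injective z
  mem_z : ∀ x, x ∈ Setting.cp P i y ↔ ∃ a, z a = x
  conj_z : ∀ k ∈ Setting.twoStab G i o, ∀ a, k * z a * k⁻¹ = z (χ k * a)

namespace Setting

variable {G Ω : Type*} [Group G] [Finite G] [MulAction G Ω] {P : Ω → Subgroup G} {i o : Ω}

theorem exists_frame (h : Setting G Ω P) : ∃ (i o : Ω) (y σ : G) (z : ZMod 47 → G)
    (χ : G → ZMod 47), Frame P i o y σ z χ := by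
  have hfin := h.finite
  have hnt : Nontrivial Ω := Finite.one_lt_card_iff_nontrivial.1 (by rw [h.card_Ω]; norm_num)
  obtain ⟨i, o, hio⟩ := exists_pair_ne Ω
  obtain ⟨y, hy, hy2, hy1, hyc, hinv⟩ := h.exists_good_involution hio
  obtain ⟨σ, hs, hs'⟩ := h.exists_orderOf_23 hio
  obtain ⟨z, hz, hzi, hzA⟩ := exists_param (hinv y hy hy2 hy1)
  obtain ⟨χ, hχ⟩ := exists_char (K := twoStab G i o) hz hzi hzA (by
    intro k hk x hx
    rw [mem_cp] at hx ⊢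
    refine ⟨h.conj_mem hk.1 hx.1, ?_⟩
    have h1 := hyc k⁻¹ (inv_mem hk)
    calc k * x * k⁻¹ * y = k * (x * y) * k⁻¹ := by rw [mul_assoc, h1]; group
      _ = y * (k * x * k⁻¹) := by rw [hx.2, ← mul_assoc, hyc k hk]; group)
  exact ⟨i, o, y, σ, z, χ, { h with
    ne := hio, y_mem := hy, y_mul := hy2, y_ne := hy1, y_comm := hyc, card_inv := hinv
    s_mem := hs, s_order := hs', z_add := hz, z_inj := hzi, mem_z := hzA, conj_z := hχ }⟩

end Setting

namespace Frame

open Setting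

variable {G Ω : Type*} [Group G] [Finite G] [MulAction G Ω] {P : Ω → Subgroup G} {i o : Ω}
  {y σ : G} {z : ZMod 47 → G} {χ : G → ZMod 47}

theorem z_zero (h : Frame P i o y σ z χ) : z 0 = 1 := by
  have := h.z_add 0 0
  rwa [add_zero, left_eq_mul] at this

theorem z_neg (h : Frame P i o y σ z χ) (a : ZMod 47) : z (-a) = (z a)⁻¹ := by
  rw [eq_inv_iff_mul_eq_one, ← h.z_add, neg_add_cancel, h.z_zero]

theorem z_comm (h : Frame P i o y σ z χ) (a b : ZMod 47) : z a * z b = z b * z a := by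
  rw [← h.z_add, ← h.z_add, add_comm]

theorem z_eq_one (h : Frame P i o y σ z χ) {a : ZMod 47} : z a = 1 ↔ a = 0 := by
  rw [← h.z_zero, h.z_inj.eq_iff]

theorem z_mem (h : Frame P i o y σ z χ) (a : ZMod 47) : z a ∈ P i :=
  (mem_cp.1 ((h.mem_z _).2 ⟨a, rfl⟩)).1

theorem z_mul_y (h : Frame P i o y σ z χ) (a : ZMod 47) : z a * y = y * z a :=
  (mem_cp.1 ((h.mem_z _).2 ⟨a, rfl⟩)).2

theorem card_K (h : Frame P i o y σ z χ) : Nat.card (twoStab G i o) = 736 :=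
  h.card_twoStab h.ne

theorem chi_mul (h : Frame P i o y σ z χ) {k l : G} (hk : k ∈ twoStab G i o)
    (hl : l ∈ twoStab G i o) : χ (k * l) = χ k * χ l := by
  have h1 := h.conj_z _ (mul_mem hk hl) 1
  have h2 : k * l * z 1 * (k * l)⁻¹ = k * (l * z 1 * l⁻¹) * k⁻¹ := by group
  rw [h2, h.conj_z l hl, h.conj_z k hk] at h1
  have := h.z_inj h1
  simpa using this.symm

theorem chi_one (h : Frame P i o y σ z χ) : χ 1 = 1 := by
  have := h.conj_z 1 (one_mem _) 1
  rw [one_mul, inv_one, mul_one, mul_one] at this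
  exact (h.z_inj this).symm

theorem chi_ne_zero (h : Frame P i o y σ z χ) {k : G} (hk : k ∈ twoStab G i o) : χ k ≠ 0 := by
  intro e
  have := h.chi_mul hk (inv_mem hk)
  rw [mul_inv_cancel, h.chi_one, e, zero_mul] at this
  exact one_ne_zero this

theorem chi_inv (h : Frame P i o y σ z χ) {k : G} (hk : k ∈ twoStab G i o) :
    χ k⁻¹ = (χ k)⁻¹ := by
  refine eq_inv_of_mul_eq_one_left ?_
  rw [← h.chi_mul (inv_mem hk) hk, inv_mul_cancel, h.chi_one]

theorem chi_pow (h : Frame P i o y σ z χ) {k : G} (hk : k ∈ twoStab G i o) (n : ℕ) :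
    χ (k ^ n) = χ k ^ n := by
  induction n with
  | zero => rw [pow_zero, pow_zero, h.chi_one]
  | succ n ih => rw [pow_succ, h.chi_mul (pow_mem hk n) hk, ih, pow_succ]

theorem chi_eq_one_iff (h : Frame P i o y σ z χ) {k : G} (hk : k ∈ twoStab G i o) :
    χ k = 1 ↔ ∀ a, k * z a = z a * k := by
  constructor
  · intro e a
    have := h.conj_z k hk a
    rwa [e, one_mul, mul_mul_inv_eq_iff] at this
  · intro e
    have := h.conj_z k hk 1
    rw [mul_mul_inv_eq_iff.2 (e 1)] at this
    have := h.z_inj this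
    rw [mul_one] at this
    exact this.symm

theorem eq_one_of_mem_zpowers (h : Frame P i o y σ z χ) {k x : G} (hk : k ∈ zpowers σ)
    (hx : x ∈ P i) (hx1 : x ≠ 1) (hkx : k * x = x * k) : k = 1 := by
  by_contra hne
  exact h.noncomm i x hx hx1 k (orderOf_of_mem_zpowers (by norm_num) h.s_order hk hne) hkx

theorem z_one_ne (h : Frame P i o y σ z χ) : z 1 ≠ 1 := fun e => one_ne_zero (h.z_eq_one.1 e)

theorem commute_s (h : Frame P i o y σ z χ) {k : G} (hk : k ∈ twoStab G i o) :
    k * σ = σ * k := by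
  have h1 := h.conj_mem_zpowers h.ne h.s_mem h.s_order hk (mem_zpowers σ)
  have h2 : k * σ * k⁻¹ * σ⁻¹ ∈ zpowers σ := mul_mem h1 (inv_mem (mem_zpowers σ))
  have h3 : k * σ * k⁻¹ * σ⁻¹ ∈ twoStab G i o := (zpowers_le.2 h.s_mem) h2
  have h4 := h.eq_one_of_mem_zpowers h2 (h.z_mem 1) h.z_one_ne
    ((h.chi_eq_one_iff h3).1 (by
      have hs := h.s_mem
      rw [h.chi_mul (mul_mem (mul_mem hk hs) (inv_mem hk)) (inv_mem hs),
        h.chi_mul (mul_mem hk hs) (inv_mem hk), h.chi_mul hk hs, h.chi_inv hk, h.chi_inv hs]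
      have := h.chi_ne_zero hk
      have := h.chi_ne_zero hs
      field_simp) 1)
  exact mul_mul_inv_eq_iff.1 (mul_inv_eq_one.1 h4)

theorem mem_K_iff (h : Frame P i o y σ z χ) {g : G} : g ∈ twoStab G i o ↔ g * σ = σ * g := by
  have : twoStab G i o = centralizer {σ} := eq_of_le_of_card_ge
    (fun k hk => mem_centralizer_singleton_iff.2 (h.commute_s hk))
    (by rw [h.card_K, h.cent σ h.s_order])
  rw [this, mem_centralizer_singleton_iff]

theorem conj_mem_K {τ k : G} (h1 : τ • i = o) (h2 : τ • o = i) (hk : k ∈ twoStab G i o) :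
    τ * k * τ⁻¹ ∈ twoStab G i o := by
  have h3 : τ⁻¹ • i = o := inv_smul_eq_iff.2 h2.symm
  have h4 : τ⁻¹ • o = i := inv_smul_eq_iff.2 h1.symm
  refine mem_twoStab.2 ⟨?_, ?_⟩
  · rw [mul_smul, mul_smul, h3, hk.2, h2]
  · rw [mul_smul, mul_smul, h4, hk.1, h1]

theorem conj_s (h : Frame P i o y σ z χ) {τ : G} (h1 : τ • i = o) (h2 : τ • o = i) :
    τ * σ * τ⁻¹ = σ⁻¹ := by
  have hmem := conj_mem_K h1 h2 h.s_mem
  have h23 : (τ * σ * τ⁻¹) ^ 23 = 1 := by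
    rw [conj_pow, ← h.s_order, pow_orderOf_eq_one, mul_one, mul_inv_cancel]
  obtain ⟨n, hn⟩ := h.mem_zpowers_of_pow_eq_one h.ne h.s_mem h.s_order hmem h23
  have hn : σ ^ n = τ * σ * τ⁻¹ := hn
  have hτ2 : τ * τ ∈ twoStab G i o := by
    refine mem_twoStab.2 ⟨?_, ?_⟩
    · rw [mul_smul, h1, h2]
    · rw [mul_smul, h2, h1]
  have h3 : σ ^ (n * n) = σ := by
    rw [zpow_mul, hn]
    calc (τ * σ * τ⁻¹) ^ n = τ * σ ^ n * τ⁻¹ := conj_zpow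
      _ = τ * τ * σ * (τ * τ)⁻¹ := by rw [hn]; group
      _ = σ := mul_mul_inv_eq_iff.2 (h.commute_s hτ2)
  have h4 : σ ^ (n * n - 1) = 1 := by rw [zpow_sub_one, h3, mul_inv_cancel]
  rw [← orderOf_dvd_iff_zpow_eq_one, h.s_order] at h4
  have h5 : (n * n - 1 : ℤ) = (n - 1) * (n + 1) := by ring
  rw [h5] at h4
  rcases (Int.Prime.dvd_mul' (by norm_num) h4) with h6 | h6
  · exfalso
    have h7 : σ ^ (n - 1) = 1 := by
      rw [← orderOf_dvd_iff_zpow_eq_one, h.s_order]; exact h6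
    rw [zpow_sub_one, hn, mul_inv_eq_one, mul_mul_inv_eq_iff] at h7
    have := (h.mem_K_iff.2 h7).1
    exact h.ne ((show τ • i = i from this).symm.trans h1)
  · have h7 : σ ^ (n + 1) = 1 := by
      rw [← orderOf_dvd_iff_zpow_eq_one, h.s_order]; exact h6
    rw [zpow_add_one, hn] at h7
    exact eq_inv_of_mul_eq_one_left h7

end Frame

theorem ncard_mul_eq_ncard_mul {α β : Type*} [Finite α] [Finite β] {S : Set α} {T : Set β}
    (r : α → β → Prop) {m n : ℕ} (hm : ∀ a ∈ S, {b | b ∈ T ∧ r a b}.ncard = m)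
    (hn : ∀ b ∈ T, {a | a ∈ S ∧ r a b}.ncard = n) : S.ncard * m = T.ncard * n := by
  classical
  have := Fintype.ofFinite α
  have := Fintype.ofFinite β
  have := Finset.card_mul_eq_card_mul (s := S.toFinset) (t := T.toFinset) r (m := m) (n := n)
    (fun a ha => by
      rw [← hm a (Set.mem_toFinset.1 ha), Set.ncard_eq_toFinset_card']
      congr 1; ext b; simp [Finset.bipartiteAbove])
    (fun b hb => by
      rw [← hn b (Set.mem_toFinset.1 hb), Set.ncard_eq_toFinset_card']
      congr 1; ext b; simp [Finset.bipartiteBelow])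
  rwa [← Set.ncard_eq_toFinset_card', ← Set.ncard_eq_toFinset_card'] at this

theorem zpowers_eq_of_card_47 {G : Type*} [Group G] {D : Subgroup G} (hD : Nat.card D = 47)
    {a : G} (ha : a ∈ D) (ha1 : a ≠ 1) : zpowers a = D := by
  have hfin : Finite D := Nat.finite_of_card_ne_zero (by rw [hD]; norm_num)
  refine eq_of_le_of_card_ge (zpowers_le.2 ha) ?_
  have hd := card_dvd_of_le (zpowers_le.2 ha)
  rw [hD] at hd ⊢
  rcases (Nat.dvd_prime (by norm_num)).1 hd with h1 | h1
  · rw [Nat.card_zpowers, orderOf_eq_one_iff] at h1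
    exact absurd h1 ha1
  · rw [h1]

namespace Frame

open Setting

variable {G Ω : Type*} [Group G] [Finite G] [MulAction G Ω] {P : Ω → Subgroup G} {i o : Ω}
  {y σ : G} {z : ZMod 47 → G} {χ : G → ZMod 47}

theorem cp_eq (h : Frame P i o y σ z χ) {k a : G} (hk : k ∈ twoStab G i o) (hk1 : k ≠ 1)
    {D : Subgroup G} (hD : Nat.card D = 47) (ha : a ∈ D) (ha1 : a ≠ 1) (hak : a ∈ cp P i k) :
    cp P i k = D := by
  rw [← zpowers_eq_of_card_47 hD ha ha1,
    zpowers_eq_of_card_47 (h.card_cp_eq_47 h.ne hk hk1 hak ha1) hak ha1]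

theorem card_A (h : Frame P i o y σ z χ) : Nat.card (cp P i y) = 47 :=
  h.card_inv y h.y_mem h.y_mul h.y_ne

theorem card_center (h : Frame P i o y σ z χ) {Z : Subgroup G}
    (hZ : ∀ x, x ∈ Z ↔ x ∈ P i ∧ ∀ p ∈ P i, p * x = x * p) (hZc : Nat.card Z = 47) :
    Z = cp P i y := by
  by_contra hne
  have hdisj : Disjoint (cp P i y) Z := by
    rw [disjoint_def]
    intro x hx hx'
    by_contra hx1
    exact hne (by rw [← zpowers_eq_of_card_47 hZc hx' hx1,
      zpowers_eq_of_card_47 h.card_A hx hx1])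
  have hinj := mul_injective_of_disjoint hdisj
  have hAK : ∀ k ∈ twoStab G i o, ∀ x ∈ cp P i y, k * x * k⁻¹ ∈ cp P i y := by
    intro k hk x hx
    obtain ⟨a, rfl⟩ := (h.mem_z x).1 hx
    rw [h.conj_z k hk]
    exact (h.mem_z _).2 ⟨_, rfl⟩
  have hZK : ∀ k ∈ twoStab G i o, ∀ x ∈ Z, k * x * k⁻¹ ∈ Z := by
    intro k hk x hx
    rw [hZ] at hx ⊢
    refine ⟨h.conj_mem hk.1 hx.1, fun p hp => ?_⟩
    have h1 := hx.2 _ (h.conj_mem (inv_mem hk).1 hp)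
    calc p * (k * x * k⁻¹) = k * (k⁻¹ * p * k⁻¹⁻¹ * x) * k⁻¹ := by group
      _ = k * x * k⁻¹ * p := by rw [h1]; group
  let A' : Set G := {x | x ∈ cp P i y ∧ x ≠ 1}
  let Z' : Set G := {x | x ∈ Z ∧ x ≠ 1}
  let Y : Set G := (fun p : G × G => p.1 * p.2) '' (A' ×ˢ Z')
  have huniq : ∀ a ∈ cp P i y, ∀ a' ∈ cp P i y, ∀ b ∈ Z, ∀ b' ∈ Z, a * b = a' * b' →
      a = a' ∧ b = b' := by
    intro a ha a' ha' b hb b' hb' e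
    have := @hinj (⟨a, ha⟩, ⟨b, hb⟩) (⟨a', ha'⟩, ⟨b', hb'⟩) e
    simpa using this
  have hY : Y.ncard = 46 * 46 := by
    have h1 : A'.ncard = 46 := by rw [ncard_ne_one_eq, h.card_A]
    have h2 : Z'.ncard = 46 := by rw [ncard_ne_one_eq, hZc]
    rw [Set.InjOn.ncard_image, Set.ncard_prod, h1, h2]
    rintro ⟨a, b⟩ ⟨ha, hb⟩ ⟨a', b'⟩ ⟨ha', hb'⟩ e
    have := huniq a ha.1 a' ha'.1 b hb.1 b' hb'.1 e
    rw [this.1, this.2]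
  have hd := card_dvd_ncard_of_conj_free (twoStab G i o) (Y := Y) (by
      rintro k hk _ ⟨⟨a, b⟩, ⟨ha, hb⟩, rfl⟩
      refine ⟨(k * a * k⁻¹, k * b * k⁻¹), ⟨⟨hAK k hk a ha.1, fun e => ha.2 (conj_eq_one_iff.1 e)⟩,
        ⟨hZK k hk b hb.1, fun e => hb.2 (conj_eq_one_iff.1 e)⟩⟩, ?_⟩
      group) (by
      rintro _ ⟨⟨a, b⟩, ⟨ha, hb⟩, rfl⟩ k hk e
      have e' : k * a * k⁻¹ * (k * b * k⁻¹) = a * b := by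
        have e : k * (a * b) * k⁻¹ = a * b := e
        rw [← e]; group
      obtain ⟨e1, e2⟩ := huniq _ (hAK k hk a ha.1) a ha.1 _ (hZK k hk b hb.1) b hb.1 e'
      by_contra hk1
      refine hne ?_
      rw [← h.cp_eq hk hk1 h.card_A ha.1 ha.2 (mem_cp.2 ⟨(mem_cp.1 ha.1).1,
        (mul_mul_inv_eq_iff.1 e1).symm⟩)]
      exact (h.cp_eq hk hk1 hZc hb.1 hb.2 (mem_cp.2 ⟨((hZ b).1 hb.1).1,
        (mul_mul_inv_eq_iff.1 e2).symm⟩)).symm)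
  rw [h.card_K, hY] at hd
  norm_num at hd

theorem z_central (h : Frame P i o y σ z χ) {x : G} (hx : x ∈ P i) (a : ZMod 47) :
    x * z a = z a * x := by
  have hp : IsPGroup 47 (P i) := IsPGroup.of_card (h.card_P i)
  have hnt : Nontrivial (P i) := Finite.one_lt_card_iff_nontrivial.1 (by
    rw [h.card_P]; norm_num)
  let Z := (center (P i)).map (P i).subtype
  have hZ : ∀ x, x ∈ Z ↔ x ∈ P i ∧ ∀ p ∈ P i, p * x = x * p := by
    intro x
    constructor
    · rintro ⟨u, hu, rfl⟩
      exact ⟨u.2, fun p hp => congrArg Subtype.val (mem_center_iff.1 hu ⟨p, hp⟩)⟩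
    · rintro ⟨hx, hx'⟩
      exact ⟨⟨x, hx⟩, mem_center_iff.2 fun p => Subtype.ext (hx' p p.2), rfl⟩
  have hZc : Nat.card Z = Nat.card (center (P i)) := card_map_of_injective (subtype_injective _)
  have hd := card_subgroup_dvd_card (center (P i))
  rw [h.card_P] at hd
  obtain ⟨j, hj, hj'⟩ := (Nat.dvd_prime_pow (by norm_num)).1 hd
  have h1 := (hp.bot_lt_center).ne'
  by_cases hj1 : j = 1
  · have hA := h.card_center hZ (by rw [hZc, hj', hj1, pow_one])
    have : z a ∈ Z := hA ▸ (h.mem_z _).2 ⟨a, rfl⟩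
    exact ((hZ _).1 this).2 x hx
  · have hcyc : IsCyclic (P i ⧸ center (P i)) := by
      have hq := Subgroup.card_eq_card_quotient_mul_card_subgroup (center (P i))
      rw [h.card_P, hj'] at hq
      interval_cases j
      · exact absurd (card_eq_one.1 (hj'.trans (pow_zero _))) h1
      · exact absurd rfl hj1
      · exact isCyclic_of_prime_card (p := 47) (by omega)
      · have : Nat.card (P i ⧸ center (P i)) = 1 := by omega
        have := (Nat.card_eq_one_iff_unique.1 this).1
        exact isCyclic_of_subsingleton
    have := (QuotientGroup.mk' (center (P i))).isMulCommutative_of_isCyclic_of_ker_le_center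
      (by rw [QuotientGroup.ker_mk'])
    exact congrArg Subtype.val (mul_comm' (⟨x, hx⟩ : P i) ⟨z a, h.z_mem a⟩)

theorem y_inv (h : Frame P i o y σ z χ) : y⁻¹ = y := inv_eq_of_mul_eq_one_left h.y_mul

theorem z_inv_two (h : Frame P i o y σ z χ) {b b' : G} {a a' : ZMod 47}
    (hb : b ∈ inverted P i y) (hb' : b' ∈ inverted P i y) (e : b * z a = b' * z a') :
    b = b' ∧ a = a' := by
  have key : ∀ b ∈ inverted P i y, ∀ a, b * z a * (y * (b * z a) * y⁻¹) = z (a + a) := by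
    intro b hb a
    calc b * z a * (y * (b * z a) * y⁻¹) = b * z a * ((y * b * y⁻¹) * (y * z a) * y⁻¹) := by group
      _ = b * z a * (b⁻¹ * z a) := by rw [hb.2, ← h.z_mul_y]; group
      _ = z (a + a) := by
        rw [h.z_central hb.1, h.z_add]; group
  have h1 := key b hb a
  rw [e, key b' hb' a'] at h1
  have h2 := h.z_inj h1
  have h3 : a = a' := by
    have : (2 : ZMod 47) * a' = 2 * a := by rw [two_mul, two_mul, h2]
    exact (mul_left_cancel₀ (by decide) this).symm
  subst h3
  exact ⟨mul_right_cancel e, rfl⟩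

theorem card_B_and_exists (h : Frame P i o y σ z χ) : (inverted P i y).ncard = 47 ^ 2 ∧
    ∀ x ∈ P i, ∃ b ∈ inverted P i y, ∃ a, x = b * z a := by
  have h1 := h.card_le_inverted h.y_mem.1 h.y_mul
  rw [h.card_A] at h1
  let f : inverted P i y × ZMod 47 → P i := fun p => ⟨p.1 * z p.2, mul_mem p.1.2.1 (h.z_mem _)⟩
  have hf : Function.Injective f := by
    rintro ⟨⟨b, hb⟩, a⟩ ⟨⟨b', hb'⟩, a'⟩ e
    obtain ⟨rfl, rfl⟩ := h.z_inv_two hb hb' (congrArg Subtype.val e)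
    rfl
  have hcard : Nat.card (inverted P i y × ZMod 47) = (inverted P i y).ncard * 47 := by
    rw [Nat.card_prod, Nat.card_zmod, Nat.card_coe_set_eq]
  have hle := Nat.card_le_card_of_injective f hf
  rw [hcard, h.card_P] at hle
  refine ⟨by omega, fun x hx => ?_⟩
  have hs := ((Nat.bijective_iff_injective_and_card f).2
    ⟨hf, by rw [hcard, h.card_P]; omega⟩).2 ⟨x, hx⟩
  obtain ⟨⟨⟨b, hb⟩, a⟩, e⟩ := hs
  exact ⟨b, hb, a, (congrArg Subtype.val e).symm⟩

theorem card_B (h : Frame P i o y σ z χ) : (inverted P i y).ncard = 47 ^ 2 :=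
  h.card_B_and_exists.1

theorem exists_mul_z (h : Frame P i o y σ z χ) {x : G} (hx : x ∈ P i) :
    ∃ b ∈ inverted P i y, ∃ a, x = b * z a := h.card_B_and_exists.2 x hx

theorem conj_mem_B (h : Frame P i o y σ z χ) {k b : G} (hk : k ∈ twoStab G i o)
    (hb : b ∈ inverted P i y) : k * b * k⁻¹ ∈ inverted P i y := by
  refine ⟨h.conj_mem hk.1 hb.1, ?_⟩
  calc y * (k * b * k⁻¹) * y⁻¹ = y * k * b * (y * k)⁻¹ := by group
    _ = k * (y * b * y⁻¹) * k⁻¹ := by rw [← h.y_comm k hk]; group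
    _ = _ := by rw [hb.2]; group

theorem inv_mem_B {b : G} (hb : b ∈ inverted P i y) :
    b⁻¹ ∈ inverted P i y := by
  refine ⟨inv_mem hb.1, ?_⟩
  calc y * b⁻¹ * y⁻¹ = (y * b * y⁻¹)⁻¹ := by group
    _ = _ := by rw [hb.2]

theorem one_mem_B : (1 : G) ∈ inverted P i y := ⟨one_mem _, by group⟩

theorem conj_mul_z (h : Frame P i o y σ z χ) {k b : G} (hk : k ∈ twoStab G i o) (a : ZMod 47) :
    k * (b * z a) * k⁻¹ = k * b * k⁻¹ * z (χ k * a) := by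
  rw [← h.conj_z k hk]; group

theorem eq_y_of_chi (h : Frame P i o y σ z χ) {n : G} (hn : n ∈ twoStab G i o) (hn2 : n * n = 1)
    (hn1 : n ≠ 1) (hc : χ n = 1) : n = y := by
  have h1 := h.card_le_inverted hn.1 hn2
  rw [h.card_inv n hn hn2 hn1] at h1
  have hsub : inverted P i n ⊆ (cp P i (y * n) : Set G) := by
    rintro x ⟨hx, hx'⟩
    obtain ⟨b, hb, a, rfl⟩ := h.exists_mul_z hx
    rw [h.conj_mul_z hn, hc, one_mul, mul_inv_rev, ← h.z_neg,
      ← h.z_central (inv_mem hb.1)] at hx'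
    obtain ⟨h2, h3⟩ := h.z_inv_two (h.conj_mem_B hn hb) (inv_mem_B hb) hx'
    have h4 : a = 0 := by
      have : (2 : ZMod 47) * a = 0 := by rw [two_mul]; nth_rewrite 1 [h3]; ring
      exact (mul_eq_zero.1 this).resolve_left (by decide)
    rw [h4, h.z_zero, mul_one]
    refine mem_cp.2 ⟨hb.1, (mul_mul_inv_eq_iff.1 ?_).symm⟩
    calc y * n * b * (y * n)⁻¹ = y * (n * b * n⁻¹) * y⁻¹ := by group
      _ = b := by rw [h2, (inv_mem_B hb).2, inv_inv]
  have h2 : (inverted P i n).ncard ≤ Nat.card (cp P i (y * n)) := by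
    rw [← SetLike.coe_sort_coe, Nat.card_coe_set_eq]
    exact Set.ncard_le_ncard hsub
  have h3 := h.eq_one_of_card_cp h.ne (mul_mem h.y_mem hn) (by omega)
  rw [← h.y_inv]
  exact eq_inv_of_mul_eq_one_right h3

theorem exists_smul_eq_of_ne (h : Frame P i o y σ z χ) {x : Ω} (hx : x ≠ i) :
    ∃ b ∈ inverted P i y, ∃ a, x = (b * z a) • o := by
  obtain ⟨p, hp, rfl⟩ := h.trans i o x h.ne.symm hx
  obtain ⟨b, hb, a, rfl⟩ := h.exists_mul_z hp
  exact ⟨b, hb, a, rfl⟩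

theorem smul_mul_z (h : Frame P i o y σ z χ) {k : G} (hk : k ∈ twoStab G i o) (b : G)
    (a : ZMod 47) : k • (b * z a) • o = (k * b * k⁻¹ * z (χ k * a)) • o := by
  rw [← h.conj_mul_z hk, conj_smul hk.2]

theorem mul_z_smul_inj (h : Frame P i o y σ z χ) {b b' : G} {a a' : ZMod 47}
    (hb : b ∈ inverted P i y) (hb' : b' ∈ inverted P i y)
    (e : (b * z a) • o = (b' * z a') • o) : b = b' ∧ a = a' :=
  h.z_inv_two hb hb' (h.eq_of_smul_eq h.ne (mul_mem hb.1 (h.z_mem _))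
    (mul_mem hb'.1 (h.z_mem _)) e)

theorem chi_y (h : Frame P i o y σ z χ) : χ y = 1 :=
  (h.chi_eq_one_iff h.y_mem).2 fun a => (h.z_mul_y a).symm

theorem eq_one_of_mul_self (h : Frame P i o y σ z χ) {b : G} (hb : b ∈ P i)
    (e : b * b = 1) : b = 1 := by
  have h1 : orderOf b ∣ 2 := orderOf_dvd_of_pow_eq_one (by rw [pow_two, e])
  have h2 : orderOf b ∣ 47 ^ 3 := by
    rw [← h.card_P i]; exact (Subgroup.orderOf_dvd_natCard _ hb)
  have h3 : orderOf b ∣ 1 := by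
    have := Nat.dvd_gcd h1 h2
    rwa [show Nat.gcd 2 (47 ^ 3) = 1 by norm_num] at this
  exact orderOf_eq_one_iff.1 (Nat.dvd_one.1 h3)

theorem y_smul_eq_iff (h : Frame P i o y σ z χ) {b : G} (hb : b ∈ inverted P i y) (a : ZMod 47) :
    y • (b * z a) • o = (b * z a) • o ↔ b = 1 := by
  rw [h.smul_mul_z h.y_mem]
  constructor
  · intro e
    have := (h.mul_z_smul_inj (h.conj_mem_B h.y_mem hb) hb e).1
    rw [hb.2] at this
    exact h.eq_one_of_mul_self hb.1 (by nth_rewrite 1 [← this]; group)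
  · rintro rfl
    rw [h.chi_y, one_mul]
    simp

/-- Nontrivial elements of the two-point stabilizer fixing a point moved by `y`. -/
theorem involution_of_fix (h : Frame P i o y σ z χ) {k : G} (hk : k ∈ twoStab G i o)
    (hk1 : k ≠ 1) {x : Ω} (hx : y • x ≠ x) (hkx : k • x = x) : k * k = 1 ∧ χ k ≠ 1 := by
  have hxi : x ≠ i := fun e => hx (by rw [e]; exact h.y_mem.1)
  obtain ⟨b, hb, a, rfl⟩ := h.exists_smul_eq_of_ne hxi
  have hb1 : b ≠ 1 := fun e => hx ((h.y_smul_eq_iff hb a).2 e)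
  rw [h.smul_mul_z hk] at hkx
  have hkb := mul_mul_inv_eq_iff.1 (h.mul_z_smul_inj (h.conj_mem_B hk hb) hb hkx).1
  have key : ∀ l ∈ twoStab G i o, l * b = b * l → χ l = 1 → l = 1 := by
    intro l hl hlb hc
    by_contra hl1
    have h1 := h.cp_eq hl hl1 h.card_A ((h.mem_z _).2 ⟨1, rfl⟩) h.z_one_ne
      (mem_cp.2 ⟨h.z_mem 1, ((h.chi_eq_one_iff hl).1 hc 1).symm⟩)
    have h2 : b ∈ cp P i l := mem_cp.2 ⟨hb.1, hlb.symm⟩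
    rw [h1] at h2
    obtain ⟨a', rfl⟩ := (h.mem_z b).1 h2
    have h3 := hb.2
    rw [mul_mul_inv_eq_iff.2 (h.z_mul_y a').symm] at h3
    exact hb1 (h.eq_one_of_mul_self hb.1 (by nth_rewrite 1 [h3]; group))
  have hkp : ∀ n : ℕ, k ^ n * b = b * k ^ n := fun n => (Commute.pow_left hkb n)
  have h46 : k ^ 46 = 1 := key _ (pow_mem hk 46) (hkp 46) (by
    rw [h.chi_pow hk]; exact ZMod.pow_card_sub_one_eq_one (h.chi_ne_zero hk))
  have h2 : k ^ 2 = 1 := h.eq_one_of_mem_zpowers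
    (h.mem_zpowers_of_pow_eq_one h.ne h.s_mem h.s_order (pow_mem hk 2) (by
      rw [← pow_mul, h46])) hb.1 hb1 (hkp 2)
  exact ⟨by rw [← pow_two, h2], fun hc => hk1 (key k hk hkb hc)⟩

end Frame

namespace Frame

open Setting

variable {G Ω : Type*} [Group G] [Finite G] [MulAction G Ω] {P : Ω → Subgroup G} {i o : Ω}
  {y σ : G} {z : ZMod 47 → G} {χ : G → ZMod 47}

theorem y_smul_z (h : Frame P i o y σ z χ) (a : ZMod 47) : y • z a • o = z a • o := by
  have := (h.y_smul_eq_iff one_mem_B a).2 rfl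
  rwa [one_mul] at this

theorem fix_y_iff (h : Frame P i o y σ z χ) (x : Ω) : y • x = x ↔ x = i ∨ ∃ a, x = z a • o := by
  constructor
  · intro hx
    by_cases hxi : x = i
    · exact Or.inl hxi
    · obtain ⟨b, hb, a, rfl⟩ := h.exists_smul_eq_of_ne hxi
      refine Or.inr ⟨a, ?_⟩
      rw [(h.y_smul_eq_iff hb a).1 hx, one_mul]
  · rintro (rfl | ⟨a, rfl⟩)
    · exact h.y_mem.1
    · exact h.y_smul_z a

theorem ncard_fix_y (h : Frame P i o y σ z χ) : {x : Ω | y • x = x}.ncard = 48 := by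
  rw [h.ncard_fixed h.ne h.y_mem, h.card_A]

theorem ncard_moved (h : Frame P i o y σ z χ) : {x : Ω | y • x ≠ x}.ncard = 103776 := by
  have := h.finite
  have h1 := Set.ncard_add_ncard_compl {x : Ω | y • x = x}
  rw [h.ncard_fix_y, h.card_Ω] at h1
  have : {x : Ω | y • x = x}ᶜ = {x : Ω | y • x ≠ x} := rfl
  rw [← this]
  omega

theorem chi_eq_neg_one (h : Frame P i o y σ z χ) {n : G} (hn : n ∈ twoStab G i o)
    (hn2 : n * n = 1) (hn1 : n ≠ 1) (hny : n ≠ y) : χ n = -1 := by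
  have h1 : χ n * χ n = 1 := by rw [← h.chi_mul hn hn, hn2, h.chi_one]
  rcases mul_self_eq_one_iff.1 h1 with h2 | h2
  · exact absurd (h.eq_y_of_chi hn hn2 hn1 h2) hny
  · exact h2

/-- The involutions of the two-point stabilizer other than the central one. -/
def extra (G : Type*) {Ω : Type*} [Group G] [MulAction G Ω] (i o : Ω) (y : G) : Set G :=
  {n | n ∈ twoStab G i o ∧ n * n = 1 ∧ n ≠ 1 ∧ n ≠ y}

theorem ncard_fix_extra (h : Frame P i o y σ z χ) {n : G} (hn : n ∈ extra G i o y) :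
    {x : Ω | y • x ≠ x ∧ n • x = x}.ncard = 46 := by
  have hfin := h.finite
  obtain ⟨hnK, hn2, hn1, hny⟩ := hn
  have hchi := h.chi_eq_neg_one hnK hn2 hn1 hny
  have h1 : {x : Ω | n • x = x} = {x | y • x ≠ x ∧ n • x = x} ∪ {i, o} := by
    ext x
    simp only [Set.mem_ofPred_eq, Set.mem_union, Set.mem_insert_iff, Set.mem_singleton_iff]
    constructor
    · intro hx
      by_cases hyx : y • x = x
      · rcases (h.fix_y_iff x).1 hyx with hxi | ⟨a, rfl⟩
        · exact Or.inr (Or.inl hxi)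
        · refine Or.inr (Or.inr ?_)
          have h2 := h.smul_mul_z hnK 1 a
          rw [one_mul, hx, hchi, mul_one, mul_inv_cancel, one_mul] at h2
          have h3 := h.z_inj (h.eq_of_smul_eq h.ne (h.z_mem _) (h.z_mem _) h2)
          have h4 : a = 0 := by
            have : (2 : ZMod 47) * a = 0 := by rw [two_mul]; nth_rewrite 1 [h3]; ring
            exact (mul_eq_zero.1 this).resolve_left (by decide)
          rw [h4, h.z_zero, one_smul]
      · exact Or.inl ⟨hyx, hx⟩
    · rintro (hx | rfl | rfl)
      · exact hx.2
      · exact hnK.1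
      · exact hnK.2
  have h2 := h.ncard_fixed h.ne hnK
  rw [h.card_inv n hnK hn2 hn1, h1, Set.ncard_union_eq ?_ (Set.toFinite _) (Set.toFinite _),
    Set.ncard_pair h.ne] at h2
  · omega
  · rw [Set.disjoint_left]
    rintro x hx (rfl | rfl)
    · exact hx.1 h.y_mem.1
    · exact hx.1 h.y_mem.2

theorem y_smul_smul (h : Frame P i o y σ z χ) {k : G} (hk : k ∈ twoStab G i o) (x : Ω) :
    y • k • x = k • y • x := by
  rw [← mul_smul, ← h.y_comm k hk, mul_smul]

theorem sixteen_dvd (h : Frame P i o y σ z χ) : 16 ∣ (extra G i o y).ncard := by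
  have hfin := h.finite
  set X : Set Ω := {x | y • x ≠ x} with hX
  set Y : Set Ω := {x | y • x ≠ x ∧ ∃ n ∈ extra G i o y, n • x = x} with hY
  have hYX : Y ⊆ X := fun x hx => hx.1
  have hm : (extra G i o y).ncard * 46 = Y.ncard * 1 := by
    refine ncard_mul_eq_ncard_mul (fun n x => n • x = x) (fun n hn => ?_) (fun x hx => ?_)
    · rw [← h.ncard_fix_extra hn]
      congr 1
      ext x
      exact ⟨fun hx => ⟨hx.1.1, hx.2⟩, fun hx => ⟨⟨hx.1, n, hn, hx.2⟩, hx.2⟩⟩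
    · obtain ⟨hx, n, hn, hnx⟩ := hx
      rw [Set.ncard_eq_one]
      refine ⟨n, ?_⟩
      ext k
      refine ⟨fun ⟨hk, hkx⟩ => ?_, ?_⟩
      · by_contra hkn
        have h1 : k * n⁻¹ ∈ twoStab G i o := mul_mem hk.1 (inv_mem hn.1)
        refine (h.involution_of_fix h1 (fun e => hkn (mul_inv_eq_one.1 e)) hx ?_).2 ?_
        · rw [mul_smul, inv_smul_eq_iff.2 hnx.symm, hkx]
        · rw [h.chi_mul hk.1 (inv_mem hn.1), h.chi_inv hn.1,
            h.chi_eq_neg_one hk.1 hk.2.1 hk.2.2.1 hk.2.2.2,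
            h.chi_eq_neg_one hn.1 hn.2.1 hn.2.2.1 hn.2.2.2]
          exact mul_inv_cancel₀ (by decide)
      · rintro rfl
        exact ⟨hn, hnx⟩
  have hXK : ∀ k ∈ twoStab G i o, ∀ x ∈ X, k • x ∈ X := by
    intro k hk x hx e
    rw [h.y_smul_smul hk] at e
    exact hx (smul_left_cancel k e)
  have hYK : ∀ k ∈ twoStab G i o, ∀ x ∈ Y, k • x ∈ Y := by
    rintro k hk x ⟨hx, n, hn, hnx⟩
    refine ⟨hXK k hk x hx, k * n * k⁻¹, ⟨mul_mem (mul_mem hk hn.1) (inv_mem hk), ?_,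
      fun e => hn.2.2.1 (conj_eq_one_iff.1 e), fun e => hn.2.2.2 ?_⟩, ?_⟩
    · calc k * n * k⁻¹ * (k * n * k⁻¹) = k * (n * n) * k⁻¹ := by group
        _ = 1 := by rw [hn.2.1]; group
    · have h1 : n = k⁻¹ * y * k := by rw [← e]; group
      rw [h1, mul_assoc, ← h.y_comm k hk, inv_mul_cancel_left]
    · rw [mul_smul, mul_smul, inv_smul_smul, hnx]
  have hfree := card_dvd_ncard_of_free
    ((MulAction.toPermHom G Ω).comp (twoStab G i o).subtype) (Y := X \ Y)
    (by
      rintro ⟨k, hk⟩ x ⟨hx, hxY⟩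
      refine ⟨hXK k hk x hx, fun e => hxY ?_⟩
      have := hYK k⁻¹ (inv_mem hk) _ e
      change k⁻¹ • k • x ∈ Y at this
      rwa [inv_smul_smul] at this)
    (by
      rintro x ⟨hx, hxY⟩ ⟨k, hk⟩ e
      by_contra hk1
      have hk1 : k ≠ 1 := fun e => hk1 (Subtype.ext e)
      have e : k • x = x := e
      have h1 := h.involution_of_fix hk hk1 hx e
      exact hxY ⟨hx, k, ⟨hk, h1.1, hk1, fun e => h1.2 (e ▸ h.chi_y)⟩, e⟩)
  rw [h.card_K, Set.ncard_sdiff hYX, h.ncard_moved] at hfree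
  have hle := Set.ncard_le_ncard hYX
  rw [h.ncard_moved] at hle
  omega

theorem involutions_ncard (h : Frame P i o y σ z χ) :
    {t | t ∈ twoStab G i o ∧ t * t = 1 ∧ t ≠ 1}.ncard = (extra G i o y).ncard + 1 := by
  have : {t | t ∈ twoStab G i o ∧ t * t = 1 ∧ t ≠ 1} = insert y (extra G i o y) := by
    ext t
    by_cases hty : t = y
    · simp [hty, h.y_mem, h.y_mul, h.y_ne]
    · simp [hty, extra]
  rw [this, Set.ncard_insert_of_notMem]
  exact fun hy => hy.2.2.2 rfl

theorem ncard_fix (h : Frame P i o y σ z χ) {t : G} (ht : t * t = 1) (ht1 : t ≠ 1) {x : Ω}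
    (hx : t • x = x) : {x : Ω | t • x = x}.ncard = 48 := by
  obtain ⟨a, hax, ha⟩ := h.exists_fixed_ne ht hx
  obtain ⟨g, rfl, rfl⟩ := h.two_transitive h.ne hax.symm
  have hv : g⁻¹ * t * g ∈ twoStab G i o := by
    refine mem_twoStab.2 ⟨?_, ?_⟩
    · rw [mul_smul, mul_smul, hx, inv_smul_smul]
    · rw [mul_smul, mul_smul, ha, inv_smul_smul]
  have h1 := h.ncard_fixed h.ne hv
  rw [h.card_inv _ hv] at h1
  · have h2 : {x : Ω | t • x = x} = (fun x => g • x) '' {x : Ω | (g⁻¹ * t * g) • x = x} := by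
      ext x
      constructor
      · intro hx
        refine ⟨g⁻¹ • x, ?_, smul_inv_smul g x⟩
        have hx : t • x = x := hx
        change (g⁻¹ * t * g) • g⁻¹ • x = g⁻¹ • x
        rw [mul_smul, mul_smul, smul_inv_smul, hx]
      · rintro ⟨u, hu, rfl⟩
        have hu : (g⁻¹ * t * g) • u = u := hu
        rw [mul_smul, mul_smul, inv_smul_eq_iff] at hu
        exact hu
    rw [h2, Set.ncard_image_of_injective _ (MulAction.injective g), h1]
  · calc g⁻¹ * t * g * (g⁻¹ * t * g) = g⁻¹ * (t * t) * g := by group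
      _ = 1 := by rw [ht]; group
  · intro e
    apply ht1
    calc t = g * (g⁻¹ * t * g) * g⁻¹ := by group
      _ = 1 := by rw [e]; group

theorem extra_eq_empty (h : Frame P i o y σ z χ) : extra G i o y = ∅ := by
  classical
  have hfin := h.finite
  have hft := Fintype.ofFinite Ω
  let T : Set G := {t | t * t = 1 ∧ t ≠ 1 ∧ ∃ x : Ω, t • x = x}
  let D : Set (Ω × Ω) := {p | p.1 ≠ p.2}
  have hconj : ∀ (g : G), ∀ t ∈ T, g * t * g⁻¹ ∈ T := by
    rintro g t ⟨h1, h2, x, hx⟩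
    refine ⟨?_, fun e => h2 (conj_eq_one_iff.1 e), g • x, ?_⟩
    · calc g * t * g⁻¹ * (g * t * g⁻¹) = g * (t * t) * g⁻¹ := by group
        _ = 1 := by rw [h1]; group
    · rw [mul_smul, mul_smul, inv_smul_smul, hx]
  have hcount : ∀ (r : G → Ω × Ω → Prop),
      (∀ g t a b, r t (a, b) → r (g * t * g⁻¹) (g • a, g • b)) → ∀ p ∈ D,
      {t | t ∈ T ∧ r t p}.ncard = {t | t ∈ T ∧ r t (i, o)}.ncard := by
    intro r hr
    have hle : ∀ a b c d : Ω, a ≠ b → c ≠ d →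
        {t | t ∈ T ∧ r t (a, b)}.ncard ≤ {t | t ∈ T ∧ r t (c, d)}.ncard := by
      intro a b c d hab hcd
      obtain ⟨g, rfl, rfl⟩ := h.two_transitive hab hcd
      refine Set.ncard_le_ncard_of_injOn (fun t => g * t * g⁻¹) (fun t ht =>
        ⟨hconj g t ht.1, hr g t a b ht.2⟩) (fun t _ t' _ e => ?_)
      exact mul_left_cancel (mul_right_cancel e)
    rintro ⟨a, b⟩ hp
    exact le_antisymm (hle _ _ _ _ hp h.ne) (hle _ _ _ _ h.ne hp)
  have hr1 := ncard_mul_eq_ncard_mul (S := T) (T := D)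
    (fun t p => t • p.1 = p.1 ∧ t • p.2 = p.2) (m := 2256)
    (n := (extra G i o y).ncard + 1) (by
      rintro t ⟨ht, ht1, x, hx⟩
      have h1 := h.ncard_fix ht ht1 hx
      have h2 : {p | p ∈ D ∧ t • p.1 = p.1 ∧ t • p.2 = p.2} =
          (({x : Ω | t • x = x}.toFinset.offDiag : Finset (Ω × Ω)) : Set (Ω × Ω)) := by
        ext ⟨a, b⟩
        simp [D]
        tauto
      rw [Set.ncard_eq_toFinset_card'] at h1
      rw [h2, Set.ncard_coe_finset, Finset.offDiag_card, h1])
    (by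
      intro p hp
      refine (hcount (fun t p => t • p.1 = p.1 ∧ t • p.2 = p.2) (by
        rintro g t a b ⟨h1, h2⟩
        simp only [mul_smul, inv_smul_smul] at h1 h2 ⊢
        rw [h1, h2]
        exact ⟨rfl, rfl⟩) p hp).trans ?_
      rw [← h.involutions_ncard]
      congr 1
      ext t
      exact ⟨fun ht => ⟨ht.2, ht.1.1, ht.1.2.1⟩, fun ht => ⟨⟨ht.2.1, ht.2.2, i, ht.1.1⟩, ht.1⟩⟩)
  have hr2 := ncard_mul_eq_ncard_mul (S := T) (T := D)
    (fun t p => t • p.1 = p.2) (m := 103776)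
    (n := {t | t ∈ T ∧ t • i = o}.ncard) (by
      rintro t ⟨ht, ht1, x, hx⟩
      have h1 := h.ncard_fix ht ht1 hx
      have h2 : {p | p ∈ D ∧ t • p.1 = p.2} =
          (fun x => (x, t • x)) '' {x : Ω | t • x = x}ᶜ := by
        ext ⟨a, b⟩
        simp only [D, Set.mem_ofPred_eq, Set.mem_image, Set.mem_compl_iff, Prod.mk.injEq]
        constructor
        · rintro ⟨h3, rfl⟩
          exact ⟨a, fun e => h3 e.symm, rfl, rfl⟩
        · rintro ⟨x, h3, rfl, rfl⟩
          exact ⟨fun e => h3 e.symm, rfl⟩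
      have h3 := Set.ncard_add_ncard_compl {x : Ω | t • x = x}
      rw [h.card_Ω, h1] at h3
      rw [h2, Set.ncard_image_of_injective]
      · omega
      · exact fun a b e => (Prod.ext_iff.1 e).1)
    (fun p hp => hcount (fun t p => t • p.1 = p.2) (by
        rintro g t a b h1
        have h1 : t • a = b := h1
        change (g * t * g⁻¹) • g • a = g • b
        rw [mul_smul, mul_smul, inv_smul_smul, h1]) p hp)
  have hle : {t | t ∈ T ∧ t • i = o}.ncard ≤ 736 := by
    obtain ⟨τ, h1, h2⟩ := h.exists_swap h.ne
    rw [← h.card_K, ← SetLike.coe_sort_coe, Nat.card_coe_set_eq]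
    refine Set.ncard_le_ncard_of_injOn (fun t => τ⁻¹ * t) (fun t ht => ?_)
      (fun t _ t' _ e => mul_left_cancel e)
    have h3 : t • i = o := ht.2
    have h4 : t • o = i := by rw [← h3, ← mul_smul, ht.1.1, one_smul]
    refine mem_twoStab.2 ⟨?_, ?_⟩
    · rw [mul_smul, h3, inv_smul_eq_iff, h1]
    · rw [mul_smul, h4, inv_smul_eq_iff, h2]
  have hDpos : 0 < D.ncard := (Set.ncard_pos (Set.toFinite D)).2 ⟨(i, o), h.ne⟩
  have hrel : {t | t ∈ T ∧ t • i = o}.ncard * 2256 = 103776 * ((extra G i o y).ncard + 1) := by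
    refine Nat.eq_of_mul_eq_mul_left hDpos ?_
    calc D.ncard * ({t | t ∈ T ∧ t • i = o}.ncard * 2256)
        = D.ncard * {t | t ∈ T ∧ t • i = o}.ncard * 2256 := by ring
      _ = 103776 * (T.ncard * 2256) := by rw [← hr2]; ring
      _ = _ := by rw [hr1]; ring
  have h16 := h.sixteen_dvd
  rw [← Set.ncard_eq_zero (Set.toFinite _)]
  omega

theorem eq_y (h : Frame P i o y σ z χ) {n : G} (hn : n ∈ twoStab G i o) (hn2 : n * n = 1)
    (hn1 : n ≠ 1) : n = y := by
  by_contra hny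
  have : n ∈ extra G i o y := ⟨hn, hn2, hn1, hny⟩
  rw [h.extra_eq_empty] at this
  exact this

theorem eq_one_of_fix (h : Frame P i o y σ z χ) {k : G} (hk : k ∈ twoStab G i o) {x : Ω}
    (hx : y • x ≠ x) (hkx : k • x = x) : k = 1 := by
  by_contra hk1
  have h1 := h.involution_of_fix hk hk1 hx hkx
  exact h1.2 (h.eq_y hk h1.1 hk1 ▸ h.chi_y)

end Frame

theorem pow_23_eq {a : ZMod 47} (ha : a ≠ 0) : a ^ 23 = 1 ∨ a ^ 23 = -1 := by
  refine mul_self_eq_one_iff.1 ?_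
  rw [← pow_add]
  exact ZMod.pow_card_sub_one_eq_one ha

/-- The involution fixing `x` and `y • x`. -/
noncomputable def tau {G Ω : Type*} [Group G] [MulAction G Ω] (y : G) (x : Ω) : G :=
  Classical.epsilon fun t : G => t * t = 1 ∧ t ≠ 1 ∧ t • x = x ∧ t • y • x = y • x

namespace Frame

open Setting

variable {G Ω : Type*} [Group G] [Finite G] [MulAction G Ω] {P : Ω → Subgroup G} {i o : Ω}
  {y σ : G} {z : ZMod 47 → G} {χ : G → ZMod 47}

theorem unique_involution (h : Frame P i o y σ z χ) {a b : Ω} (hab : a ≠ b) {u v : G}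
    (hu : u * u = 1) (hu1 : u ≠ 1) (hua : u • a = a) (hub : u • b = b)
    (hv : v * v = 1) (hv1 : v ≠ 1) (hva : v • a = a) (hvb : v • b = b) : u = v := by
  obtain ⟨g, rfl, rfl⟩ := h.two_transitive h.ne hab
  have key : ∀ u : G, u * u = 1 → u ≠ 1 → u • g • i = g • i → u • g • o = g • o →
      g⁻¹ * u * g = y := by
    intro u hu hu1 hua hub
    refine h.eq_y (mem_twoStab.2 ⟨?_, ?_⟩) ?_ ?_
    · rw [mul_smul, mul_smul, hua, inv_smul_smul]
    · rw [mul_smul, mul_smul, hub, inv_smul_smul]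
    · calc g⁻¹ * u * g * (g⁻¹ * u * g) = g⁻¹ * (u * u) * g := by group
        _ = 1 := by rw [hu]; group
    · intro e
      apply hu1
      calc u = g * (g⁻¹ * u * g) * g⁻¹ := by group
        _ = 1 := by rw [e]; group
  have e := (key u hu hu1 hua hub).trans (key v hv hv1 hva hvb).symm
  exact mul_left_cancel (mul_right_cancel e)

theorem tau_spec (h : Frame P i o y σ z χ) {x : Ω} (hx : y • x ≠ x) :
    tau y x * tau y x = 1 ∧ tau y x ≠ 1 ∧ tau y x • x = x ∧ tau y x • y • x = y • x := by
  refine Classical.epsilon_spec (p := fun t : G => t * t = 1 ∧ t ≠ 1 ∧ t • x = x ∧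
    t • y • x = y • x) ?_
  obtain ⟨g, h1, h2⟩ := h.two_transitive h.ne hx.symm
  refine ⟨g * y * g⁻¹, ?_, fun e => h.y_ne (conj_eq_one_iff.1 e), ?_, ?_⟩
  · calc g * y * g⁻¹ * (g * y * g⁻¹) = g * (y * y) * g⁻¹ := by group
      _ = 1 := by rw [h.y_mul]; group
  · rw [mul_smul, mul_smul, inv_smul_eq_iff.2 h1.symm, h.y_mem.1, h1]
  · rw [mul_smul, mul_smul, inv_smul_eq_iff.2 h2.symm, h.y_mem.2, h2]

theorem eq_tau (h : Frame P i o y σ z χ) {x : Ω} (hx : y • x ≠ x) {t : G} (ht : t * t = 1)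
    (ht1 : t ≠ 1) (htx : t • x = x) (hty : t • y • x = y • x) : t = tau y x := by
  obtain ⟨h1, h2, h3, h4⟩ := h.tau_spec hx
  exact h.unique_involution hx.symm ht ht1 htx hty h1 h2 h3 h4

theorem smul_ne_of_comm {g : G} (hg : g * y = y * g) {x : Ω} (hx : y • x ≠ x) :
    y • g • x ≠ g • x := by
  rw [← mul_smul, ← hg, mul_smul]
  exact fun e => hx (smul_left_cancel g e)

theorem tau_conj (h : Frame P i o y σ z χ) {g : G} (hg : g * y = y * g) {x : Ω}
    (hx : y • x ≠ x) : tau y (g • x) = g * tau y x * g⁻¹ := by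
  obtain ⟨h1, h2, h3, h4⟩ := h.tau_spec hx
  refine (h.eq_tau (smul_ne_of_comm hg hx) ?_ (fun e => h2 (conj_eq_one_iff.1 e)) ?_ ?_).symm
  · calc g * tau y x * g⁻¹ * (g * tau y x * g⁻¹) = g * (tau y x * tau y x) * g⁻¹ := by group
      _ = 1 := by rw [h1]; group
  · rw [mul_smul, mul_smul, inv_smul_smul, h3]
  · rw [← mul_smul y, ← hg, mul_smul g y, mul_smul, mul_smul, inv_smul_smul, h4]

theorem tau_smul_y (h : Frame P i o y σ z χ) {x : Ω} (hx : y • x ≠ x) :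
    tau y (y • x) = tau y x := by
  obtain ⟨h1, h2, h3, h4⟩ := h.tau_spec hx
  refine (h.eq_tau (smul_ne_of_comm rfl hx) h1 h2 h4 ?_).symm
  rw [← mul_smul y y, h.y_mul, one_smul, h3]

theorem tau_comm (h : Frame P i o y σ z χ) {x : Ω} (hx : y • x ≠ x) :
    tau y x * y = y * tau y x := by
  have h1 := h.tau_conj (g := y) rfl hx
  rw [h.tau_smul_y hx] at h1
  exact (mul_mul_inv_eq_iff.1 h1.symm).symm

theorem eq_tau_of_comm (h : Frame P i o y σ z χ) {x : Ω} (hx : y • x ≠ x) {t : G}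
    (ht : t * t = 1) (ht1 : t ≠ 1) (htx : t • x = x) (hty : t * y = y * t) : t = tau y x :=
  h.eq_tau hx ht ht1 htx (by rw [← mul_smul, hty, mul_smul, htx])

theorem tau_smul_ne (h : Frame P i o y σ z χ) {x d : Ω} (hx : y • x ≠ x) (hd : y • d = d) :
    tau y x • d ≠ d := by
  intro e
  have hfin := h.finite
  obtain ⟨h1, h2, h3, h4⟩ := h.tau_spec hx
  have hc := h.tau_comm hx
  generalize tau y x = t at *
  have hp : IsPGroup 2 (zpowers t) := IsPGroup.of_card_dvd_pow (n := 1) (by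
    rw [Nat.card_zpowers, pow_one]
    exact orderOf_dvd_of_pow_eq_one (by rw [pow_two, h1]))
  have hzd : ∀ k : zpowers t, (k : G) • d = d := fun k =>
    (zpowers_le.2 (show t ∈ stabilizer G d from e)) k.2
  have hzy : ∀ k : zpowers t, (k : G) * y = y * k := fun k =>
    mem_centralizer_singleton_iff.1
      ((zpowers_le.2 (mem_centralizer_singleton_iff.2 hc : t ∈ centralizer ({y} : Set G))) k.2)
  set Y : Set Ω := {a | y • a = a} \ {d} with hY
  have hmod := ncard_modEq_ncard_fixed hp ((MulAction.toPermHom G Ω).comp (zpowers t).subtype)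
    (Y := Y) (by
      rintro k a ⟨ha, had⟩
      change y • a = a at ha
      refine ⟨?_, fun e => had (smul_left_cancel (k : G) ?_)⟩
      · change y • (k : G) • a = (k : G) • a
        rw [← mul_smul, ← hzy, mul_smul, ha]
      · exact (show (k : G) • a = d from e).trans (hzd k).symm)
  have hYc : Y.ncard = 47 := by
    rw [hY, Set.ncard_sdiff_singleton_of_mem (show d ∈ {a : Ω | y • a = a} from hd), h.ncard_fix_y]
  obtain ⟨d', hd', hdd', hfix⟩ : ∃ d', y • d' = d' ∧ d' ≠ d ∧ t • d' = d' := by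
    by_contra! hno
    have he : {a | a ∈ Y ∧ ∀ k : zpowers t,
        ((MulAction.toPermHom G Ω).comp (zpowers t).subtype) k a = a} = ∅ := by
      ext a
      simp only [Set.mem_ofPred_eq, Set.mem_empty_iff_false, iff_false]
      exact fun hh => hno a hh.1.1 hh.1.2 (hh.2 ⟨t, mem_zpowers t⟩)
    rw [he, Set.ncard_empty, hYc] at hmod
    exact absurd hmod (by decide)
  have := h.unique_involution hdd'.symm h1 h2 e hfix h.y_mul h.y_ne hd hd'
  exact hx (this ▸ h3)

theorem exists_smul_i (h : Frame P i o y σ z χ) {t : G} (ht : t * y = y * t) (hti : t • i ≠ i) :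
    ∃ a, t • i = z a • o := by
  refine ((h.fix_y_iff (t • i)).1 ?_).resolve_left hti
  rw [← mul_smul, ← ht, mul_smul, h.y_mem.1]

theorem chi_s (h : Frame P i o y σ z χ) : IsPrimitiveRoot (χ σ) 23 := by
  have : orderOf (χ σ) = 23 := by
    refine orderOf_eq_prime ?_ ?_
    · rw [← h.chi_pow h.s_mem, ← h.s_order, pow_orderOf_eq_one, h.chi_one]
    · intro e
      exact h.noncomm i _ (h.z_mem 1) h.z_one_ne σ h.s_order ((h.chi_eq_one_iff h.s_mem).1 e 1)
  rw [← this]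
  exact IsPrimitiveRoot.orderOf _

theorem smul_z_smul (h : Frame P i o y σ z χ) {k : G} (hk : k ∈ twoStab G i o) (a : ZMod 47) :
    k • z a • o = z (χ k * a) • o := by
  rw [← conj_smul hk.2, h.conj_z k hk]

theorem z_smul_inj (h : Frame P i o y σ z χ) {a b : ZMod 47} (e : z a • o = z b • o) : a = b :=
  h.z_inj (h.eq_of_smul_eq h.ne (h.z_mem a) (h.z_mem b) e)

theorem z_smul_ne (h : Frame P i o y σ z χ) (a : ZMod 47) : z a • o ≠ i :=
  h.smul_ne h.ne (h.z_mem a)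

theorem z_smul_i (h : Frame P i o y σ z χ) (a : ZMod 47) : z a • i = i := h.fix i _ (h.z_mem a)

theorem z_zero_smul (h : Frame P i o y σ z χ) (x : Ω) : z 0 • x = x := by
  rw [h.z_zero, one_smul]

theorem z_smul_smul (h : Frame P i o y σ z χ) (a b : ZMod 47) (x : Ω) :
    z a • z b • x = z (a + b) • x := by
  rw [h.z_add, mul_smul]

theorem smul_smul_self {t : G} (ht : t * t = 1) (x : Ω) : t • t • x = x := by
  rw [← mul_smul, ht, one_smul]

/-- The action of a fixed-point-free swap of `i` and `o` on the fixed points of `y`. -/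
theorem swap_law (h : Frame P i o y σ z χ) {t : G} (hti : t • i = o) (ht : t * t = 1)
    (hty : t * y = y * t) (hfix : ∀ a, t • z a • o ≠ z a • o) :
    ∃ c : ZMod 47, c ^ 23 = -1 ∧ ∀ s, s ≠ 0 → t • z s • o = z (c / s) • o := by
  have hto : t • o = i := by rw [← hti, smul_smul_self ht]
  have hex : ∀ s : ZMod 47, ∃ r, s ≠ 0 → t • z s • o = z r • o := by
    intro s
    by_cases hs : s = 0
    · exact ⟨0, fun hh => absurd hs hh⟩
    · have h1 : y • t • z s • o = t • z s • o := by
        rw [← mul_smul, ← hty, mul_smul, h.y_smul_z]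
      rcases (h.fix_y_iff _).1 h1 with h2 | ⟨r, hr⟩
      · exfalso
        have h3 := congrArg (t • ·) h2
        simp only [smul_smul_self ht, hti] at h3
        exact hs (h.z_smul_inj (h3.trans (h.z_zero_smul o).symm))
      · exact ⟨r, fun _ => hr⟩
  choose f hf using hex
  have hf0 : ∀ s, s ≠ 0 → f s ≠ 0 := by
    intro s hs e
    have h1 := hf s hs
    rw [e, h.z_zero_smul] at h1
    have h2 := congrArg (t • ·) h1
    simp only [smul_smul_self ht, hto] at h2
    exact h.z_smul_ne s h2
  have hff : ∀ s, s ≠ 0 → f (f s) = s := by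
    intro s hs
    have h1 := congrArg (t • ·) (hf s hs)
    simp only [smul_smul_self ht] at h1
    rw [hf _ (hf0 s hs)] at h1
    exact (h.z_smul_inj h1).symm
  have htinv : t⁻¹ = t := inv_eq_of_mul_eq_one_left ht
  set q := χ σ with hq
  have hq0 : q ≠ 0 := h.chi_ne_zero h.s_mem
  have hfq : ∀ s, s ≠ 0 → f (q * s) = q⁻¹ * f s := by
    intro s hs
    have h1 := h.conj_s hti hto
    have h2 : t * σ = σ⁻¹ * t := by
      rw [← h1]; group
    refine h.z_smul_inj (o := o) ?_
    rw [← hf _ (mul_ne_zero hq0 hs), hq, ← h.smul_z_smul h.s_mem, ← mul_smul, h2, mul_smul,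
      hf s hs, h.smul_z_smul (inv_mem h.s_mem), h.chi_inv h.s_mem]
  have hpow : ∀ n : ℕ, f (q ^ n) * q ^ n = f 1 := by
    intro n
    induction n with
    | zero => simp
    | succ n ih =>
      rw [pow_succ', hfq _ (pow_ne_zero n hq0), ← ih]
      field_simp
  have hsq : ∀ s : ZMod 47, s ^ 23 = 1 → f s * s = f 1 := by
    intro s hs
    obtain ⟨n, -, rfl⟩ := h.chi_s.eq_pow_of_pow_eq_one hs
    exact hpow n
  set c := f 1 with hc
  have hc0 : c ≠ 0 := hf0 1 one_ne_zero
  have hc23 : c ^ 23 = -1 := by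
    refine (pow_23_eq hc0).resolve_left fun e => ?_
    have h1 : (c ^ 12) ^ 23 = 1 := by rw [← pow_mul, mul_comm, pow_mul, e, one_pow]
    have h2 := hsq _ h1
    have h3 : c ^ 12 ≠ 0 := pow_ne_zero _ hc0
    have h4 : c ^ 12 * c ^ 12 = c := by
      rw [← pow_add, show 12 + 12 = 23 + 1 from rfl, pow_succ, e, one_mul]
    have h5 : f (c ^ 12) = c ^ 12 := mul_right_cancel₀ h3 (h2.trans h4.symm)
    have h6 := hf _ h3
    rw [h5] at h6
    exact hfix _ h6
  refine ⟨c, hc23, fun s hs => ?_⟩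
  rw [hf s hs]
  suffices f s = c / s by rw [this]
  rcases pow_23_eq hs with h1 | h1
  · exact eq_div_of_mul_eq hs (hsq s h1)
  · have h2 : (c / s) ^ 23 = 1 := by
      rw [div_pow, hc23, h1, div_self (neg_ne_zero.2 one_ne_zero)]
    have h3 := hsq _ h2
    have h4 : f (c / s) = s := by
      have h5 : c / s ≠ 0 := div_ne_zero hc0 hs
      refine mul_right_cancel₀ h5 (h3.trans ?_)
      field_simp
    have h5 := hff _ (div_ne_zero hc0 hs)
    rw [h4] at h5
    exact h5

end Frame

/-- The involution `tau y x` maps `i` to `z α • o` and acts on the fixed points of `y` as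
`s + α ↦ c / s + α`. -/
def HasPsi {G Ω : Type*} [Group G] [MulAction G Ω] (i o : Ω) (y : G) (z : ZMod 47 → G) (x : Ω)
    (α c : ZMod 47) : Prop :=
  tau y x • i = z α • o ∧ c ^ 23 = -1 ∧ ∀ s, s ≠ 0 → tau y x • z (s + α) • o = z (α + c / s) • o

theorem ne_zero_of_pow_23 {c : ZMod 47} (hc : c ^ 23 = -1) : c ≠ 0 := by
  rintro rfl
  rw [zero_pow (by norm_num)] at hc
  exact absurd hc (by decide)

theorem mul_self_ne_of_pow_23 {c : ZMod 47} (hc : c ^ 23 = -1) (a : ZMod 47) : a * a ≠ c := by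
  rintro rfl
  have ha : a ≠ 0 := fun e => ne_zero_of_pow_23 hc (by rw [e, mul_zero])
  have := ZMod.pow_card_sub_one_eq_one ha
  rw [← pow_two, ← pow_mul] at hc
  rw [show 47 - 1 = 2 * 23 from rfl, hc] at this
  exact absurd this (by decide)

namespace Frame

open Setting

variable {G Ω : Type*} [Group G] [Finite G] [MulAction G Ω] {P : Ω → Subgroup G} {i o : Ω}
  {y σ : G} {z : ZMod 47 → G} {χ : G → ZMod 47}

theorem hasPsi_unique (h : Frame P i o y σ z χ) {x : Ω} {α c α' c' : ZMod 47}
    (h1 : HasPsi i o y z x α c) (h2 : HasPsi i o y z x α' c') : α = α' ∧ c = c' := by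
  have e : α = α' := h.z_smul_inj (h1.1.symm.trans h2.1)
  subst e
  refine ⟨rfl, ?_⟩
  have h3 := h.z_smul_inj ((h1.2.2 1 one_ne_zero).symm.trans (h2.2.2 1 one_ne_zero))
  simpa using h3

theorem hasPsi_z (h : Frame P i o y σ z χ) {x : Ω} (hx : y • x ≠ x) {α c : ZMod 47}
    (h1 : HasPsi i o y z x α c) (a : ZMod 47) : HasPsi i o y z (z a • x) (a + α) c := by
  rw [HasPsi, h.tau_conj (h.z_mul_y a) hx, ← h.z_neg]
  refine ⟨?_, h1.2.1, fun s hs => ?_⟩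
  · rw [mul_smul, mul_smul, h.z_smul_i, h1.1, h.z_smul_smul]
  · rw [mul_smul, mul_smul, h.z_smul_smul, show -a + (s + (a + α)) = s + α by ring,
      h1.2.2 s hs, h.z_smul_smul, add_assoc]

theorem hasPsi_y (h : Frame P i o y σ z χ) {x : Ω} (hx : y • x ≠ x) {α c : ZMod 47}
    (h1 : HasPsi i o y z x α c) : HasPsi i o y z (y • x) α c := by
  rw [HasPsi, h.tau_smul_y hx]
  exact h1

theorem hasPsi_smul (h : Frame P i o y σ z χ) {x : Ω} (hx : y • x ≠ x) {α c : ZMod 47}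
    (h1 : HasPsi i o y z x α c) {k : G} (hk : k ∈ twoStab G i o) :
    HasPsi i o y z (k • x) (χ k * α) (χ k ^ 2 * c) := by
  have hc := h.chi_ne_zero hk
  have hc46 := ZMod.pow_card_sub_one_eq_one hc
  rw [HasPsi, h.tau_conj (h.y_comm k hk) hx]
  refine ⟨?_, ?_, fun s hs => ?_⟩
  · rw [mul_smul, mul_smul, (inv_mem hk).1, h1.1, h.smul_z_smul hk]
  · rw [mul_pow, ← pow_mul, show 2 * 23 = 47 - 1 from rfl, hc46, one_mul, h1.2.1]
  · rw [mul_smul, mul_smul, h.smul_z_smul (inv_mem hk), h.chi_inv hk,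
      show (χ k)⁻¹ * (s + χ k * α) = s / χ k + α by field_simp,
      h1.2.2 _ (div_ne_zero hs hc), h.smul_z_smul hk]
    congr 2
    field_simp

theorem exists_hasPsi (h : Frame P i o y σ z χ) {x : Ω} (hx : y • x ≠ x) :
    ∃ α c, HasPsi i o y z x α c := by
  obtain ⟨h1, h2, h3, h4⟩ := h.tau_spec hx
  obtain ⟨α, hα⟩ := h.exists_smul_i (h.tau_comm hx) (h.tau_smul_ne hx h.y_mem.1)
  have hx' : y • z (-α) • x ≠ z (-α) • x := smul_ne_of_comm (h.z_mul_y _) hx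
  obtain ⟨h1', -⟩ := h.tau_spec hx'
  have hti : tau y (z (-α) • x) • i = o := by
    rw [h.tau_conj (h.z_mul_y _) hx, ← h.z_neg, mul_smul, mul_smul, h.z_smul_i, hα,
      h.z_smul_smul, neg_add_cancel, h.z_zero_smul]
  obtain ⟨c, hc, hs⟩ := h.swap_law hti h1' (h.tau_comm hx')
    (fun a => h.tau_smul_ne hx' (h.y_smul_z a))
  have h5 : HasPsi i o y z (z (-α) • x) 0 c := by
    refine ⟨by rw [hti, h.z_zero_smul], hc, fun s hs' => ?_⟩
    rw [add_zero, zero_add, hs s hs']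
  have h6 := h.hasPsi_z hx' h5 α
  rw [h.z_smul_smul, add_neg_cancel, h.z_zero_smul, add_zero] at h6
  exact ⟨α, c, h6⟩

theorem HasPsi.swap (h : Frame P i o y σ z χ) {u : Ω} (hu : y • u ≠ u) {c : ZMod 47}
    (h1 : HasPsi i o y z u 0 c) : tau y u • i = o ∧ tau y u • o = i := by
  have h2 : tau y u • i = o := h1.1.trans (h.z_zero_smul o)
  refine ⟨h2, ?_⟩
  rw [← h2, smul_smul_self (h.tau_spec hu).1]

theorem hasPsi_swap_aux (h : Frame P i o y σ z χ) {u x : Ω} (hu : y • u ≠ u) (hx : y • x ≠ x)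
    {c' α c α' : ZMod 47} {c'' : ZMod 47} (h1 : HasPsi i o y z u 0 c')
    (h2 : HasPsi i o y z x α c) (h3 : HasPsi i o y z (tau y u • x) α' c'') :
    (α = 0 → α' = 0) ∧ α' * (α ^ 2 - c) = c' * α := by
  obtain ⟨hti, hto⟩ := HasPsi.swap h hu h1
  have hcomm := h.tau_comm hu
  have htt := (h.tau_spec hu).1
  have h4 := h3.1
  rw [h.tau_conj hcomm hx, inv_eq_of_mul_eq_one_left htt, mul_smul, mul_smul, hti] at h4
  have h5 := h2.2.2 (-α)
  rw [neg_add_cancel, h.z_zero_smul] at h5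
  by_cases hα : α = 0
  · subst hα
    rw [(HasPsi.swap h hx h2).2, hti] at h4
    have : α' = 0 := (h.z_smul_inj ((h.z_zero_smul o).trans h4)).symm
    refine ⟨fun _ => this, by rw [this]; ring⟩
  · refine ⟨fun e => absurd e hα, ?_⟩
    rw [h5 (neg_ne_zero.2 hα)] at h4
    have hne : α + c / -α ≠ 0 := by
      intro e
      refine mul_self_ne_of_pow_23 h2.2.1 α ?_
      field_simp at e
      linear_combination e
    have h6 := h1.2.2 _ hne
    rw [add_zero, zero_add] at h6
    have h7 := h.z_smul_inj (h4.symm.trans h6)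
    rw [h7]
    have : α + c / -α = (α ^ 2 - c) / α := by field_simp; ring
    have h8 : α ^ 2 - c ≠ 0 := by
      intro e
      exact hne (by rw [this, e, zero_div])
    rw [this]
    field_simp

theorem hasPsi_swap (h : Frame P i o y σ z χ) {u x : Ω} (hu : y • u ≠ u) (hx : y • x ≠ x)
    {c' α c α' c'' : ZMod 47} (h1 : HasPsi i o y z u 0 c')
    (h2 : HasPsi i o y z x α c) (h3 : HasPsi i o y z (tau y u • x) α' c'') :
    α' ^ 2 * c = α ^ 2 * c'' := by
  have htt := (h.tau_spec hu).1
  have h4 := h.hasPsi_swap_aux hu hx h1 h2 h3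
  have h5 := h.hasPsi_swap_aux hu (smul_ne_of_comm (h.tau_comm hu) hx) h1 h3
    (by rw [smul_smul_self htt]; exact h2)
  linear_combination (-α') * h4.2 + α * h5.2

theorem y_smul_b (h : Frame P i o y σ z χ) {b : G} (hb : b ∈ inverted P i y) :
    y • b • o = b⁻¹ • o := by
  rw [← hb.2, mul_smul, mul_smul, h.y_inv, h.y_mem.2]

theorem b_moved (h : Frame P i o y σ z χ) {b : G} (hb : b ∈ inverted P i y) (hb1 : b ≠ 1) :
    y • b • o ≠ b • o := by
  have := h.y_smul_eq_iff hb 0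
  rw [h.z_zero, mul_one] at this
  exact fun e => hb1 (this.1 e)

/-- If `t = tau y u` swaps `i` and `o`, where `u = p • o`, then `t p⁻¹ o` lies in `B • o`. -/
theorem exists_tau_smul (h : Frame P i o y σ z χ) {p : G} (hp : p ∈ P i)
    (hu : y • p • o ≠ p • o) (hti : tau y (p • o) • i = o) :
    ∃ b ∈ inverted P i y, b ≠ 1 ∧ tau y (p • o) • p⁻¹ • o = b • o := by
  obtain ⟨htt, -, htu, -⟩ := h.tau_spec hu
  have hcomm := h.tau_comm hu
  generalize htd : tau y (p • o) = t at *
  have hto : t • o = i := by rw [← hti, smul_smul_self htt]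
  have hpi : p • i = i := h.fix i p hp
  have hpi' : p⁻¹ • i = i := h.fix i _ (inv_mem hp)
  have hq : y • p⁻¹ • o ≠ p⁻¹ • o := by
    intro e
    rcases (h.fix_y_iff _).1 e with e1 | ⟨a, e1⟩
    · exact h.smul_ne h.ne (inv_mem hp) e1
    · have := h.eq_of_smul_eq h.ne (inv_mem hp) (h.z_mem a) e1
      rw [inv_eq_iff_eq_inv, ← h.z_neg] at this
      rw [this] at hu
      exact hu (h.y_smul_z _)
  have hw : y • t • p⁻¹ • o ≠ t • p⁻¹ • o := smul_ne_of_comm hcomm hq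
  have hwi : t • p⁻¹ • o ≠ i := fun e => hw (by rw [e, h.y_mem.1])
  obtain ⟨b, hb, s, hbs⟩ := h.exists_smul_eq_of_ne hwi
  have hb1 : b ≠ 1 := by
    intro e
    rw [hbs] at hw
    exact hw ((h.y_smul_eq_iff hb s).2 e)
  have hbi : (b * z s)⁻¹ • i = i := h.fix i _ (inv_mem (mul_mem hb.1 (h.z_mem s)))
  set k := (b * z s)⁻¹ * t * p⁻¹ * t * p * t with hk
  have hkK : k ∈ twoStab G i o := by
    refine mem_twoStab.2 ⟨?_, ?_⟩
    · rw [hk]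
      simp only [mul_smul, hti, htu, inv_smul_smul, hto]
      exact hbi
    · have : (b * z s)⁻¹ • t • p⁻¹ • o = o := by rw [hbs, inv_smul_smul]
      rw [hk]
      simp only [mul_smul, hto, hpi, hti, this]
  have hkw : k • (b * z s) • o = (b * z s)⁻¹ • o := by
    rw [← hbs, hk]
    simp only [mul_smul, smul_smul_self htt, smul_inv_smul, hto, hpi', hti]
  have hinv : (b * z s)⁻¹ = b⁻¹ * z (-s) := by
    rw [mul_inv_rev, ← h.z_neg, h.z_central (inv_mem hb.1)]
  rw [h.smul_mul_z hkK, hinv] at hkw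
  obtain ⟨e1, e2⟩ := h.mul_z_smul_inj (h.conj_mem_B hkK hb) (inv_mem_B hb) hkw
  have hyk : y * k = 1 := by
    refine h.eq_one_of_fix (mul_mem h.y_mem hkK) (h.b_moved hb hb1) ?_
    rw [← conj_smul (mul_mem h.y_mem hkK).2]
    congr 1
    calc y * k * b * (y * k)⁻¹ = y * (k * b * k⁻¹) * y⁻¹ := by group
      _ = b := by rw [e1, (inv_mem_B hb).2, inv_inv]
  have hky : k = y := by
    rw [← h.y_inv]; exact (inv_eq_of_mul_eq_one_right hyk).symm
  rw [hky, h.chi_y, one_mul] at e2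
  have hs : s = 0 := by
    have h2 : (2 : ZMod 47) * s = 0 := by linear_combination e2
    exact (mul_eq_zero.1 h2).resolve_left (by decide)
  refine ⟨b, hb, hb1, ?_⟩
  rw [hbs, hs, h.z_zero, mul_one]

theorem exists_hasPsi_four (h : Frame P i o y σ z χ) {b : G} (hb : b ∈ inverted P i y)
    (hb1 : b ≠ 1) {α c : ZMod 47} (hbc : HasPsi i o y z (b • o) α c) :
    ∃ b' ∈ inverted P i y, b' ≠ 1 ∧ ∃ α' c', HasPsi i o y z (b' • o) α' c' ∧
      α' ^ 2 * c = 4 * α ^ 2 * c' := by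
  have hbm := h.b_moved hb hb1
  have h1 := h.hasPsi_z hbm hbc (-α)
  rw [neg_add_cancel, ← mul_smul] at h1
  have hp : z (-α) * b ∈ P i := mul_mem (h.z_mem _) hb.1
  have hu : y • (z (-α) * b) • o ≠ (z (-α) * b) • o := by
    rw [mul_smul]
    exact smul_ne_of_comm (h.z_mul_y _) hbm
  obtain ⟨b', hb', hb'1, e⟩ := h.exists_tau_smul hp hu (HasPsi.swap h hu h1).1
  have hq : (z (-α) * b)⁻¹ • o = z α • y • b • o := by
    rw [h.y_smul_b hb, mul_inv_rev, ← h.z_neg, neg_neg, h.z_central (inv_mem hb.1), mul_smul]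
  have hym : y • y • b • o ≠ y • b • o := smul_ne_of_comm rfl hbm
  have h2 := h.hasPsi_z hym (h.hasPsi_y hbm hbc) α
  have h2m : y • z α • y • b • o ≠ z α • y • b • o := smul_ne_of_comm (h.z_mul_y _) hym
  obtain ⟨α', c', h3⟩ := h.exists_hasPsi (h.b_moved hb' hb'1)
  have h3' := h3
  rw [← e, hq] at h3'
  have h4 := h.hasPsi_swap hu h2m h1 h2 h3'
  exact ⟨b', hb', hb'1, α', c', h3, by rw [h4]; ring⟩

theorem hasPsi_zero (h : Frame P i o y σ z χ) {b : G} (hb : b ∈ inverted P i y)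
    (hb1 : b ≠ 1) {α c : ZMod 47} (hbc : HasPsi i o y z (b • o) α c) : α = 0 := by
  by_contra hα
  have hc := ne_zero_of_pow_23 hbc.2.1
  set ρ := α ^ 2 / c with hρ
  have hρ0 : ρ ≠ 0 := div_ne_zero (pow_ne_zero 2 hα) hc
  have key : ∀ n : ℕ, ∃ b', b' ∈ inverted P i y ∧ b' ≠ 1 ∧ ∃ α' c', HasPsi i o y z (b' • o) α' c' ∧
      α' ^ 2 = 4 ^ n * ρ * c' := by
    intro n
    induction n with
    | zero => exact ⟨b, hb, hb1, α, c, hbc, by rw [hρ]; field_simp⟩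
    | succ n ih =>
      obtain ⟨b', hb', hb'1, α', c', h1, h2⟩ := ih
      obtain ⟨b'', hb'', hb''1, α'', c'', h3, h4⟩ := h.exists_hasPsi_four hb' hb'1 h1
      refine ⟨b'', hb'', hb''1, α'', c'', h3, ?_⟩
      have hc' := ne_zero_of_pow_23 h1.2.1
      refine mul_right_cancel₀ hc' ?_
      rw [h4, h2]; ring
  choose f hfB hf1 a c hfp hac using key
  let g : Fin 4 × twoStab G i o → inverted P i y :=
    fun p => ⟨p.2 * f p.1 * (p.2 : G)⁻¹, h.conj_mem_B p.2.2 (hfB _)⟩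
  have hsm : ∀ k : twoStab G i o, ∀ n, (k * f n * (k : G)⁻¹) • o = (k : G) • f n • o :=
    fun k n => conj_smul k.2.2 _
  have hg : Function.Injective g := by
    rintro ⟨n, k⟩ ⟨m, l⟩ e
    have e1 : (k * f n * (k : G)⁻¹) = (l * f m * (l : G)⁻¹) := congrArg Subtype.val e
    have e2 := congrArg (fun x : G => x • o) e1
    simp only [hsm] at e2
    have h1 := h.hasPsi_smul (h.b_moved (hfB n) (hf1 n)) (hfp n) k.2
    have h2 := h.hasPsi_smul (h.b_moved (hfB m) (hf1 m)) (hfp m) l.2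
    rw [e2] at h1
    obtain ⟨e3, e4⟩ := h.hasPsi_unique h1 h2
    have hnm : n = m := by
      have h3 : (χ k * a n) ^ 2 = 4 ^ (n : ℕ) * ρ * (χ k ^ 2 * c n) := by
        rw [mul_pow, hac]; ring
      have h4 : (χ l * a m) ^ 2 = 4 ^ (m : ℕ) * ρ * (χ l ^ 2 * c m) := by
        rw [mul_pow, hac]; ring
      rw [e3, h4, e4] at h3
      have h5 := mul_right_cancel₀ hρ0 (mul_right_cancel₀ (ne_zero_of_pow_23 h2.2.1) h3)
      clear * - h5
      revert n m
      decide
    subst hnm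
    have h6 : (l : G)⁻¹ * k = 1 := by
      refine h.eq_one_of_fix (mul_mem (inv_mem l.2) k.2) (h.b_moved (hfB n) (hf1 n)) ?_
      rw [mul_smul, e2, inv_smul_smul]
    have h7 : (k : G) = l := (inv_mul_eq_one.1 h6).symm
    rw [Subtype.ext h7]
  have hle := Nat.card_le_card_of_injective g hg
  rw [Nat.card_prod, Nat.card_fin, h.card_K, Nat.card_coe_set_eq, h.card_B] at hle
  norm_num at hle

theorem tau_b (h : Frame P i o y σ z χ) {b : G} (hb : b ∈ inverted P i y)
    (hb1 : b ≠ 1) : ∃ c, HasPsi i o y z (b • o) 0 c := by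
  obtain ⟨α, c, hc⟩ := h.exists_hasPsi (h.b_moved hb hb1)
  rw [h.hasPsi_zero hb hb1 hc] at hc
  exact ⟨c, hc⟩

theorem tau_b_swap (h : Frame P i o y σ z χ) {b : G} (hb : b ∈ inverted P i y)
    (hb1 : b ≠ 1) : tau y (b • o) • i = o ∧ tau y (b • o) • o = i := by
  obtain ⟨c, hc⟩ := h.tau_b hb hb1
  exact HasPsi.swap h (h.b_moved hb hb1) hc

theorem exists_eq_b_smul (h : Frame P i o y σ z χ) {x : Ω} (hx : y • x ≠ x)
    (hxi : tau y x • i = o) : ∃ b ∈ inverted P i y, b ≠ 1 ∧ x = b • o := by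
  have hne : x ≠ i := fun e => hx (by rw [e, h.y_mem.1])
  obtain ⟨b, hb, a, hba⟩ := h.exists_smul_eq_of_ne hne
  have hb1 : b ≠ 1 := by
    intro e
    rw [hba] at hx
    exact hx ((h.y_smul_eq_iff hb a).2 e)
  obtain ⟨c, hc⟩ := h.tau_b hb hb1
  have h1 := h.hasPsi_z (h.b_moved hb hb1) hc a
  rw [← mul_smul, ← h.z_central hb.1, ← hba] at h1
  have h2 := h.z_smul_inj (h1.1.symm.trans (hxi.trans (h.z_zero_smul o).symm))
  rw [add_zero] at h2
  exact ⟨b, hb, hb1, by rw [hba, h2, h.z_zero, mul_one]⟩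

/-- The involution attached to `b • o` permutes the `b' • o` with `b' ∈ B`, `b' ≠ 1`. -/
theorem tau_smul_b (h : Frame P i o y σ z χ) {t : G} (hti : t • i = o) (hto : t • o = i)
    (hty : t * y = y * t) {b : G} (hb : b ∈ inverted P i y) (hb1 : b ≠ 1) :
    ∃ b' ∈ inverted P i y, b' ≠ 1 ∧ t • b • o = b' • o := by
  have hbm := h.b_moved hb hb1
  refine h.exists_eq_b_smul (smul_ne_of_comm hty hbm) ?_
  rw [h.tau_conj hty hbm, mul_smul, mul_smul, inv_smul_eq_iff.2 hto.symm,
    (h.tau_b_swap hb hb1).2, hti]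

theorem exists_mul_notMem (h : Frame P i o y σ z χ) :
    ∃ b ∈ inverted P i y, ∃ b' ∈ inverted P i y, b * b' ∉ inverted P i y := by
  by_contra! hB
  have hfin := h.finite
  obtain ⟨b, hb, hb1⟩ : ∃ b ∈ inverted P i y, b ≠ 1 := by
    refine Set.exists_ne_of_one_lt_ncard ?_ 1
    rw [h.card_B]; norm_num
  obtain ⟨hti, hto⟩ := h.tau_b_swap hb hb1
  have hty := h.tau_comm (h.b_moved hb hb1)
  generalize tau y (b • o) = t at *
  set F : Set Ω := insert i ((fun b : G => b • o) '' inverted P i y) with hF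
  have hiF : i ∈ F := Set.mem_insert _ _
  have hbF : ∀ b ∈ inverted P i y, b • o ∈ F := fun b hb => Set.mem_insert_of_mem _ ⟨b, hb, rfl⟩
  have hoF : o ∈ F := by simpa using hbF 1 one_mem_B
  have hFc : F.ncard = 2210 := by
    have hni : i ∉ (fun b : G => b • o) '' inverted P i y := by
      rintro ⟨b, hb, e⟩
      exact h.smul_ne h.ne hb.1 e
    have hinj : Set.InjOn (fun b : G => b • o) (inverted P i y) :=
      fun b hb b' hb' e => h.eq_of_smul_eq h.ne hb.1 hb'.1 e
    rw [hF, Set.ncard_insert_of_notMem hni, hinj.ncard_image, h.card_B]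
    norm_num
  let H : Subgroup G := closure (insert t (inverted P i y))
  have htH : t ∈ H := subset_closure (Set.mem_insert _ _)
  have hbH : ∀ b ∈ inverted P i y, b ∈ H := fun b hb => subset_closure (Set.mem_insert_of_mem _ hb)
  have hle : H ≤ stabilizer G F := by
    rw [closure_le]
    intro g hg
    rw [SetLike.mem_coe, mem_stabilizer_set_iff_smul_set_subset F.toFinite]
    rintro _ ⟨x, hx, rfl⟩
    change g • x ∈ F
    rcases hg with rfl | hg
    · rcases hx with rfl | ⟨b', hb', rfl⟩
      · rwa [hti]
      · change g • b' • o ∈ F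
        by_cases hb'1 : b' = 1
        · rwa [hb'1, one_smul, hto]
        · obtain ⟨b'', hb'', -, e⟩ := h.tau_smul_b hti hto hty hb' hb'1
          rw [e]
          exact hbF _ hb''
    · rcases hx with rfl | ⟨b', hb', rfl⟩
      · rwa [h.fix _ _ hg.1]
      · change g • b' • o ∈ F
        rw [← mul_smul]
        exact hbF _ (hB _ hg _ hb')
  have hdvd := ncard_dvd_card_of_transitive H (F := F) (a := i)
    (fun g hg => by
      have := hle hg
      rw [mem_stabilizer_set] at this
      exact (this i).2 hiF) (by
    rintro x (rfl | ⟨b', hb', rfl⟩)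
    · exact ⟨1, one_mem _, one_smul _ _⟩
    · exact ⟨b' * t, mul_mem (hbH _ hb') htH, by rw [mul_smul, hti]⟩)
  rw [hFc] at hdvd
  have h5 : 5 ∣ Nat.card G := ((by norm_num : 5 ∣ 2210).trans hdvd).trans (card_subgroup_dvd_card H)
  rw [h.card_G] at h5
  norm_num at h5

end Frame

theorem exists_klein {L : Type*} [Group L] {a b : L} (ha : a * a = 1) (hb : b * b = 1)
    (hab : a * b = b * a) (ha1 : a ≠ 1) (hb1 : b ≠ 1) (hne : a ≠ b) :
    ∃ V : Subgroup L, (∀ v, v ∈ V ↔ v = 1 ∨ v = a ∨ v = b ∨ v = a * b) ∧ Nat.card V = 4 ∧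
      ∀ v ∈ V, v * v = 1 := by
  have e3 : a * b * a = b := by rw [hab, mul_assoc, ha, mul_one]
  have e4 : a * b * b = a := by rw [mul_assoc, hb, mul_one]
  have hab' : a * b * (a * b) = 1 := by rw [← mul_assoc, e3, hb]
  have e1 : a * (a * b) = b := by rw [← mul_assoc, ha, one_mul]
  have e2 : b * (a * b) = a := by rw [hab, ← mul_assoc, hb, one_mul]
  have hsq : ∀ v, v = 1 ∨ v = a ∨ v = b ∨ v = a * b → v * v = 1 := by
    rintro v (hv | hv | hv | hv) <;> rw [hv]
    exacts [one_mul 1, ha, hb, hab']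
  let V : Subgroup L :=
    { carrier := {v | v = 1 ∨ v = a ∨ v = b ∨ v = a * b}
      one_mem' := Or.inl rfl
      mul_mem' := by
        rintro u v (hu | hu | hu | hu) (hv | hv | hv | hv) <;> rw [hu, hv] <;>
          simp only [Set.mem_ofPred_eq, one_mul, mul_one, ha, hb, hab', e1, e2, e3, e4, ← hab,
            true_or, or_true]
      inv_mem' := by
        intro v hv
        rwa [Set.mem_ofPred_eq, inv_eq_of_mul_eq_one_left (hsq v hv)] }
  refine ⟨V, fun v => Iff.rfl, ?_, hsq⟩
  have hV : (V : Set L) = {1, a, b, a * b} := by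
    ext v
    rfl
  have h3 : a ≠ a * b := fun e => hb1 (left_eq_mul.1 e)
  have h4 : b ≠ a * b := fun e => ha1 (right_eq_mul.1 e)
  have h5 : (1 : L) ≠ a * b := fun e => hne (by
    rw [← mul_right_inj b, hb, ← hab]; exact e.symm)
  change (V : Set L).ncard = 4
  rw [hV, Set.ncard_insert_of_notMem (by simp [ha1.symm, hb1.symm, h5]),
    Set.ncard_insert_of_notMem (by simp [hne, hb1]), Set.ncard_pair h4]

/-- `a ↦ -a⁻¹` on the projective line over `ZMod 47`. -/
def negInv : Option (ZMod 47) → Option (ZMod 47)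
  | none => some 0
  | some a => if a = 0 then none else some (-a ^ 45)

/-- `a ↦ 9 - 12 * (a - 9)⁻¹` on the projective line over `ZMod 47`. -/
def shiftInv : Option (ZMod 47) → Option (ZMod 47)
  | none => some 9
  | some a => if a = 9 then none else some (9 + 12 * -(a - 9) ^ 45)

theorem inv_eq_pow_45 {a : ZMod 47} (ha : a ≠ 0) : a ^ 45 = a⁻¹ := by
  refine eq_inv_of_mul_eq_one_left ?_
  rw [← pow_succ]
  exact ZMod.pow_card_sub_one_eq_one ha

set_option maxRecDepth 10000 in
theorem negInv_negInv : Function.Involutive negInv := by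
  unfold Function.Involutive
  decide

set_option maxRecDepth 10000 in
theorem shiftInv_shiftInv : Function.Involutive shiftInv := by
  unfold Function.Involutive
  decide

set_option maxRecDepth 10000 in
theorem negInv_shiftInv : ∀ x, negInv (shiftInv x) = shiftInv (negInv x) := by decide

namespace Frame

open Setting

variable {G Ω : Type*} [Group G] [Finite G] [MulAction G Ω] {P : Ω → Subgroup G} {i o : Ω}
  {y σ : G} {z : ZMod 47 → G} {χ : G → ZMod 47}

theorem exists_chi_eq (h : Frame P i o y σ z χ) {a : ZMod 47} (ha : a ^ 23 = 1) :
    ∃ k ∈ twoStab G i o, χ k = a := by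
  have : NeZero 23 := ⟨by norm_num⟩
  obtain ⟨n, -, rfl⟩ := h.chi_s.eq_pow_of_pow_eq_one ha
  exact ⟨σ ^ n, pow_mem h.s_mem n, h.chi_pow h.s_mem n⟩

theorem exists_hasPsi_neg_one (h : Frame P i o y σ z χ) :
    ∃ b ∈ inverted P i y, b ≠ 1 ∧ HasPsi i o y z (b • o) 0 (-1) := by
  obtain ⟨b, hb, hb1⟩ : ∃ b ∈ inverted P i y, b ≠ 1 := by
    refine Set.exists_ne_of_one_lt_ncard ?_ 1
    rw [h.card_B]; norm_num
  obtain ⟨c, hc⟩ := h.tau_b hb hb1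
  have hu : (-1 / c) ^ 23 = 1 := by
    rw [div_pow, hc.2.1, show (-1 : ZMod 47) ^ 23 = -1 by decide,
      div_self (neg_ne_zero.2 one_ne_zero)]
  obtain ⟨k, hk, hkc⟩ := h.exists_chi_eq (a := (-1 / c) ^ 12) (by
    rw [← pow_mul, mul_comm, pow_mul, hu, one_pow])
  have h1 := h.hasPsi_smul (h.b_moved hb hb1) hc hk
  have h2 : χ k ^ 2 * c = -1 := by
    rw [hkc, ← pow_mul, show 12 * 2 = 23 + 1 from rfl, pow_succ, hu, one_mul,
      div_mul_cancel₀ _ (ne_zero_of_pow_23 hc.2.1)]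
  rw [mul_zero, h2, ← conj_smul hk.2] at h1
  exact ⟨_, h.conj_mem_B hk hb, fun e => hb1 (conj_eq_one_iff.1 e), h1⟩

/-- The fixed points of `y`, indexed by the projective line. -/
def pt {G Ω : Type*} [Group G] [MulAction G Ω] (i o : Ω) (z : ZMod 47 → G) :
    Option (ZMod 47) → Ω
  | none => i
  | some a => z a • o

theorem pt_inj (h : Frame P i o y σ z χ) : Function.Injective (pt i o z) := by
  rintro (_ | a) (_ | b) e
  · rfl
  · exact absurd e.symm (h.z_smul_ne b)
  · exact absurd e (h.z_smul_ne a)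
  · exact congrArg some (h.z_smul_inj e)

theorem exists_chi_neg (h : Frame P i o y σ z χ) : ∃ k ∈ twoStab G i o, χ k ^ 23 = -1 := by
  by_contra! hno
  have hfin := h.finite
  have hall : ∀ k ∈ twoStab G i o, χ k ^ 23 = 1 := fun k hk =>
    (pow_23_eq (h.chi_ne_zero hk)).resolve_right (hno k hk)
  obtain ⟨b, hb, hb1, hbc⟩ := h.exists_hasPsi_neg_one
  obtain ⟨hti, hto⟩ := h.tau_b_swap hb hb1
  have htt := (h.tau_spec (h.b_moved hb hb1)).1
  have htz := hbc.2.2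
  generalize tau y (b • o) = t at *
  obtain ⟨k, hk, hk12⟩ := h.exists_chi_eq (a := 12) (by decide)
  have hT : ∀ x, t • pt i o z x = pt i o z (negInv x) := by
    rintro (_ | a)
    · exact hti.trans (h.z_zero_smul o).symm
    · by_cases ha : a = 0
      · rw [ha]
        change t • z 0 • o = i
        rw [h.z_zero_smul, hto]
      · rw [show negInv (some a) = some (-a ^ 45) from if_neg ha, inv_eq_pow_45 ha]
        have := htz a ha
        rwa [add_zero, zero_add, neg_div, one_div] at this
  have hJ : ∀ x, (z 9 * k * t * z (-9)) • pt i o z x = pt i o z (shiftInv x) := by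
    rintro (_ | a)
    · change (z 9 * k * t * z (-9)) • i = z 9 • o
      rw [mul_smul, mul_smul, mul_smul, h.z_smul_i, hti, hk.2]
    · change (z 9 * k * t * z (-9)) • z a • o = _
      rw [mul_smul, mul_smul, mul_smul, h.z_smul_smul]
      by_cases ha : a = 9
      · rw [ha, neg_add_cancel, h.z_zero_smul, hto, hk.1, h.z_smul_i]
        rfl
      · have ha' : a - 9 ≠ 0 := sub_ne_zero.2 ha
        rw [show shiftInv (some a) = some (9 + 12 * -(a - 9) ^ 45) from if_neg ha,
          inv_eq_pow_45 ha']
        have := htz (a - 9) ha'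
        rw [add_zero, zero_add, neg_div, one_div] at this
        rw [show -9 + a = a - 9 by ring, this, h.smul_z_smul hk, hk12, h.z_smul_smul]
        rfl
  let T : Equiv.Perm (Option (ZMod 47)) := negInv_negInv.toPerm
  let J : Equiv.Perm (Option (ZMod 47)) := shiftInv_shiftInv.toPerm
  have hT1 : T none = some 0 := rfl
  have hJ1 : J none = some 9 := rfl
  obtain ⟨V, hV, hVc, hVs⟩ := exists_klein (a := T) (b := J)
    (Equiv.ext negInv_negInv) (Equiv.ext shiftInv_shiftInv) (Equiv.ext negInv_shiftInv)
    (fun e => by rw [e] at hT1; exact absurd hT1 (by decide))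
    (fun e => by rw [e] at hJ1; exact absurd hJ1 (by decide))
    (fun e => by rw [e, hJ1] at hT1; exact absurd hT1 (by decide))
  let D : Subgroup (G × Equiv.Perm (Option (ZMod 47))) :=
    { carrier := {p | p.2 ∈ V ∧ ∀ x, p.1 • pt i o z x = pt i o z (p.2 x)}
      one_mem' := ⟨one_mem V, fun x => one_smul _ _⟩
      mul_mem' := by
        rintro ⟨g, f⟩ ⟨g', f'⟩ ⟨h1, h2⟩ ⟨h3, h4⟩
        refine ⟨mul_mem h1 h3, fun x => ?_⟩
        change (g * g') • _ = _
        rw [mul_smul, h4, h2]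
        rfl
      inv_mem' := by
        rintro ⟨g, f⟩ ⟨h1, h2⟩
        refine ⟨inv_mem h1, fun x => ?_⟩
        change g⁻¹ • _ = _
        rw [inv_smul_eq_iff, h2]
        exact congrArg _ (Equiv.apply_symm_apply f x).symm }
  have hone : ∀ p ∈ D, p.1 = 1 → p = 1 := by
    rintro ⟨g, f⟩ ⟨-, h2⟩ (rfl : g = 1)
    refine Prod.ext rfl (Equiv.ext fun x => ?_)
    exact (h.pt_inj ((one_smul _ _).symm.trans (h2 x))).symm
  have hker : ∀ g : G, (∀ x, g • pt i o z x = pt i o z x) → g ∈ twoStab G i o := by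
    intro g hg
    have h1 := hg (some 0)
    change g • z 0 • o = z 0 • o at h1
    rw [h.z_zero_smul] at h1
    exact ⟨hg none, h1⟩
  have hDy : ∀ p ∈ D, p.1 * y = y * p.1 := by
    rintro ⟨g, f⟩ hp
    have hyp : ∀ x, y • pt i o z x = pt i o z x := by
      rintro (_ | a)
      · exact h.y_mem.1
      · exact h.y_smul_z a
    have h2 := (inv_mem hp).2
    have h3 : g * y * g⁻¹ = y := by
      refine h.eq_y (hker _ fun x => ?_) ?_ (fun e => h.y_ne (conj_eq_one_iff.1 e))
      · have h4 := h2 x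
        change g⁻¹ • _ = _ at h4
        rw [mul_smul, mul_smul, h4, hyp, ← h4, smul_inv_smul]
      · calc g * y * g⁻¹ * (g * y * g⁻¹) = g * (y * y) * g⁻¹ := by group
          _ = 1 := by rw [h.y_mul]; group
    exact mul_mul_inv_eq_iff.1 h3
  have h32 : 128 ∣ Nat.card D := by
    obtain ⟨S, hS⟩ := Sylow.exists_subgroup_card_pow_prime (G := twoStab G i o) 2 (n := 5)
      (by rw [h.card_K]; norm_num)
    let ψ : D →* V := ((MonoidHom.snd _ _).comp D.subtype).codRestrict V fun p => p.2.1
    have hψ : Function.Surjective ψ := by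
      have hTD : (t, T) ∈ D := ⟨(hV _).2 (Or.inr (Or.inl rfl)), hT⟩
      have hJD : (z 9 * k * t * z (-9), J) ∈ D :=
        ⟨(hV _).2 (Or.inr (Or.inr (Or.inl rfl))), hJ⟩
      rintro ⟨v, hv⟩
      rcases (hV v).1 hv with rfl | rfl | rfl | rfl
      · exact ⟨1, map_one ψ⟩
      · exact ⟨⟨_, hTD⟩, rfl⟩
      · exact ⟨⟨_, hJD⟩, rfl⟩
      · exact ⟨⟨_, mul_mem hTD hJD⟩, rfl⟩
    have hchi : ∀ k ∈ S, ∀ a, (k : G) * z a = z a * k := by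
      intro k hkS
      refine (h.chi_eq_one_iff k.2).1 ?_
      have h1 : (k : G) ^ 32 = 1 := by
        have : k ^ 32 = 1 := by
          have := Subgroup.orderOf_dvd_natCard S hkS
          rw [hS] at this
          exact orderOf_dvd_iff_pow_eq_one.1 this
        exact congrArg Subtype.val this
      have h2 := h.chi_pow k.2 32
      rw [h1, h.chi_one] at h2
      have h3 := hall k k.2
      have h4 := h.chi_pow k.2 23
      calc χ k = χ k * (χ k ^ 32) ^ 5 := by rw [← h2]; ring
        _ = (χ k ^ 23) ^ 7 := by ring
        _ = 1 := by rw [h3, one_pow]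
    let f : S → ψ.ker := fun k => ⟨⟨((k : twoStab G i o), 1), one_mem V, by
      rintro (_ | a)
      · exact k.1.2.1
      · change ((k : twoStab G i o) : G) • z a • o = z a • o
        rw [← mul_smul, hchi _ k.2, mul_smul, k.1.2.2]⟩, rfl⟩
    have h5 : Nat.card S ∣ Nat.card ψ.ker := by
      let f' : S →* ψ.ker := MonoidHom.mk' f fun a b => rfl
      refine Subgroup.card_dvd_of_injective f' fun a b e => ?_
      have : ((a : twoStab G i o) : G) = (b : twoStab G i o) :=
        congrArg (fun p : ψ.ker => p.1.1.1) e
      exact Subtype.ext (Subtype.ext this)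
    rw [Subgroup.card_eq_card_quotient_mul_card_subgroup ψ.ker,
      Nat.card_congr (QuotientGroup.quotientKerEquivOfSurjective ψ hψ).toEquiv, hVc,
      show 128 = 4 * 2 ^ 5 by norm_num, ← hS]
    exact mul_dvd_mul_left _ h5
  have hd := card_dvd_ncard_mul
    (((MulAction.toPermHom G Ω).comp (MonoidHom.fst _ _)).comp D.subtype)
    (Y := {x : Ω | y • x ≠ x}) (c := 2)
    (fun p x hx => smul_ne_of_comm (hDy _ p.2) hx) (by
    intro x hx
    obtain ⟨-, -, hx3, -⟩ := h.tau_spec hx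
    have hsub : ∀ p : D, (p : G × Equiv.Perm (Option (ZMod 47))).1 • x = x →
        p = 1 ∨ (p : G × Equiv.Perm (Option (ZMod 47))).1 = tau y x := by
      rintro ⟨⟨g, f⟩, hp⟩ hpx
      change g • x = x at hpx
      have hgg : g * g = 1 := by
        refine h.eq_one_of_fix (hker _ fun a => ?_) hx (by rw [mul_smul, hpx, hpx])
        have h1 := (mul_mem hp hp).2 a
        have h2 : f * f = 1 := hVs f hp.1
        change (g * g) • _ = pt i o z ((f * f) a) at h1
        rw [h2] at h1
        exact h1
      by_cases hg : g = 1
      · exact Or.inl (Subtype.ext (hone _ hp hg))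
      · exact Or.inr (h.eq_tau_of_comm hx hgg hg hpx (hDy _ hp))
    have hle : {p : D | (p : G × Equiv.Perm (Option (ZMod 47))).1 • x = x}.ncard ≤ 2 := by
      have hinj : ∀ p q : D, (p : G × Equiv.Perm (Option (ZMod 47))).1 =
          (q : G × Equiv.Perm (Option (ZMod 47))).1 → p = q := by
        intro p q e
        have := hone _ (mul_mem p.2 (inv_mem q.2)) (by
          rw [Prod.fst_mul, Prod.fst_inv, e, mul_inv_cancel])
        exact Subtype.ext (mul_inv_eq_one.1 this)
      rw [← Set.ncard_image_of_injective _ (f := fun p : D =>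
        (p : G × Equiv.Perm (Option (ZMod 47))).1) (fun p q => hinj p q)]
      refine (Set.ncard_le_ncard (t := {1, tau y x}) ?_ (Set.toFinite _)).trans
        ((Set.ncard_insert_le _ _).trans (by rw [Set.ncard_singleton]))
      rintro _ ⟨p, hp, rfl⟩
      rcases hsub p hp with rfl | e
      · exact Or.inl rfl
      · exact Or.inr e
    have hpos : 0 < {p : D | (p : G × Equiv.Perm (Option (ZMod 47))).1 • x = x}.ncard :=
      (Set.ncard_pos (Set.toFinite _)).2 ⟨1, one_smul _ _⟩
    change {p : D | (p : G × Equiv.Perm (Option (ZMod 47))).1 • x = x}.ncard ∣ 2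
    interval_cases {p : D | (p : G × Equiv.Perm (Option (ZMod 47))).1 • x = x}.ncard <;> norm_num)
  rw [h.ncard_moved] at hd
  have := h32.trans hd
  norm_num at this

end Frame

/-- The field with `47 ^ 2` elements, as `ZMod 47` with a square root of `-1` adjoined. -/
abbrev F47 := QuadraticAlgebra (ZMod 47) (-1) 0

instance : Fact (∀ r : ZMod 47, r ^ 2 ≠ -1 + 0 * r) := ⟨by decide⟩

theorem im_star_mul (v v' : F47) : (star v * v').im = v.re * v'.im - v.im * v'.re := by
  simp
  ring

theorem norm_eq (v : F47) : v.norm = v.re ^ 2 + v.im ^ 2 := by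
  rw [QuadraticAlgebra.norm_def]
  ring

theorem additive_zmod {f : ZMod 47 → ZMod 47} (hf : ∀ a b, f (a + b) = f a + f b) (a : ZMod 47) :
    f a = a * f 1 := by
  have := ((AddMonoidHom.mk' f hf).toZModLinearMap 47).map_smul a 1
  simpa using this

theorem additive_eq_mul {f : F47 → F47} (hf : ∀ a b, f (a + b) = f a + f b)
    (hi : ∀ v, f (QuadraticAlgebra.omega * v) = QuadraticAlgebra.omega * f v) (v : F47) :
    f v = f 1 * v := by
  have hs : ∀ (c : ZMod 47) v, f (c • v) = c • f v := fun c v =>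
    ((AddMonoidHom.mk' f hf).toZModLinearMap 47).map_smul c v
  have h1 : v = v.re • (1 : F47) + v.im • (QuadraticAlgebra.omega * 1 : F47) := by
    ext <;> simp [QuadraticAlgebra.re_one, QuadraticAlgebra.im_one]
  conv_lhs => rw [h1]
  rw [hf, hs, hs, hi]
  ext <;> simp <;> ring

namespace Frame

open Setting

variable {G Ω : Type*} [Group G] [Finite G] [MulAction G Ω] {P : Ω → Subgroup G} {i o : Ω}
  {y σ : G} {z : ZMod 47 → G} {χ : G → ZMod 47}

theorem eq_of_mem_B (h : Frame P i o y σ z χ) {b b' : G} {a : ZMod 47}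
    (hb : b ∈ inverted P i y) (hb' : b' ∈ inverted P i y) (e : b = b' * z a) : b = b' ∧ a = 0 := by
  have := h.z_inv_two hb hb' (a := 0) (a' := a) (by rw [h.z_zero, mul_one, e])
  exact ⟨this.1, this.2.symm⟩

theorem exists_orderOf_B (h : Frame P i o y σ z χ) :
    ∃ b ∈ inverted P i y, orderOf b = 47 := by
  obtain ⟨b, hb, hb1⟩ : ∃ b ∈ inverted P i y, b ≠ 1 := by
    refine Set.exists_ne_of_one_lt_ncard ?_ 1
    rw [h.card_B]; norm_num
  have hd : orderOf b ∣ 47 ^ 3 := by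
    rw [← h.card_P i]
    exact Subgroup.orderOf_dvd_natCard _ hb.1
  have h47 : 47 ∣ orderOf b := by
    obtain ⟨n, -, hn⟩ := (Nat.dvd_prime_pow (by norm_num)).1 hd
    rw [hn]
    refine dvd_pow_self _ fun e => hb1 ?_
    rw [e, pow_zero, orderOf_eq_one_iff] at hn
    exact hn
  have hord := orderOf_pow_orderOf_div (orderOf_pos b).ne' h47
  refine ⟨_, ⟨pow_mem hb.1 _, ?_⟩, hord⟩
  rw [← conj_pow, hb.2, inv_pow]

theorem exists_heisenberg (h : Frame P i o y σ z χ) {J : G} (hJ : J ∈ twoStab G i o)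
    (hJJ : J * J = y) : ∃ (β : F47 → G) (ω₀ : ZMod 47), (∀ v, β v ∈ inverted P i y) ∧
      Function.Injective β ∧
      (∀ v v', β v * β v' = β (v + v') * z (ω₀ * (star v * v').im)) ∧
      ∀ v, J * β v * J⁻¹ = β (QuadraticAlgebra.omega * v) := by
  obtain ⟨b, hb, hb47⟩ := h.exists_orderOf_B
  obtain ⟨u, hu, hui, hub⟩ := exists_param (A := zpowers b) (by rw [Nat.card_zpowers, hb47])
  have huB : ∀ a, u a ∈ inverted P i y := by
    intro a
    obtain ⟨n, hn⟩ := (hub _).2 ⟨a, rfl⟩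
    rw [← hn]
    refine ⟨zpow_mem hb.1 n, ?_⟩
    change y * b ^ n * y⁻¹ = (b ^ n)⁻¹
    rw [← conj_zpow, hb.2, inv_zpow]
  have hu0 : u 0 = 1 := by
    have := hu 0 0
    rwa [add_zero, left_eq_mul] at this
  have hun : ∀ a, u (-a) = (u a)⁻¹ := fun a => by
    rw [eq_inv_iff_mul_eq_one, ← hu, neg_add_cancel, hu0]
  obtain ⟨w, hw⟩ : ∃ w : ZMod 47 → G, ∀ a, w a = J * u a * J⁻¹ := ⟨_, fun _ => rfl⟩
  have hwB : ∀ a, w a ∈ inverted P i y := fun a => by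
    rw [hw]; exact h.conj_mem_B hJ (huB a)
  have hwadd : ∀ a a', w (a + a') = w a * w a' := fun a a' => by
    simp only [hw, hu]; group
  have hw0 : w 0 = 1 := by simp only [hw, hu0]; group
  have hwn : ∀ a, w (-a) = (w a)⁻¹ := fun a => by
    simp only [hw, hun]; group
  have hJw : ∀ a, J * w a * J⁻¹ = u (-a) := by
    intro a
    rw [hun, ← (huB a).2, ← hJJ]
    simp only [hw]; group
  have hf : ∀ a a', ∃ c, u a * w a' = w a' * u a * z c := by
    intro a a'
    obtain ⟨x, hx, c, e⟩ := h.exists_mul_z (mul_mem (huB a).1 (hwB a').1)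
    have e2 : w a' * u a = x * z (-c) := by
      have h1 : y * (u a * w a') * y⁻¹ = y * (x * z c) * y⁻¹ := by rw [e]
      have h2 : y * (u a * w a') * y⁻¹ = (w a' * u a)⁻¹ := by
        rw [mul_inv_rev, ← (huB a).2, ← (hwB a').2]; group
      have h3 : y * (x * z c) * y⁻¹ = x⁻¹ * z c := by
        rw [← hx.2]
        calc y * (x * z c) * y⁻¹ = y * x * (z c * y) * (y⁻¹ * y⁻¹) := by group
          _ = y * x * y⁻¹ * z c := by
            have hyy : y * y * (y⁻¹ * y⁻¹) = 1 := by group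
            rw [h.z_mul_y, h.y_inv]
            calc y * x * (y * z c) * (y * y) = y * x * y * z c * (y * y) := by group
              _ = _ := by rw [h.y_mul, mul_one]
      rw [h2, h3, inv_eq_iff_eq_inv, mul_inv_rev, inv_inv, ← h.z_neg, ← h.z_central hx.1] at h1
      exact h1
    refine ⟨c + c, ?_⟩
    rw [e, e2, mul_assoc, ← h.z_add]
    congr 2
    ring
  choose f hf using hf
  have hcz : ∀ a c, z c * u a = u a * z c := fun a c => (h.z_central (huB a).1 c).symm
  have hcw : ∀ a c, z c * w a = w a * z c := fun a c => (h.z_central (hwB a).1 c).symm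
  have hf1 : ∀ a a' c, f (a + a') c = f a c + f a' c := by
    intro a a' c
    refine h.z_inj (mul_left_cancel (a := w c * u (a + a')) ?_)
    rw [← hf, hu, h.z_add, mul_assoc, hf a' c]
    calc u a * (w c * u a' * z (f a' c)) = u a * w c * u a' * z (f a' c) := by group
      _ = w c * u a * (z (f a c) * u a') * z (f a' c) := by rw [hf a c]; group
      _ = _ := by rw [hcz]; group
  have hf2 : ∀ a c c', f a (c + c') = f a c + f a c' := by
    intro a c c'
    refine h.z_inj (mul_left_cancel (a := w (c + c') * u a) ?_)
    rw [← hf, hwadd, h.z_add]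
    calc u a * (w c * w c') = u a * w c * w c' := by group
      _ = w c * u a * (z (f a c) * w c') := by rw [hf a c]; group
      _ = w c * (u a * w c') * z (f a c) := by rw [hcw]; group
      _ = w c * w c' * u a * (z (f a c') * z (f a c)) := by rw [hf a c']; group
      _ = _ := by rw [h.z_comm]
  set ω₀ := f 1 1 / 2 with hω
  have hfω : ∀ a c, f a c = 2 * ω₀ * (a * c) := by
    intro a c
    rw [additive_zmod (f := fun a => f a c) (fun a a' => hf1 a a' c) a,
      additive_zmod (f := f 1) (hf2 1) c, hω, mul_div_cancel₀ _ (by decide : (2 : ZMod 47) ≠ 0)]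
    ring
  set β : F47 → G := fun v => u v.re * w v.im * z (-(ω₀ * (v.re * v.im))) with hβ
  have hmul : ∀ v v', β v * β v' = β (v + v') * z (ω₀ * (star v * v').im) := by
    intro v v'
    simp only [hβ, QuadraticAlgebra.re_add, QuadraticAlgebra.im_add, hu, hwadd, im_star_mul]
    have e1 : w v.im * u v'.re = u v'.re * w v.im * z (-(2 * ω₀ * (v'.re * v.im))) := by
      rw [hf, hfω, mul_assoc, ← h.z_add, add_neg_cancel, h.z_zero, mul_one]
    calc u v.re * w v.im * z (-(ω₀ * (v.re * v.im))) *
          (u v'.re * w v'.im * z (-(ω₀ * (v'.re * v'.im))))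
        = u v.re * w v.im * (z (-(ω₀ * (v.re * v.im))) *
          u v'.re) * w v'.im * z (-(ω₀ * (v'.re * v'.im))) := by group
      _ = u v.re * (w v.im * u v'.re) * (z (-(ω₀ * (v.re * v.im))) *
          w v'.im) * z (-(ω₀ * (v'.re * v'.im))) := by rw [hcz]; group
      _ = u v.re * u v'.re * w v.im * (z (-(2 * ω₀ * (v'.re * v.im))) * w v'.im) *
          (z (-(ω₀ * (v.re * v.im))) * z (-(ω₀ * (v'.re * v'.im)))) := by
          rw [e1, hcw]; group
      _ = u v.re * u v'.re * (w v.im * w v'.im) * z (-(2 * ω₀ * (v'.re * v.im)) +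
          (-(ω₀ * (v.re * v.im)) + -(ω₀ * (v'.re * v'.im)))) := by
          rw [hcw, h.z_add, h.z_add]; group
      _ = _ := by
          rw [mul_assoc _ (z _) (z _), ← h.z_add]
          congr 2
          ring
  have hβ0 : β 0 = 1 := by
    simp [hβ, hu0, hw0, h.z_zero]
  have hβn : ∀ v, β (-v) = (β v)⁻¹ := by
    intro v
    rw [eq_inv_iff_mul_eq_one, hmul, neg_add_cancel, hβ0, im_star_mul]
    simp only [QuadraticAlgebra.re_neg, QuadraticAlgebra.im_neg]
    rw [show ω₀ * (-v.re * v.im - -v.im * v.re) = 0 by ring, h.z_zero, mul_one]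
  have hβB : ∀ v, β v ∈ inverted P i y := by
    intro v
    refine ⟨mul_mem (mul_mem (huB _).1 (hwB _).1) (h.z_mem _), ?_⟩
    rw [← hβn]
    simp only [hβ]
    rw [h.conj_mul_z h.y_mem, h.chi_y, one_mul, QuadraticAlgebra.re_neg, QuadraticAlgebra.im_neg,
      hun, hwn, ← (huB _).2, ← (hwB _).2, neg_mul_neg]
    group
  have hβJ : ∀ v, J * β v * J⁻¹ = β (QuadraticAlgebra.omega * v) := by
    intro v
    have e : J * β v * J⁻¹ = β (QuadraticAlgebra.omega * v) * z (ω₀ * (v.re * v.im) -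
        χ J * (ω₀ * (v.re * v.im))) := by
      simp only [hβ]
      rw [h.conj_mul_z hJ]
      have e1 : J * (u v.re * w v.im) * J⁻¹ = w v.re * u (-v.im) := by
        rw [← hJw]; simp only [hw]; group
      have e2 : w v.re * u (-v.im) = u (-v.im) * w v.re * z (-(2 * ω₀ * (-v.im * v.re))) := by
        rw [hf, hfω, mul_assoc, ← h.z_add, add_neg_cancel, h.z_zero, mul_one]
      have e3 : (QuadraticAlgebra.omega * v : F47).re = -v.im := by simp
      have e4 : (QuadraticAlgebra.omega * v : F47).im = v.re := by simp
      rw [e1, e2, e3, e4, mul_assoc, mul_assoc _ (z _) (z _), ← h.z_add, ← h.z_add]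
      congr 2
      ring
    exact (h.eq_of_mem_B (h.conj_mem_B hJ (hβB v)) (hβB _) e).1
  refine ⟨β, ω₀, hβB, ?_, hmul, hβJ⟩
  let S : AddSubgroup F47 :=
    { carrier := {v | β v = 1}
      zero_mem' := hβ0
      add_mem' := by
        intro v v' hv hv'
        change β v = 1 at hv
        change β v' = 1 at hv'
        have := hmul v v'
        rw [hv, hv', mul_one] at this
        exact (h.eq_of_mem_B one_mem_B (hβB _) this).1.symm
      neg_mem' := by
        intro v hv
        change β v = 1 at hv
        change β (-v) = 1
        rw [hβn, hv, inv_one] }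
  have hSsmul : ∀ (c : ZMod 47) v, v ∈ S → c • v ∈ S := by
    intro c v hv
    rw [← ZMod.natCast_zmod_val c, Nat.cast_smul_eq_nsmul]
    exact nsmul_mem hv _
  have hS : ∀ v, β v = 1 → v = 0 := by
    intro v hv
    by_contra hv0
    have h1 : QuadraticAlgebra.omega * v ∈ S := by
      change β _ = 1
      rw [← hβJ, hv, mul_one, mul_inv_cancel]
    have h2 : (v.norm)⁻¹ • (v.re • v - v.im • (QuadraticAlgebra.omega * v)) ∈ S :=
      hSsmul _ _ (sub_mem (hSsmul _ _ hv) (hSsmul _ _ h1))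
    have hn : v.norm ≠ 0 := fun e => hv0 (QuadraticAlgebra.norm_eq_zero_iff_eq_zero.1 e)
    have h3 : (v.norm)⁻¹ • (v.re • v - v.im • (QuadraticAlgebra.omega * v)) = 1 := by
      rw [inv_smul_eq_iff₀ hn, norm_eq]
      ext <;> simp [QuadraticAlgebra.re_one, QuadraticAlgebra.im_one] <;> ring
    rw [h3] at h2
    have h4 : β 1 = 1 := h2
    simp only [hβ, QuadraticAlgebra.re_one, QuadraticAlgebra.im_one, hw0, mul_zero, neg_zero,
      h.z_zero, mul_one] at h4
    exact one_ne_zero (hui (h4.trans hu0.symm))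
  intro v v' e
  have h1 := hmul v (-v')
  rw [hβn, ← e, mul_inv_cancel] at h1
  have := hS _ (h.eq_of_mem_B one_mem_B (hβB _) h1).1.symm
  rwa [← sub_eq_add_neg, sub_eq_zero] at this

end Frame

instance : CharP F47 47 := charP_of_injective_algebraMap (algebraMap (ZMod 47) F47).injective 47

theorem star_eq_pow (v : F47) : star v = v ^ 47 := by
  have h1 : v = algebraMap (ZMod 47) F47 v.re + algebraMap (ZMod 47) F47 v.im *
      (QuadraticAlgebra.omega : F47) := by
    ext <;> simp
  have h2 : (QuadraticAlgebra.omega : F47) ^ 47 = -QuadraticAlgebra.omega := by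
    have : (QuadraticAlgebra.omega : F47) ^ 2 = -1 := by
      ext <;> simp [pow_two, QuadraticAlgebra.re_one, QuadraticAlgebra.im_one]
    calc (QuadraticAlgebra.omega : F47) ^ 47 = (QuadraticAlgebra.omega ^ 2) ^ 23 *
          QuadraticAlgebra.omega := by ring
      _ = _ := by rw [this]; ring
  conv_rhs => rw [h1, add_pow_char, mul_pow, ← map_pow, ← map_pow, ZMod.pow_card, ZMod.pow_card, h2]
  ext <;> simp

theorem pow_48 (v : F47) : v ^ 48 = algebraMap (ZMod 47) F47 v.norm := by
  rw [QuadraticAlgebra.algebraMap_norm_eq_mul_star, star_eq_pow]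
  ring

theorem card_F47 : Nat.card F47 = 47 ^ 2 := by
  rw [Nat.card_congr (QuadraticAlgebra.equivProd (-1 : ZMod 47) 0), Nat.card_prod, Nat.card_zmod]
  norm_num

instance : Finite F47 := Nat.finite_of_card_ne_zero (by rw [card_F47]; norm_num)

/-- A `Frame` with coordinates in which the Sylow `47`-subgroup of the stabilizer of `i` becomes
the Heisenberg group over `F47`. -/
structure Coord {G Ω : Type*} [Group G] [MulAction G Ω] (P : Ω → Subgroup G) (i o : Ω)
    (y σ : G) (z : ZMod 47 → G) (χ : G → ZMod 47) (β : F47 → G) (m : G → F47) (κ : G) : Prop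
    extends Frame P i o y σ z χ where
  b_mem : ∀ v, β v ∈ Setting.inverted P i y
  b_inj : Function.Injective β
  b_surj : ∀ b ∈ Setting.inverted P i y, ∃ v, β v = b
  b_mul : ∀ v v', β v * β v' = β (v + v') * z (star v * v').im
  conj_b : ∀ k ∈ Setting.twoStab G i o, ∀ v, k * β v * k⁻¹ = β (m k * v)
  ka_mem : κ ∈ Setting.twoStab G i o
  chi_ka : χ κ = -1
  order_ka : orderOf κ = 32
  gen : ∀ k ∈ Setting.twoStab G i o, k ∈ zpowers (σ * κ)

namespace Frame

open Setting

variable {G Ω : Type*} [Group G] [Finite G] [MulAction G Ω] {P : Ω → Subgroup G} {i o : Ω}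
  {y σ : G} {z : ZMod 47 → G} {χ : G → ZMod 47}

theorem pow_sq_eq_y (h : Frame P i o y σ z χ) {κ : G} (hκ : κ ∈ twoStab G i o)
    (hc : χ κ = -1) (h32 : κ ^ 32 = 1) : ∃ n, κ ^ n * κ ^ n = y := by
  have key : ∀ n, κ ^ n ≠ 1 → κ ^ n * κ ^ n = 1 → κ ^ n = y := fun n h1 h2 =>
    h.eq_y (pow_mem hκ n) h2 h1
  have h1 : κ ^ 1 ≠ 1 := by
    rw [pow_one]
    rintro rfl
    rw [h.chi_one] at hc
    exact absurd hc (by decide)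
  have h2 : κ ^ 2 ≠ 1 := by
    intro h2
    have := key 1 h1 (by rw [← pow_add]; exact h2)
    rw [pow_one] at this
    rw [this, h.chi_y] at hc
    exact absurd hc (by decide)
  by_cases h4 : κ ^ 4 = 1
  · exact ⟨1, by rw [← pow_add]; exact key 2 h2 (by rw [← pow_add]; exact h4)⟩
  by_cases h8 : κ ^ 8 = 1
  · exact ⟨2, by rw [← pow_add]; exact key 4 h4 (by rw [← pow_add]; exact h8)⟩
  by_cases h16 : κ ^ 16 = 1
  · exact ⟨4, by rw [← pow_add]; exact key 8 h8 (by rw [← pow_add]; exact h16)⟩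
  · exact ⟨8, by rw [← pow_add]; exact key 16 h16 (by rw [← pow_add]; exact h32)⟩

theorem exists_normalized (h : Frame P i o y σ z χ) {J : G} (hJ : J ∈ twoStab G i o)
    (hJJ : J * J = y) : ∃ (β : F47 → G) (z' : ZMod 47 → G), Frame P i o y σ z' χ ∧
      (∀ v, β v ∈ inverted P i y) ∧ Function.Injective β ∧ (∀ b ∈ inverted P i y, ∃ v, β v = b) ∧
      (∀ v v', β v * β v' = β (v + v') * z' (star v * v').im) ∧
      ∀ v, J * β v * J⁻¹ = β (QuadraticAlgebra.omega * v) := by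
  obtain ⟨β, ω₀, hB, hi, hmul, hJβ⟩ := h.exists_heisenberg hJ hJJ
  have hsurj : ∀ b ∈ inverted P i y, ∃ v, β v = b := by
    have h1 : Set.range β = inverted P i y := by
      refine Set.eq_of_subset_of_ncard_le ?_ ?_ (Set.toFinite _)
      · rintro _ ⟨v, rfl⟩
        exact hB v
      · rw [h.card_B, ← Set.image_univ, Set.ncard_image_of_injective _ hi, Set.ncard_univ, card_F47]
    intro b hb
    rw [← h1] at hb
    exact hb
  have h0 : ω₀ ≠ 0 := by
    rintro rfl
    obtain ⟨b, hb, b', hb', hbb⟩ := h.exists_mul_notMem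
    obtain ⟨v, rfl⟩ := hsurj b hb
    obtain ⟨v', rfl⟩ := hsurj b' hb'
    rw [hmul, zero_mul, h.z_zero, mul_one] at hbb
    exact hbb (hB _)
  refine ⟨β, fun a => z (ω₀ * a), ?_, hB, hi, hsurj, hmul, hJβ⟩
  exact
  { h with
    z_add := fun a b => by rw [mul_add, h.z_add]
    z_inj := fun a b e => mul_left_cancel₀ h0 (h.z_inj e)
    mem_z := fun x => by
      rw [h.mem_z]
      constructor
      · rintro ⟨a, rfl⟩
        exact ⟨a / ω₀, by rw [mul_div_cancel₀ _ h0]⟩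
      · rintro ⟨a, rfl⟩
        exact ⟨_, rfl⟩
    conj_z := fun k hk a => by rw [h.conj_z k hk, mul_left_comm] }

theorem exists_coord (h : Setting G Ω P) : ∃ (i o : Ω) (y σ : G) (z : ZMod 47 → G)
    (χ : G → ZMod 47) (β : F47 → G) (m : G → F47) (κ : G), Coord P i o y σ z χ β m κ := by
  obtain ⟨i, o, y, σ, z₀, χ, h₀⟩ := h.exists_frame
  obtain ⟨k₀, hk₀, hc₀⟩ := h₀.exists_chi_neg
  obtain ⟨κ, hκ⟩ : ∃ κ, κ = k₀ ^ 23 := ⟨_, rfl⟩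
  have hκm : κ ∈ twoStab G i o := hκ ▸ pow_mem hk₀ 23
  have hχ : χ κ = -1 := by rw [hκ, h₀.chi_pow hk₀, hc₀]
  have hpow : ∀ k ∈ twoStab G i o, k ^ 736 = 1 := by
    intro k hk
    have := pow_card_eq_one' (x := (⟨k, hk⟩ : twoStab G i o))
    rw [h₀.card_K] at this
    exact congrArg Subtype.val this
  have h32 : κ ^ 32 = 1 := by rw [hκ, ← pow_mul]; exact hpow _ hk₀
  obtain ⟨n, hn⟩ := h₀.pow_sq_eq_y hκm hχ h32
  obtain ⟨β, z, h, hB, hi, hsurj, hmul, hJβ⟩ := h₀.exists_normalized (pow_mem hκm n) hn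
  have hlin : ∀ k ∈ twoStab G i o, k * κ ^ n = κ ^ n * k →
      ∃ u, ∀ v, k * β v * k⁻¹ = β (u * v) := by
    intro k hk hkJ
    choose f hf using fun v => hsurj _ (h.conj_mem_B hk (hB v))
    refine ⟨f 1, fun v => ?_⟩
    rw [← hf, additive_eq_mul (f := f)]
    · intro v v'
      have h1 : k * (β v * β v') * k⁻¹ = (k * β v * k⁻¹) * (k * β v' * k⁻¹) := by group
      rw [hmul, h.conj_mul_z hk, ← hf, ← hf, ← hf, hmul] at h1
      exact hi (h.z_inv_two (hB _) (hB _) h1).1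
    · intro v
      apply hi
      rw [hf, ← hJβ, ← hJβ, hf]
      calc k * (κ ^ n * β v * (κ ^ n)⁻¹) * k⁻¹ = (k * κ ^ n) * β v * (k * κ ^ n)⁻¹ := by group
        _ = _ := by rw [hkJ]; group
  have hκ16 : κ ^ 16 ≠ 1 := by
    intro h16
    obtain ⟨u, hu⟩ := hlin κ hκm (by rw [← pow_succ, ← pow_succ'])
    have hN : χ κ = u.norm := by
      have h1 : κ * (β 1 * β QuadraticAlgebra.omega) * κ⁻¹ =
          (κ * β 1 * κ⁻¹) * (κ * β QuadraticAlgebra.omega * κ⁻¹) := by group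
      rw [hmul, h.conj_mul_z hκm, hu, hu, hu, hmul] at h1
      have h2 := (h.z_inv_two (hB _) (hB _) h1).2
      rw [im_star_mul, im_star_mul] at h2
      simpa [QuadraticAlgebra.re_one, QuadraticAlgebra.im_one, norm_eq, pow_two] using h2
    have hpow : ∀ j v, κ ^ j * β v * (κ ^ j)⁻¹ = β (u ^ j * v) := by
      intro j
      induction j with
      | zero => intro v; simp
      | succ j ih =>
        intro v
        rw [pow_succ, pow_succ, mul_assoc (u ^ j), ← ih, ← hu]
        group
    have h2 := hpow 16 1
    rw [h16, one_mul, inv_one, mul_one] at h2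
    have h3 := hi h2
    rw [mul_one] at h3
    have h4 := pow_48 u
    rw [show u ^ 48 = (u ^ 16) ^ 3 by ring, ← h3, one_pow, ← hN, hχ] at h4
    have h5 := congrArg QuadraticAlgebra.re h4
    rw [QuadraticAlgebra.re_one, QuadraticAlgebra.algebraMap_re] at h5
    exact absurd h5 (by decide)
  have hord : orderOf κ = 32 := orderOf_eq_prime_pow (p := 2) (n := 4) hκ16 h32
  have hcomm : Commute σ κ := (h.commute_s hκm).symm
  have hord2 : orderOf (σ * κ) = 736 := by
    rw [hcomm.orderOf_mul_eq_mul_orderOf_of_coprime (by rw [h.s_order, hord]; norm_num), h.s_order,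
      hord]
  have hle : zpowers (σ * κ) ≤ twoStab G i o := by
    rw [zpowers_le]
    exact mul_mem h.s_mem hκm
  have hgen : zpowers (σ * κ) = twoStab G i o :=
    Subgroup.eq_of_le_of_card_ge hle (by rw [h.card_K, Nat.card_zpowers, hord2])
  have hm : ∀ k, ∃ u, k ∈ twoStab G i o → ∀ v, k * β v * k⁻¹ = β (u * v) := by
    intro k
    by_cases hk : k ∈ twoStab G i o
    · have h1 : κ ^ n ∈ twoStab G i o := pow_mem hκm n
      have hk' := hk
      rw [← hgen] at h1 hk'
      obtain ⟨a, ha⟩ := h1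
      obtain ⟨b, hb⟩ := hk'
      obtain ⟨u, hu⟩ := hlin k hk (by
        rw [← ha, ← hb]
        exact (Commute.zpow_zpow (Commute.refl _) b a).eq)
      exact ⟨u, fun _ => hu⟩
    · exact ⟨0, fun hk' => absurd hk' hk⟩
  choose m hm using hm
  exact ⟨i, o, y, σ, z, χ, β, m, κ, { h with
    b_mem := hB
    b_inj := hi
    b_surj := hsurj
    b_mul := hmul
    conj_b := hm
    ka_mem := hκm
    chi_ka := hχ
    order_ka := hord
    gen := fun k hk => hgen ▸ hk }⟩

end Frame

namespace Coord

open Setting OD.Frame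

variable {G Ω : Type*} [Group G] [Finite G] [MulAction G Ω] {P : Ω → Subgroup G} {i o : Ω}
  {y σ : G} {z : ZMod 47 → G} {χ : G → ZMod 47} {β : F47 → G} {m : G → F47} {κ : G}

theorem b_zero (h : Coord P i o y σ z χ β m κ) : β 0 = 1 := by
  have := h.b_mul 0 0
  rwa [im_star_mul, add_zero, show (0 : F47).re * (0 : F47).im - (0 : F47).im * (0 : F47).re = 0
    by simp, h.z_zero, mul_one, mul_eq_left] at this

theorem b_neg (h : Coord P i o y σ z χ β m κ) (v : F47) : β (-v) = (β v)⁻¹ := by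
  rw [eq_inv_iff_mul_eq_one, h.b_mul, neg_add_cancel, h.b_zero, im_star_mul]
  simp only [QuadraticAlgebra.re_neg, QuadraticAlgebra.im_neg]
  rw [show -v.re * v.im - -v.im * v.re = 0 by ring, h.z_zero, mul_one]

theorem b_ne_one (h : Coord P i o y σ z χ β m κ) {v : F47} (hv : v ≠ 0) : β v ≠ 1 := fun e =>
  hv (h.b_inj (e.trans h.b_zero.symm))

theorem mul_b (h : Coord P i o y σ z χ β m κ) {k : G} (hk : k ∈ twoStab G i o) (v : F47) :
    k * β v = β (m k * v) * k := by
  rw [← h.conj_b k hk]; group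

theorem m_eq (h : Coord P i o y σ z χ β m κ) {k : G} (hk : k ∈ twoStab G i o) {u v : F47}
    (hv : v ≠ 0) (e : k * β v * k⁻¹ = β (u * v)) : m k = u := by
  rw [h.conj_b k hk] at e
  exact mul_right_cancel₀ hv (h.b_inj e)

theorem m_one (h : Coord P i o y σ z χ β m κ) : m 1 = 1 :=
  h.m_eq (one_mem _) (one_ne_zero (α := F47)) (by group)

theorem m_mul (h : Coord P i o y σ z χ β m κ) {k l : G} (hk : k ∈ twoStab G i o)
    (hl : l ∈ twoStab G i o) : m (k * l) = m k * m l := by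
  refine h.m_eq (mul_mem hk hl) (one_ne_zero (α := F47)) ?_
  rw [mul_assoc (m k), ← h.conj_b k hk, ← h.conj_b l hl]
  group

theorem m_pow (h : Coord P i o y σ z χ β m κ) {k : G} (hk : k ∈ twoStab G i o) (n : ℕ) :
    m (k ^ n) = m k ^ n := by
  induction n with
  | zero => rw [pow_zero, pow_zero, h.m_one]
  | succ n ih => rw [pow_succ, pow_succ, h.m_mul (pow_mem hk n) hk, ih]

theorem pow_736 (h : Coord P i o y σ z χ β m κ) {k : G} (hk : k ∈ twoStab G i o) :
    k ^ 736 = 1 := by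
  have := pow_card_eq_one' (x := (⟨k, hk⟩ : twoStab G i o))
  rw [h.card_K] at this
  exact congrArg Subtype.val this

theorem m_pow_736 (h : Coord P i o y σ z χ β m κ) {k : G} (hk : k ∈ twoStab G i o) :
    m k ^ 736 = 1 := by
  rw [← h.m_pow hk, h.pow_736 hk, h.m_one]

theorem m_ne_zero (h : Coord P i o y σ z χ β m κ) {k : G} (hk : k ∈ twoStab G i o) :
    m k ≠ 0 := by
  intro e
  have := h.m_pow_736 hk
  rw [e, zero_pow (by norm_num)] at this
  exact zero_ne_one this

theorem smul_b (h : Coord P i o y σ z χ β m κ) {k : G} (hk : k ∈ twoStab G i o) (v : F47) :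
    k • β v • o = β (m k * v) • o := by
  rw [← mul_smul, h.mul_b hk, mul_smul, hk.2]

theorem m_inj (h : Coord P i o y σ z χ β m κ) {k l : G} (hk : k ∈ twoStab G i o)
    (hl : l ∈ twoStab G i o) (e : m k = m l) : k = l := by
  rw [← inv_mul_eq_one]
  refine h.eq_one_of_fix (mul_mem (inv_mem hk) hl)
    (h.b_moved (h.b_mem 1) (h.b_ne_one one_ne_zero)) ?_
  rw [mul_smul, h.smul_b hl, ← e, ← h.smul_b hk, inv_smul_smul]

theorem chi_eq (h : Coord P i o y σ z χ β m κ) {k : G} (hk : k ∈ twoStab G i o) :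
    χ k = (m k).norm := by
  have h1 : k * (β 1 * β QuadraticAlgebra.omega) * k⁻¹ =
      (k * β 1 * k⁻¹) * (k * β QuadraticAlgebra.omega * k⁻¹) := by group
  rw [h.b_mul, h.conj_mul_z hk, h.conj_b k hk, h.conj_b k hk, h.conj_b k hk, h.b_mul] at h1
  have h2 := (h.z_inv_two (h.b_mem _) (h.b_mem _) h1).2
  rw [im_star_mul, im_star_mul] at h2
  simpa [QuadraticAlgebra.re_one, QuadraticAlgebra.im_one, norm_eq, pow_two] using h2

theorem comm_K (h : Coord P i o y σ z χ β m κ) {k l : G} (hk : k ∈ twoStab G i o)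
    (hl : l ∈ twoStab G i o) : k * l = l * k :=
  h.m_inj (mul_mem hk hl) (mul_mem hl hk) (by rw [h.m_mul hk hl, h.m_mul hl hk, mul_comm])

theorem exists_m_eq (h : Coord P i o y σ z χ β m κ) {u : F47} (hu : u ^ 736 = 1) :
    ∃ k ∈ twoStab G i o, m k = u := by
  have hsub : m '' (twoStab G i o) ⊆ (Polynomial.nthRootsFinset 736 (1 : F47) : Set F47) := by
    rintro _ ⟨k, hk, rfl⟩
    rw [Finset.mem_coe, Polynomial.mem_nthRootsFinset (by norm_num)]
    exact h.m_pow_736 hk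
  have hcard : (m '' (twoStab G i o : Set G)).ncard = 736 := by
    rw [Set.InjOn.ncard_image fun k hk l hl e => h.m_inj hk hl e, ← Nat.card_coe_set_eq]
    exact h.card_K
  have heq := Set.eq_of_subset_of_ncard_le hsub (by
    rw [hcard, Set.ncard_coe_finset, Polynomial.nthRootsFinset_def]
    exact (Multiset.toFinset_card_le _).trans (Polynomial.card_nthRoots _ _))
  have : u ∈ m '' (twoStab G i o) := by
    rw [heq, Finset.mem_coe, Polynomial.mem_nthRootsFinset (by norm_num)]
    exact hu
  exact this

theorem m_y (h : Coord P i o y σ z χ β m κ) : m y = -1 := by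
  refine h.m_eq h.y_mem (one_ne_zero (α := F47)) ?_
  rw [(h.b_mem 1).2, ← h.b_neg, neg_mul, one_mul]

theorem m_s_star (h : Coord P i o y σ z χ β m κ) : star (m σ) = m σ := by
  have h1 : m σ ^ 23 = 1 := by
    rw [← h.m_pow h.s_mem, ← h.s_order, pow_orderOf_eq_one, h.m_one]
  rw [star_eq_pow, show m σ ^ 47 = (m σ ^ 23) ^ 2 * m σ by ring, h1, one_pow, one_mul]

end Coord

/-- A `Coord` together with the involution which interchanges `i` and `o` and fixes `β 1 • o`. -/
structure Flip {G Ω : Type*} [Group G] [MulAction G Ω] (P : Ω → Subgroup G) (i o : Ω)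
    (y σ : G) (z : ZMod 47 → G) (χ : G → ZMod 47) (β : F47 → G) (m : G → F47) (κ t : G)
    (c : ZMod 47) : Prop extends Coord P i o y σ z χ β m κ where
  t_mul : t * t = 1
  t_ne : t ≠ 1
  t_i : t • i = o
  t_o : t • o = i
  t_y : t * y = y * t
  t_b : t • β 1 • o = β 1 • o
  c_pow : c ^ 23 = -1
  t_z : ∀ s, s ≠ 0 → t • z s • o = z (c / s) • o
  t_moved : ∀ x : Ω, y • x = x → t • x ≠ x

theorem Coord.exists_flip {G Ω : Type*} [Group G] [Finite G] [MulAction G Ω]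
    {P : Ω → Subgroup G} {i o : Ω} {y σ : G} {z : ZMod 47 → G} {χ : G → ZMod 47} {β : F47 → G}
    {m : G → F47} {κ : G} (h : Coord P i o y σ z χ β m κ) :
    ∃ t c, Flip P i o y σ z χ β m κ t c := by
  have hb := h.b_mem 1
  have hb1 := h.b_ne_one one_ne_zero
  have hm := h.b_moved hb hb1
  obtain ⟨c, h1, h2, h3⟩ := h.tau_b hb hb1
  obtain ⟨h4, h5, h6, -⟩ := h.tau_spec hm
  exact ⟨tau y (β 1 • o), c, { h with
    t_mul := h4
    t_ne := h5
    t_i := (h.tau_b_swap hb hb1).1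
    t_o := (h.tau_b_swap hb hb1).2
    t_y := h.tau_comm hm
    t_b := h6
    c_pow := h2
    t_z := fun s hs => by simpa using h3 s hs
    t_moved := fun x hx => h.tau_smul_ne hm hx }⟩

namespace Flip

open Setting OD.Frame

variable {G Ω : Type*} [Group G] [Finite G] [MulAction G Ω] {P : Ω → Subgroup G} {i o : Ω}
  {y σ : G} {z : ZMod 47 → G} {χ : G → ZMod 47} {β : F47 → G} {m : G → F47} {κ t : G}
  {c : ZMod 47}

theorem t_inv (h : Flip P i o y σ z χ β m κ t c) : t⁻¹ = t := inv_eq_of_mul_eq_one_left h.t_mul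

theorem c_ne_zero (h : Flip P i o y σ z χ β m κ t c) : c ≠ 0 := ne_zero_of_pow_23 h.c_pow

theorem smul_smul_t (h : Flip P i o y σ z χ β m κ t c) (x : Ω) : t • t • x = x :=
  smul_smul_self h.t_mul x

theorem conj_mem (h : Flip P i o y σ z χ β m κ t c) {k : G} (hk : k ∈ twoStab G i o) :
    t * k * t ∈ twoStab G i o := by
  have := conj_mem_K h.t_i h.t_o hk
  rwa [h.t_inv] at this

theorem chi_conj (h : Flip P i o y σ z χ β m κ t c) {k : G} (hk : k ∈ twoStab G i o) :
    χ (t * k * t) = (χ k)⁻¹ := by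
  have hc := h.c_ne_zero
  have hχ := h.chi_ne_zero hk
  have h1 := h.smul_z_smul (h.conj_mem hk) 1
  rw [mul_smul, mul_smul, h.t_z 1 one_ne_zero, h.smul_z_smul hk, h.t_z _ (by simp [hc, hχ])] at h1
  have h2 := h.z_smul_inj h1
  rw [mul_one] at h2
  rw [← h2]
  field_simp

theorem comm_of_chi (h : Flip P i o y σ z χ β m κ t c) {k : G} (hk : k ∈ twoStab G i o)
    (hχ : χ k = 1) : t * k = k * t := by
  have hc := h.c_ne_zero
  have hw : z (-c) * t * z 1 * t * z (-c) * t ∈ twoStab G i o := by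
    constructor
    · change _ • i = i
      simp only [mul_smul]
      rw [h.t_i, h.t_z _ (neg_ne_zero.2 hc), h.z_smul_smul, div_neg, div_self hc, add_neg_cancel,
        h.z_zero_smul, h.t_o, h.z_smul_i]
    · change _ • o = o
      simp only [mul_smul]
      rw [h.t_o, h.z_smul_i, h.t_i, h.t_z _ one_ne_zero, h.z_smul_smul, div_one, neg_add_cancel,
        h.z_zero_smul]
  have hk' := h.conj_mem hk
  have hχ' : χ (t * k * t) = 1 := by rw [h.chi_conj hk, hχ, inv_one]
  have h1 := (h.chi_eq_one_iff hk).1 hχ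
  have h2 := (h.chi_eq_one_iff hk').1 hχ'
  obtain ⟨w, hwdef⟩ : ∃ w, w = z (-c) * t * z 1 * t * z (-c) := ⟨_, rfl⟩
  have h3 : k * w = w * k := by
    have ht : ∀ x : G, t * (t * x) = x := fun x => by rw [← mul_assoc, h.t_mul, one_mul]
    calc k * w = k * z (-c) * t * z 1 * t * z (-c) := by rw [hwdef]; group
      _ = z (-c) * t * ((t * k * t) * z 1) * t * z (-c) := by
        rw [h1]; simp only [mul_assoc, ht]
      _ = z (-c) * t * z 1 * t * (k * z (-c)) := by
        rw [h2]; simp only [mul_assoc, ht]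
      _ = _ := by rw [h1, hwdef]; simp only [mul_assoc]
  rw [← hwdef] at hw
  have h4 := h.comm_K hk hw
  rw [← mul_assoc, h3, mul_assoc, mul_assoc] at h4
  exact (mul_left_cancel h4).symm

theorem conj_ka (h : Flip P i o y σ z χ β m κ t c) : t * κ * t = y * κ := by
  have hκ' := h.conj_mem h.ka_mem
  have h1 : t * κ ^ 2 = κ ^ 2 * t := h.comm_of_chi (pow_mem h.ka_mem 2) (by
    rw [h.chi_pow h.ka_mem, h.chi_ka]; norm_num)
  have h2 : (t * κ * t) * (t * κ * t) = κ * κ := by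
    calc (t * κ * t) * (t * κ * t) = t * κ * (t * t) * κ * t := by group
      _ = t * κ ^ 2 * t := by rw [h.t_mul, mul_one, pow_two]; group
      _ = _ := by rw [h1, mul_assoc, h.t_mul, pow_two, mul_one]
  have hmem : t * κ * t * κ⁻¹ ∈ twoStab G i o := mul_mem hκ' (inv_mem h.ka_mem)
  have h3 : t * κ * t * κ⁻¹ * (t * κ * t * κ⁻¹) = 1 := by
    rw [h.comm_K hκ' (inv_mem h.ka_mem)]
    calc κ⁻¹ * (t * κ * t) * (κ⁻¹ * (t * κ * t)) = κ⁻¹ * ((t * κ * t) * κ⁻¹) * (t * κ * t) := by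
          group
      _ = κ⁻¹ * κ⁻¹ * ((t * κ * t) * (t * κ * t)) := by
          rw [h.comm_K hκ' (inv_mem h.ka_mem)]; group
      _ = 1 := by rw [h2]; group
  by_cases h4 : t * κ * t * κ⁻¹ = 1
  · exfalso
    have h5 : t * κ = κ * t := by
      rw [mul_inv_eq_one] at h4
      calc t * κ = t * κ * t * t := by rw [mul_assoc (t * κ), h.t_mul, mul_one]
        _ = _ := by rw [h4]
    have h6 : ∀ k : zpowers κ, t * (k : G) = k * t := by
      rintro ⟨k, hk⟩
      obtain ⟨n, rfl⟩ := hk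
      exact ((show Commute t κ from h5).zpow_right n).eq
    have := h.finite
    have h7 : Nat.card (zpowers κ) ∣ {x : Ω | t • x = x}.ncard := by
      refine card_dvd_ncard_of_free ((MulAction.toPermHom G Ω).comp (zpowers κ).subtype) ?_ ?_
      · intro k x (hx : t • x = x)
        change t • (k : G) • x = (k : G) • x
        rw [← mul_smul, h6, mul_smul, hx]
      · intro x (hx : t • x = x) k (hk : (k : G) • x = x)
        have hkK : (k : G) ∈ twoStab G i o := (zpowers_le.2 h.ka_mem) k.2
        exact Subtype.ext (h.eq_one_of_fix hkK (fun e => h.t_moved x e hx) hk)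
    rw [Nat.card_zpowers, h.order_ka, h.ncard_fix h.t_mul h.t_ne h.t_b] at h7
    exact absurd h7 (by norm_num)
  · have h5 := h.eq_y hmem h3 h4
    rw [← h5]; group

theorem m_conj (h : Flip P i o y σ z χ β m κ t c) {k : G} (hk : k ∈ twoStab G i o) :
    m (t * k * t) * star (m k) = 1 := by
  have hmul : ∀ k ∈ twoStab G i o, ∀ l ∈ twoStab G i o, m (t * k * t) * star (m k) = 1 →
      m (t * l * t) * star (m l) = 1 → m (t * (k * l) * t) * star (m (k * l)) = 1 := by
    intro k hk l hl h1 h2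
    have h3 : t * (k * l) * t = (t * k * t) * (t * l * t) := by
      calc t * (k * l) * t = t * k * 1 * l * t := by group
        _ = _ := by rw [← h.t_mul]; group
    rw [h3, h.m_mul (h.conj_mem hk) (h.conj_mem hl), h.m_mul hk hl, star_mul']
    calc _ = (m (t * k * t) * star (m k)) * (m (t * l * t) * star (m l)) := by ring
      _ = 1 := by rw [h1, h2, mul_one]
  have hσ : m (t * σ * t) * star (m σ) = 1 := by
    have h1 := h.conj_s h.t_i h.t_o
    rw [h.t_inv] at h1
    rw [h.m_s_star, h1, ← h.m_mul (inv_mem h.s_mem) h.s_mem, inv_mul_cancel, h.m_one]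
  have hκ : m (t * κ * t) * star (m κ) = 1 := by
    rw [h.conj_ka, h.m_mul h.y_mem h.ka_mem, h.m_y, neg_one_mul, neg_mul,
      ← QuadraticAlgebra.algebraMap_norm_eq_mul_star, ← h.chi_eq h.ka_mem, h.chi_ka, map_neg,
      map_one, neg_neg]
  have hg := h.gen k hk
  rw [← mem_powers_iff_mem_zpowers] at hg
  obtain ⟨n, rfl⟩ := hg
  have hσκ := mul_mem h.s_mem h.ka_mem
  induction n with
  | zero =>
    change m (t * (σ * κ) ^ 0 * t) * star (m ((σ * κ) ^ 0)) = 1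
    rw [pow_zero, mul_one, h.t_mul, h.m_one, star_one, mul_one]
  | succ n ih =>
    change m (t * (σ * κ) ^ (n + 1) * t) * star (m ((σ * κ) ^ (n + 1))) = 1
    rw [pow_succ]
    exact hmul _ (pow_mem hσκ n) _ hσκ (ih (pow_mem hσκ n)) (hmul _ h.s_mem _ h.ka_mem hσ hκ)

end Flip

/-- The point with coordinates `(v, s)`. -/
def hpt {G Ω : Type*} [Group G] [MulAction G Ω] (o : Ω) (z : ZMod 47 → G) (β : F47 → G) (v : F47)
    (s : ZMod 47) : Ω := (β v * z s) • o

/-- The element of the stabilizer of two points which occurs in the Bruhat decomposition of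
`t * z s * t`. -/
def gam {G : Type*} [Group G] (z : ZMod 47 → G) (t : G) (c s : ZMod 47) : G :=
  z (-(c / s)) * t * z s * t * z (-(c / s)) * t

namespace Coord

open Setting OD.Frame

variable {G Ω : Type*} [Group G] [Finite G] [MulAction G Ω] {P : Ω → Subgroup G} {i o : Ω}
  {y σ : G} {z : ZMod 47 → G} {χ : G → ZMod 47} {β : F47 → G} {m : G → F47} {κ : G}

theorem hpt_inj (h : Coord P i o y σ z χ β m κ) {v v' : F47} {s s' : ZMod 47}
    (e : hpt o z β v s = hpt o z β v' s') : v = v' ∧ s = s' := by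
  obtain ⟨h1, h2⟩ := h.mul_z_smul_inj (h.b_mem v) (h.b_mem v') e
  exact ⟨h.b_inj h1, h2⟩

theorem exists_hpt (h : Coord P i o y σ z χ β m κ) {x : Ω} (hx : x ≠ i) :
    ∃ v s, x = hpt o z β v s := by
  obtain ⟨b, hb, a, rfl⟩ := h.exists_smul_eq_of_ne hx
  obtain ⟨v, rfl⟩ := h.b_surj b hb
  exact ⟨v, a, rfl⟩

theorem mul_mem_P (h : Coord P i o y σ z χ β m κ) (v : F47) (s : ZMod 47) : β v * z s ∈ P i :=
  mul_mem (h.b_mem v).1 (h.z_mem s)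

theorem hpt_ne (h : Coord P i o y σ z χ β m κ) (v : F47) (s : ZMod 47) : hpt o z β v s ≠ i :=
  h.smul_ne h.ne (h.mul_mem_P v s)

theorem hpt_zero (h : Coord P i o y σ z χ β m κ) (s : ZMod 47) : hpt o z β 0 s = z s • o := by
  rw [hpt, h.b_zero, one_mul]

theorem hpt_b (h : Coord P i o y σ z χ β m κ) (v : F47) : hpt o z β v 0 = β v • o := by
  rw [hpt, h.z_zero, mul_one]

theorem smul_hpt (h : Coord P i o y σ z χ β m κ) {k : G} (hk : k ∈ twoStab G i o) (v : F47)
    (s : ZMod 47) : k • hpt o z β v s = hpt o z β (m k * v) ((m k).norm * s) := by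
  rw [hpt, h.smul_mul_z hk, h.conj_b k hk, h.chi_eq hk, hpt]

theorem b_hpt (h : Coord P i o y σ z χ β m κ) (v v' : F47) (s : ZMod 47) :
    β v • hpt o z β v' s = hpt o z β (v + v') ((star v * v').im + s) := by
  rw [hpt, hpt, ← mul_smul, ← mul_assoc, h.b_mul, mul_assoc, ← h.z_add]

theorem z_hpt (h : Coord P i o y σ z χ β m κ) (a : ZMod 47) (v : F47) (s : ZMod 47) :
    z a • hpt o z β v s = hpt o z β v (a + s) := by
  rw [hpt, hpt, ← mul_smul, ← mul_assoc, ← h.z_central (h.b_mem v).1, mul_assoc, ← h.z_add]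

theorem exists_chi (h : Coord P i o y σ z χ β m κ) {a : ZMod 47} (ha : a ≠ 0) :
    ∃ k ∈ twoStab G i o, χ k = a := by
  rcases pow_23_eq ha with h1 | h1
  · exact h.exists_chi_eq h1
  · obtain ⟨k, hk, hka⟩ := h.exists_chi_eq (a := -a) (by
      rw [Odd.neg_pow (by decide), h1, neg_neg])
    exact ⟨k * κ, mul_mem hk h.ka_mem, by rw [h.chi_mul hk h.ka_mem, hka, h.chi_ka]; ring⟩

end Coord

namespace Flip

open Setting OD.Frame

variable {G Ω : Type*} [Group G] [Finite G] [MulAction G Ω] {P : Ω → Subgroup G} {i o : Ω}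
  {y σ : G} {z : ZMod 47 → G} {χ : G → ZMod 47} {β : F47 → G} {m : G → F47} {κ t : G}
  {c : ZMod 47}

theorem star_m_ne (h : Flip P i o y σ z χ β m κ t c) {k : G} (hk : k ∈ twoStab G i o) :
    star (m k) ≠ 0 := fun e => by
  have := h.m_conj hk
  rw [e, mul_zero] at this
  exact zero_ne_one this

theorem m_conj_eq (h : Flip P i o y σ z χ β m κ t c) {k : G} (hk : k ∈ twoStab G i o) :
    m (t * k * t) = (star (m k))⁻¹ := eq_inv_of_mul_eq_one_left (h.m_conj hk)

theorem m_inv (h : Flip P i o y σ z χ β m κ t c) {k : G} (hk : k ∈ twoStab G i o) :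
    m k⁻¹ = (m k)⁻¹ := eq_inv_of_mul_eq_one_left (by
      rw [← h.m_mul (inv_mem hk) hk, inv_mul_cancel, h.m_one])

theorem t_smul (h : Flip P i o y σ z χ β m κ t c) (k : G) (x : Ω) :
    t • k • x = (t * k * t) • t • x := by
  rw [mul_smul, h.smul_smul_t, mul_smul]

theorem mul_t_mul_t (h : Flip P i o y σ z χ β m κ t c) (x : G) : t * (t * x) = x := by
  rw [← mul_assoc, h.t_mul, one_mul]

theorem t_hpt_zero (h : Flip P i o y σ z χ β m κ t c) {s : ZMod 47} (hs : s ≠ 0) :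
    t • hpt o z β 0 s = hpt o z β 0 (c / s) := by
  rw [h.hpt_zero, h.hpt_zero, h.t_z s hs]

theorem exists_t_b (h : Flip P i o y σ z χ β m κ t c) {v : F47} (hv : v ≠ 0) :
    ∃ r : ZMod 47, r ≠ 0 ∧ t • hpt o z β v 0 = hpt o z β (algebraMap (ZMod 47) F47 r * v) 0 := by
  have hb := h.b_mem v
  have hb1 := h.b_ne_one hv
  have hm := h.b_moved hb hb1
  obtain ⟨h4, h5, h6, -⟩ := h.tau_spec hm
  obtain ⟨h7, h8⟩ := h.tau_b_swap hb hb1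
  generalize tau y (β v • o) = t' at *
  have hγ : t * t' ∈ twoStab G i o :=
    ⟨by change _ • i = i; rw [mul_smul, h7, h.t_o], by change _ • o = o; rw [mul_smul, h8, h.t_i]⟩
  have h9 : t * (t * t') * t * (t * t') = 1 := by
    rw [h.mul_t_mul_t, mul_assoc, h.mul_t_mul_t, h4]
  have h10 := congrArg m h9
  rw [h.m_mul (h.conj_mem hγ) hγ, h.m_conj_eq hγ, h.m_one,
    inv_mul_eq_one₀ (h.star_m_ne hγ)] at h10
  have h11 : (m (t * t')).im = 0 := by
    have := congrArg QuadraticAlgebra.im h10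
    simp only [QuadraticAlgebra.im_star] at this
    generalize (m (t * t')).im = w at this
    revert w; decide
  have h12 : m (t * t') = algebraMap (ZMod 47) F47 (m (t * t')).re := by
    ext
    · rw [QuadraticAlgebra.algebraMap_re]
    · rw [QuadraticAlgebra.algebraMap_im, h11]
  refine ⟨(m (t * t')).re, fun e => h.m_ne_zero hγ ?_, ?_⟩
  · rw [h12, e, map_zero]
  · have : t • hpt o z β v 0 = (t * t') • hpt o z β v 0 := by
      rw [mul_smul, h.hpt_b, h6]
    rw [this, h.smul_hpt hγ, mul_zero, ← h12]

theorem gam_mem (h : Flip P i o y σ z χ β m κ t c) {s : ZMod 47} (hs : s ≠ 0) :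
    gam z t c s ∈ twoStab G i o := by
  have hc := h.c_ne_zero
  constructor
  · change _ • i = i
    simp only [gam, mul_smul]
    rw [h.t_i, h.t_z _ (neg_ne_zero.2 (div_ne_zero hc hs)), h.z_smul_smul,
      show s + c / -(c / s) = 0 by field_simp; ring, h.z_zero_smul, h.t_o, h.z_smul_i]
  · change _ • o = o
    simp only [gam, mul_smul]
    rw [h.t_o, h.z_smul_i, h.t_i, h.t_z _ hs, h.z_smul_smul, neg_add_cancel, h.z_zero_smul]

theorem t_z_t (h : Flip P i o y σ z χ β m κ t c) (s : ZMod 47) :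
    t * z s * t = z (c / s) * gam z t c s * t * z (c / s) := by
  rw [gam, h.z_neg]
  calc t * z s * t = z (c / s) * (z (c / s))⁻¹ * t * z s * t * (z (c / s))⁻¹ * z (c / s) := by group
    _ = z (c / s) * (z (c / s))⁻¹ * t * z s * t * (z (c / s))⁻¹ * (t * (t * z (c / s))) := by
      rw [h.mul_t_mul_t]
    _ = _ := by simp only [mul_assoc]

theorem gam_neg (h : Flip P i o y σ z χ β m κ t c) (s : ZMod 47) :
    gam z t c (-s) = t * (gam z t c s)⁻¹ * t := by
  simp only [gam, div_neg, h.z_neg, mul_inv_rev, h.t_inv, inv_inv, mul_assoc, h.mul_t_mul_t]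

theorem gam_conj (h : Flip P i o y σ z χ β m κ t c) {k : G} (hk : k ∈ twoStab G i o)
    (s : ZMod 47) : gam z t c (χ k * s) = (t * k * t) * gam z t c s * k⁻¹ := by
  have h1 : ∀ a, z (χ k * a) = k * z a * k⁻¹ := fun a => (h.conj_z k hk a).symm
  have h2 : z (-(c / (χ k * s))) = t * k * t * z (-(c / s)) * (t * k⁻¹ * t) := by
    have h3 : (t * k * t)⁻¹ = t * k⁻¹ * t := by
      simp only [mul_inv_rev, h.t_inv, mul_assoc]
    rw [← h3, h.conj_z _ (h.conj_mem hk), h.chi_conj hk]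
    congr 1
    have := h.chi_ne_zero hk
    field_simp
  simp only [gam, h1, h2, mul_assoc, h.mul_t_mul_t, inv_mul_cancel_left, h.t_mul, mul_one]

theorem m_gam_mul (h : Flip P i o y σ z χ β m κ t c) {a s : ZMod 47} (ha : a ≠ 0) (hs : s ≠ 0) :
    algebraMap (ZMod 47) F47 a * m (gam z t c (a * s)) = m (gam z t c s) := by
  obtain ⟨k, hk, rfl⟩ := h.exists_chi ha
  have hg := h.gam_mem hs
  rw [h.gam_conj hk, h.m_mul (mul_mem (h.conj_mem hk) hg) (inv_mem hk), h.m_mul (h.conj_mem hk) hg,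
    h.m_conj_eq hk, h.m_inv hk, h.chi_eq hk, QuadraticAlgebra.algebraMap_norm_eq_mul_star]
  have h1 := h.m_ne_zero hk
  have h2 := h.star_m_ne hk
  field_simp

theorem exists_m_gam (h : Flip P i o y σ z χ β m κ t c) : ∃ g : ZMod 47, g ≠ 0 ∧ c = -g ^ 2 ∧
    ∀ s ≠ 0, m (gam z t c s) = ⟨0, g / s⟩ := by
  have hg := h.gam_mem one_ne_zero
  have h1 : m (gam z t c (-1)) = star (m (gam z t c 1)) := by
    rw [h.gam_neg, h.m_conj_eq (inv_mem hg), h.m_inv hg, star_inv₀, inv_inv]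
  have h2 := h.m_gam_mul (a := -1) (s := 1) (by decide) one_ne_zero
  rw [mul_one, h1] at h2
  have h3 : (m (gam z t c 1)).re = 0 := by
    have := congrArg QuadraticAlgebra.re h2
    simp only [map_neg, map_one, neg_mul, one_mul, QuadraticAlgebra.re_neg,
      QuadraticAlgebra.re_star, zero_mul, add_zero] at this
    generalize (m (gam z t c 1)).re = w at this
    revert w; decide
  have h4 : ∀ s ≠ 0, m (gam z t c s) = ⟨0, (m (gam z t c 1)).im / s⟩ := by
    intro s hs
    have h5 := h.m_gam_mul hs one_ne_zero
    rw [mul_one] at h5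
    rw [← h5] at h3 ⊢
    have h6 := congrArg QuadraticAlgebra.re h5
    ext
    · simp at h3 ⊢
      exact h3.resolve_left hs
    · simp [hs]
  have hn : (m (gam z t c 1)).norm = -c := by
    have h5 := congrArg (fun x : G => x • o) (h.t_z_t 1)
    simp only [mul_smul] at h5
    rw [h.t_o, h.z_smul_i, h.t_i, h.t_z _ (div_ne_zero h.c_ne_zero one_ne_zero),
      h.smul_z_smul hg, h.z_smul_smul, h.chi_eq hg] at h5
    have h6 := h.z_smul_inj ((h.z_zero_smul o).trans h5)
    have := h.c_ne_zero
    field_simp at h6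
    linear_combination -h6
  rw [norm_eq, h3] at hn
  refine ⟨_, fun e => h.m_ne_zero hg ?_, by linear_combination hn, h4⟩
  ext
  · exact h3
  · exact e

end Flip

/-- The Hermitian form expression attached to the point `(v, s)`. -/
def wt (v : F47) (s : ZMod 47) : F47 := ⟨v.norm, 2 * s⟩

theorem wt_eq (v : F47) (s : ZMod 47) :
    wt v s = algebraMap (ZMod 47) F47 v.norm + ⟨0, 2 * s⟩ := by
  ext <;> simp [wt]

namespace Flip

open Setting OD.Frame

variable {G Ω : Type*} [Group G] [Finite G] [MulAction G Ω] {P : Ω → Subgroup G} {i o : Ω}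
  {y σ : G} {z : ZMod 47 → G} {χ : G → ZMod 47} {β : F47 → G} {m : G → F47} {κ t : G}
  {c : ZMod 47}

theorem t_b_t (h : Flip P i o y σ z χ β m κ t c) {v : F47} (hv : v ≠ 0) {r : ZMod 47}
    (hr : t • hpt o z β v 0 = hpt o z β (algebraMap (ZMod 47) F47 r * v) 0) :
    ∃ k ∈ twoStab G i o, m k = -algebraMap (ZMod 47) F47 r ∧
      t * β v * t = β (algebraMap (ZMod 47) F47 r * v) * k * t *
        β (algebraMap (ZMod 47) F47 r * v) := by
  obtain ⟨u, hu⟩ : ∃ u, u = algebraMap (ZMod 47) F47 r * v := ⟨_, rfl⟩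
  rw [← hu] at hr ⊢
  have hy : ∀ x, y • hpt o z β x 0 = hpt o z β (-x) 0 := fun x => by
    rw [h.smul_hpt h.y_mem, h.m_y, neg_one_mul, mul_zero]
  have hr' : t • hpt o z β u 0 = hpt o z β v 0 := by rw [← hr, h.smul_smul_t]
  have hneg : t • β (-u) • o = β (-v) • o := by
    rw [← h.hpt_b, ← h.hpt_b, ← hy, ← mul_smul, h.t_y, mul_smul, hr', hy]
  obtain ⟨k, hk⟩ : ∃ k, k = β (-u) * t * β v * t * β (-u) * t := ⟨_, rfl⟩
  have hkK : k ∈ twoStab G i o := by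
    constructor
    · change k • i = i
      simp only [hk, mul_smul]
      rw [h.t_i, hneg, h.b_neg v, smul_inv_smul, h.t_o, h.fix i _ (h.b_mem _).1]
    · change k • o = o
      simp only [hk, mul_smul]
      rw [h.t_o, h.fix i _ (h.b_mem _).1, h.t_i, ← h.hpt_b v, hr, h.hpt_b, h.b_neg, inv_smul_smul]
  have e : t * β v * t = β u * k * t * β u := by
    rw [hk, h.b_neg]
    simp only [mul_assoc, h.mul_t_mul_t, inv_mul_cancel, mul_one, mul_inv_cancel_left]
  refine ⟨k, hkK, ?_, e⟩
  have h1 := congrArg (fun x : G => x • o) e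
  simp only [mul_smul] at h1
  rw [h.t_o, h.fix i _ (h.b_mem _).1, h.t_i, ← h.hpt_b u, hr', h.smul_hpt hkK, h.b_hpt] at h1
  have h2 : hpt o z β 0 0 = hpt o z β (u + m k * v) ((star u * (m k * v)).im + (m k).norm * 0) := by
    rw [← h1, h.hpt_zero, h.z_zero_smul]
  have h3 := (h.hpt_inj h2).1
  rw [hu, ← add_mul] at h3
  have h4 := (mul_eq_zero.1 h3.symm).resolve_right hv
  exact eq_neg_of_add_eq_zero_right h4

theorem hpt_eq_of_t_eq (h : Flip P i o y σ z χ β m κ t c) {v : F47} {s : ZMod 47}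
    (e : t • hpt o z β v s = i) : v = 0 ∧ s = 0 := by
  refine h.hpt_inj (o := o) ?_
  calc hpt o z β v s = t • t • hpt o z β v s := (h.smul_smul_t _).symm
    _ = o := by rw [e, h.t_i]
    _ = hpt o z β 0 0 := by rw [h.hpt_zero, h.z_zero_smul]

theorem t_hpt_aux (h : Flip P i o y σ z χ β m κ t c) {g : ZMod 47}
    (hg : ∀ s ≠ 0, m (gam z t c s) = ⟨0, g / s⟩) {v : F47} (hv : v ≠ 0) {r s : ZMod 47}
    (hr : t • hpt o z β v 0 = hpt o z β (algebraMap (ZMod 47) F47 r * v) 0) (hs : s ≠ 0) :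
    ∃ F' U', t • hpt o z β v s = hpt o z β (⟨0, g / s⟩ * F') (c / s + (g / s) ^ 2 * U') ∧
      ⟨0, g / s⟩ * F' = algebraMap (ZMod 47) F47 r * (v - F') ∧
      c / s + (g / s) ^ 2 * U' = r ^ 2 * (U' - (star v * F').im) := by
  obtain ⟨k, hk, hmk, hkt⟩ := h.t_b_t hv hr
  have hgK := h.gam_mem hs
  have ha : c / s ≠ 0 := div_ne_zero h.c_ne_zero hs
  obtain ⟨F', U', hFU⟩ : ∃ F' U',
      t • hpt o z β (algebraMap (ZMod 47) F47 r * v) (c / s) = hpt o z β F' U' := by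
    exact h.exists_hpt fun e => ha (h.hpt_eq_of_t_eq e).2
  have e1 : t • hpt o z β v s = hpt o z β (⟨0, g / s⟩ * F') (c / s + (g / s) ^ 2 * U') := by
    have h1 : hpt o z β v s = z s • hpt o z β v 0 := by rw [h.z_hpt, add_zero]
    rw [h1, h.t_smul, hr, h.t_z_t, mul_smul, mul_smul, mul_smul, h.z_hpt, add_zero, hFU,
      h.smul_hpt hgK, h.z_hpt, hg s hs, norm_eq]
    simp
  refine ⟨F', U', e1, ?_⟩
  have e2 : t • hpt o z β v s = hpt o z β (algebraMap (ZMod 47) F47 r * (v - F'))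
      (r ^ 2 * (U' - (star v * F').im)) := by
    have h1 : hpt o z β v s = β v • hpt o z β 0 s := by
      rw [h.b_hpt, add_zero, mul_zero, QuadraticAlgebra.im_zero, zero_add]
    rw [h1, h.t_smul, h.t_hpt_zero hs, hkt, mul_smul, mul_smul, mul_smul, h.b_hpt, add_zero,
      mul_zero, QuadraticAlgebra.im_zero, zero_add, hFU, h.smul_hpt hk, h.b_hpt, hmk]
    congr 1
    · ring
    · rw [im_star_mul, im_star_mul, norm_eq]
      simp
      ring
  exact h.hpt_inj (e1.symm.trans e2)

theorem t_hpt_b_aux (h : Flip P i o y σ z χ β m κ t c) {g : ZMod 47} (hg0 : g ≠ 0)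
    (hc : c = -g ^ 2) (hg : ∀ s ≠ 0, m (gam z t c s) = ⟨0, g / s⟩) {v : F47} (hv : v ≠ 0)
    {r : ZMod 47} (hr0 : r ≠ 0)
    (hr : t • hpt o z β v 0 = hpt o z β (algebraMap (ZMod 47) F47 r * v) 0) :
    r * v.norm = -2 * g := by
  obtain ⟨F', U', -, h1, h2⟩ := h.t_hpt_aux hg hv hr (div_ne_zero hg0 hr0)
  rw [div_div_cancel₀ hg0] at h1 h2
  have h3 := congrArg QuadraticAlgebra.re h1
  have h4 := congrArg QuadraticAlgebra.im h1
  simp at h3 h4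
  have h5 : v.re = F'.re - F'.im := mul_left_cancel₀ hr0 (by linear_combination -h3)
  have h6 : v.im = F'.re + F'.im := by linear_combination -h4.resolve_right hr0
  rw [im_star_mul, hc, h5, h6, div_div_eq_mul_div] at h2
  field_simp at h2
  rw [norm_eq, h5, h6]
  linear_combination -2 * h2

theorem exists_g (h : Flip P i o y σ z χ β m κ t c) : c = -(1 / 4) ∧
    (∀ s ≠ 0, m (gam z t c s) = ⟨0, -(1 / 2) / s⟩) ∧
    ∀ v ≠ 0, t • hpt o z β v 0 = hpt o z β (algebraMap (ZMod 47) F47 (v.norm)⁻¹ * v) 0 := by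
  have h2' : (2 : ZMod 47) ≠ 0 := by decide
  have h4' : (4 : ZMod 47) = 2 * 2 := by decide
  obtain ⟨g, hg0, hc, hg⟩ := h.exists_m_gam
  have h1 := h.t_hpt_b_aux hg0 hc hg (one_ne_zero (α := F47)) one_ne_zero (by
    rw [map_one, mul_one, h.hpt_b, h.t_b])
  rw [map_one, mul_one] at h1
  have h2 : g = -(1 / 2) := by
    rw [neg_mul, eq_neg_iff_add_eq_zero] at h1
    field_simp
    linear_combination h1
  refine ⟨by rw [hc, h2, h4']; field_simp, by rw [← h2]; exact hg, fun v hv => ?_⟩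
  obtain ⟨r, hr0, hr⟩ := h.exists_t_b hv
  have h3 := h.t_hpt_b_aux hg0 hc hg hv hr0 hr
  rw [← h1] at h3
  rw [hr, eq_inv_of_mul_eq_one_left h3]

theorem wt_mul (h : Flip P i o y σ z χ β m κ t c) {v F : F47} {s U : ZMod 47} (hv : v ≠ 0)
    (e : t • hpt o z β v s = hpt o z β F U) : wt v s * F = v := by
  obtain ⟨-, hg, hr⟩ := h.exists_g
  have hN : v.norm ≠ 0 := fun e => hv (QuadraticAlgebra.norm_eq_zero_iff_eq_zero.1 e)
  have hN' : algebraMap (ZMod 47) F47 v.norm * algebraMap (ZMod 47) F47 (v.norm)⁻¹ = 1 := by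
    rw [← map_mul, mul_inv_cancel₀ hN, map_one]
  rw [wt_eq]
  by_cases hs : s = 0
  · subst hs
    rw [hr v hv] at e
    rw [← (h.hpt_inj e).1, mul_zero, show (⟨0, 0⟩ : F47) = 0 from rfl, add_zero, ← mul_assoc, hN',
      one_mul]
  · obtain ⟨F', U', h1, h2, -⟩ := h.t_hpt_aux hg hv (hr v hv) hs
    rw [e] at h1
    rw [(h.hpt_inj h1).1]
    have h3 : (⟨0, 2 * s⟩ : F47) * ⟨0, -(1 / 2) / s⟩ = 1 := by
      have h2 : (2 : ZMod 47) ≠ 0 := by decide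
      ext
      · simp [QuadraticAlgebra.re_one]
        field_simp
      · simp [QuadraticAlgebra.im_one]
    rw [add_mul, ← mul_assoc (⟨0, 2 * s⟩ : F47), h3, one_mul, h2, ← mul_assoc, hN', one_mul,
      sub_add_cancel]

theorem t_hpt (h : Flip P i o y σ z χ β m κ t c) {v : F47} {s : ZMod 47}
    (hvs : ¬(v = 0 ∧ s = 0)) :
    t • hpt o z β v s = hpt o z β (v / wt v s) (((wt v s)⁻¹).im / 2) := by
  have h2 : (2 : ZMod 47) ≠ 0 := by decide
  by_cases hv : v = 0
  · subst hv
    have hs : s ≠ 0 := fun e => hvs ⟨rfl, e⟩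
    have h3 : wt 0 s * ⟨0, -(1 / 2) / s⟩ = 1 := by
      rw [wt, QuadraticAlgebra.norm_zero]
      ext
      · simp [QuadraticAlgebra.re_one]
        field_simp
      · simp [QuadraticAlgebra.im_one]
    rw [h.t_hpt_zero hs, zero_div, inv_eq_of_mul_eq_one_right h3, h.exists_g.1]
    congr 1
    have h4 : (4 : ZMod 47) = 2 * 2 := by decide
    rw [h4]
    field_simp
  · obtain ⟨F, U, e⟩ := h.exists_hpt (x := t • hpt o z β v s) fun e =>
      hvs (h.hpt_eq_of_t_eq e)
    have h3 := h.wt_mul hv e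
    have hF : F ≠ 0 := fun hF => hv (by rw [← h3, hF, mul_zero])
    have hw : wt v s ≠ 0 := fun hw => hv (by rw [← h3, hw, zero_mul])
    have h4 := h.wt_mul (F := v) (U := s) hF (by rw [← e, h.smul_smul_t])
    have h5 : (wt v s)⁻¹ = wt F U := by
      refine inv_eq_of_mul_eq_one_right (mul_right_cancel₀ hF ?_)
      rw [mul_right_comm, h3, mul_comm, h4, one_mul]
    have h6 : F = v / wt v s := eq_div_of_mul_eq hw (by rw [mul_comm, h3])
    have h7 : (wt F U).im / 2 = U := mul_div_cancel_left₀ _ h2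
    rw [e, h5, h7, ← h6]

end Flip

/-- The elements `g` and `g'` act in the same way on the points labelled by `e` and `e'`. -/
def Corr {G H Ω Ω' M : Type*} [Group G] [Group H] [MulAction G Ω] [MulAction H Ω'] (e : M → Ω)
    (e' : M → Ω') (g : G) (g' : H) : Prop :=
  ∀ x, ∃ x', g • e x = e x' ∧ g' • e' x = e' x'

section Corr

variable {G H Ω Ω' M : Type*} [Group G] [Group H] [MulAction G Ω] [MulAction H Ω'] {e : M → Ω}
  {e' : M → Ω'}

theorem Corr.symm {g : G} {g' : H} (h : Corr e e' g g') : Corr e' e g' g := fun x => by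
  obtain ⟨x', h1, h2⟩ := h x
  exact ⟨x', h2, h1⟩

theorem Corr.mul {a b : G} {a' b' : H} (ha : Corr e e' a a') (hb : Corr e e' b b') :
    Corr e e' (a * b) (a' * b') := fun x => by
  obtain ⟨x', h1, h2⟩ := hb x
  obtain ⟨x'', h3, h4⟩ := ha x'
  exact ⟨x'', by rw [mul_smul, h1, h3], by rw [mul_smul, h2, h4]⟩

theorem Corr.unique (he : Function.Injective e) (he' : Function.Surjective e')
    (hH : ∀ g : H, (∀ x : Ω', g • x = x) → g = 1) {g : G} {a b : H} (ha : Corr e e' g a)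
    (hb : Corr e e' g b) : a = b := by
  refine inv_mul_eq_one.1 (hH _ fun w => ?_)
  obtain ⟨x, rfl⟩ := he' w
  obtain ⟨x₁, h1, h2⟩ := ha x
  obtain ⟨x₂, h3, h4⟩ := hb x
  rw [mul_smul, inv_smul_eq_iff, h2, h4, he (h1.symm.trans h3)]

theorem nonempty_mulEquiv_of_corr (he : Function.Bijective e) (he' : Function.Bijective e')
    (hG : ∀ g : G, (∀ x : Ω, g • x = x) → g = 1) (hH : ∀ g : H, (∀ x : Ω', g • x = x) → g = 1)
    (h : ∀ g : G, ∃ g' : H, Corr e e' g g')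
    (h' : ∀ g' : H, ∃ g : G, Corr e' e g' g) : Nonempty (G ≃* H) := by
  choose f hf using h
  choose f' hf' using h'
  exact ⟨{
    toFun := f
    invFun := f'
    left_inv := fun g => Corr.unique he'.1 he.2 hG (hf' (f g)) (hf g).symm
    right_inv := fun g => Corr.unique he.1 he'.2 hH (hf (f' g)) (hf' g).symm
    map_mul' := fun a b => Corr.unique he.1 he'.2 hH (hf (a * b)) ((hf a).mul (hf b)) }⟩

end Corr

/-- The labelling of all points by coordinates, `none` being the label of `i`. -/
def pt {G Ω : Type*} [Group G] [MulAction G Ω] (i o : Ω) (z : ZMod 47 → G) (β : F47 → G) :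
    Option (F47 × ZMod 47) → Ω
  | none => i
  | some p => hpt o z β p.1 p.2

namespace Flip

open Setting OD.Frame

variable {G Ω : Type*} [Group G] [Finite G] [MulAction G Ω] {P : Ω → Subgroup G} {i o : Ω}
  {y σ : G} {z : ZMod 47 → G} {χ : G → ZMod 47} {β : F47 → G} {m : G → F47} {κ t : G}
  {c : ZMod 47}
variable {H Ω' : Type*} [Group H] [Finite H] [MulAction H Ω'] {P' : Ω' → Subgroup H} {i' o' : Ω'}
  {y' σ' : H} {z' : ZMod 47 → H} {χ' : H → ZMod 47} {β' : F47 → H} {m' : H → F47} {κ' t' : H}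
  {c' : ZMod 47}

theorem pt_bijective (h : Flip P i o y σ z χ β m κ t c) : Function.Bijective (pt i o z β) := by
  constructor
  · rintro (_ | ⟨v, s⟩) (_ | ⟨v', s'⟩) e
    · rfl
    · exact (h.hpt_ne v' s' e.symm).elim
    · exact (h.hpt_ne v s e).elim
    · obtain ⟨rfl, rfl⟩ := h.hpt_inj e
      rfl
  · intro x
    by_cases hx : x = i
    · exact ⟨none, hx.symm⟩
    · obtain ⟨v, s, e⟩ := h.exists_hpt hx
      exact ⟨some (v, s), e.symm⟩

theorem corr_mul (h : Flip P i o y σ z χ β m κ t c) (h' : Flip P' i' o' y' σ' z' χ' β' m' κ' t' c')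
    (v : F47) (s : ZMod 47) :
    Corr (pt i o z β) (pt i' o' z' β') (β v * z s) (β' v * z' s) := by
  rintro (_ | ⟨w, r⟩)
  · exact ⟨none, h.fix i _ (h.mul_mem_P v s), h'.fix i' _ (h'.mul_mem_P v s)⟩
  · refine ⟨some (v + w, (star v * w).im + (s + r)), ?_, ?_⟩
    · change _ • hpt o z β w r = hpt o z β _ _
      rw [mul_smul, h.z_hpt, h.b_hpt]
    · change _ • hpt o' z' β' w r = hpt o' z' β' _ _
      rw [mul_smul, h'.z_hpt, h'.b_hpt]

theorem corr_of_m_eq (h : Flip P i o y σ z χ β m κ t c)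
    (h' : Flip P' i' o' y' σ' z' χ' β' m' κ' t' c') {k : G} {k' : H} (hk : k ∈ twoStab G i o)
    (hk' : k' ∈ twoStab H i' o') (e : m' k' = m k) :
    Corr (pt i o z β) (pt i' o' z' β') k k' := by
  rintro (_ | ⟨w, r⟩)
  · exact ⟨none, hk.1, hk'.1⟩
  · refine ⟨some (m k * w, (m k).norm * r), h.smul_hpt hk w r, ?_⟩
    change _ • hpt o' z' β' w r = hpt o' z' β' _ _
    rw [h'.smul_hpt hk', e]

theorem t_i_eq (h : Flip P i o y σ z χ β m κ t c) : t • i = hpt o z β 0 0 := by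
  rw [h.hpt_zero, h.z_zero_smul, h.t_i]

theorem t_hpt_zero_zero (h : Flip P i o y σ z χ β m κ t c) : t • hpt o z β 0 0 = i := by
  rw [h.hpt_zero, h.z_zero_smul, h.t_o]

theorem corr_t (h : Flip P i o y σ z χ β m κ t c)
    (h' : Flip P' i' o' y' σ' z' χ' β' m' κ' t' c') :
    Corr (pt i o z β) (pt i' o' z' β') t t' := by
  rintro (_ | ⟨w, r⟩)
  · exact ⟨some (0, 0), h.t_i_eq, h'.t_i_eq⟩
  · by_cases hw : w = 0 ∧ r = 0
    · obtain ⟨rfl, rfl⟩ := hw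
      exact ⟨none, h.t_hpt_zero_zero, h'.t_hpt_zero_zero⟩
    · exact ⟨some (w / wt w r, ((wt w r)⁻¹).im / 2), h.t_hpt hw, h'.t_hpt hw⟩

theorem exists_corr_of_smul_eq (h : Flip P i o y σ z χ β m κ t c)
    (h' : Flip P' i' o' y' σ' z' χ' β' m' κ' t' c') {g : G} (hg : g • i = i) :
    ∃ g' : H, Corr (pt i o z β) (pt i' o' z' β') g g' := by
  have hgo : g • o ≠ i := fun e => h.ne (smul_left_cancel g (hg.trans e.symm))
  obtain ⟨v, s, hvs⟩ := h.exists_hpt hgo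
  have hk : (β v * z s)⁻¹ * g ∈ twoStab G i o := by
    constructor
    · change _ • i = i
      rw [mul_smul, hg, h.fix i _ (inv_mem (h.mul_mem_P v s))]
    · change _ • o = o
      rw [mul_smul, hvs, hpt, inv_smul_smul]
  obtain ⟨k', hk', e⟩ := h'.exists_m_eq (h.m_pow_736 hk)
  refine ⟨β' v * z' s * k', ?_⟩
  have := (h.corr_mul h' v s).mul (h.corr_of_m_eq h' hk hk' e)
  rwa [mul_inv_cancel_left] at this

theorem exists_corr (h : Flip P i o y σ z χ β m κ t c)
    (h' : Flip P' i' o' y' σ' z' χ' β' m' κ' t' c') (g : G) :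
    ∃ g' : H, Corr (pt i o z β) (pt i' o' z' β') g g' := by
  by_cases hg : g • i = i
  · exact h.exists_corr_of_smul_eq h' hg
  · obtain ⟨v, s, hvs⟩ := h.exists_hpt hg
    obtain ⟨g', hg'⟩ := h.exists_corr_of_smul_eq h' (g := t * (β v * z s)⁻¹ * g) (by
      rw [mul_smul, mul_smul, hvs, hpt, inv_smul_smul, h.t_o])
    have := ((h.corr_mul h' v s).mul (h.corr_t h')).mul hg'
    rw [show β v * z s * t * (t * (β v * z s)⁻¹ * g) =
      β v * z s * (t * t) * (β v * z s)⁻¹ * g by group, h.t_mul, mul_one, mul_inv_cancel,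
      one_mul] at this
    exact ⟨_, this⟩

theorem nonempty_mulEquiv (h : Flip P i o y σ z χ β m κ t c)
    (h' : Flip P' i' o' y' σ' z' χ' β' m' κ' t' c') : Nonempty (G ≃* H) :=
  nonempty_mulEquiv_of_corr h.pt_bijective h'.pt_bijective h.faithful h'.faithful (h.exists_corr h')
    (h'.exists_corr h)

end Flip

theorem HasPattern.nonempty_mulEquiv {G H : Type*} [Group G] [Finite G] [Group H] [Finite H]
    (hG : HasPattern G) (hH : HasPattern H) : Nonempty (G ≃* H) := by
  obtain ⟨_, _, _, _, _, _, _, _, _, h⟩ := Frame.exists_coord hG.setting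
  obtain ⟨_, _, _, _, _, _, _, _, _, h'⟩ := Frame.exists_coord hH.setting
  obtain ⟨_, _, h⟩ := h.exists_flip
  obtain ⟨_, _, h'⟩ := h'.exists_flip
  exact h.nonempty_mulEquiv h'

end OD

/-- Any two finite groups of order `2^9 * 3^2 * 7 * 23 * 47^3 * 103` whose prime graphs have
vertex degrees deg 2 = 3, deg 3 = 1, deg 7 = 1, deg 23 = 1, deg 47 = 1, deg 103 = 1 are isomorphic (the
order and degree pattern of the simple unitary group `U_3(47)`). -/
theorem od_characterization_U_3_47
    (G H : Type*) [Group G] [Finite G] [Group H] [Finite H]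
    (hG : Nat.card G = 2^9 * 3^2 * 7 * 23 * 47^3 * 103)
    (hH : Nat.card H = 2^9 * 3^2 * 7 * 23 * 47^3 * 103)
    (hG2 : gkDegree G 2 = 3)
    (hG3 : gkDegree G 3 = 1)
    (hG7 : gkDegree G 7 = 1)
    (hG23 : gkDegree G 23 = 1)
    (hG47 : gkDegree G 47 = 1)
    (hG103 : gkDegree G 103 = 1)
    (hH2 : gkDegree H 2 = 3)
    (hH3 : gkDegree H 3 = 1)
    (hH7 : gkDegree H 7 = 1)
    (hH23 : gkDegree H 23 = 1)
    (hH47 : gkDegree H 47 = 1)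
    (hH103 : gkDegree H 103 = 1) :
    Nonempty (G ≃* H) := by
  exact (OD.hasPattern hG hG2 hG3 hG7 hG23 hG47 hG103).nonempty_mulEquiv
    (OD.hasPattern hH hH2 hH3 hH7 hH23 hH47 hH103)
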